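/- There exists an absolute constant c > 0 such that for every finite set P of n points in the plane ℝ², with n sufficiently large, the number |H(P)| of distinct hinges defined by P — that is, the cardinality of the image of P³ under the map (p,q,r) ↦ (‖p−q‖, ‖q−r‖) ∈ ℝ² — satisfies |H(P)| ≥ c · n² / (log n)³. -/

import Mathlib

open scoped Classical

noncomputable section

/-! ### Alternating labels -/

/-- The indicator (mod 2) that a sorted list of labels is strictly increasing with parities that
alternate, the first one being even iff `b` is true. -/
def altList : Bool → List ℕ → ZMod 2
  | _, [] => 1
  | b, c :: K => if decide (Even c) = b ∧ ∀ y ∈ K, c < y then altList (!b) K else 0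

theorem altList_eq_zero_of_not_nodup (b : Bool) (L : List ℕ) (h : ¬ L.Nodup) :
    altList b L = 0 := by
  induction L generalizing b with
  | nil => simp at h
  | cons c K ih =>
    rw [altList]
    split_ifs with hc
    · apply ih
      intro hK
      exact h (List.nodup_cons.2 ⟨fun hcK => lt_irrefl _ (hc.2 c hcK), hK⟩)
    · rfl

theorem altList_cons_of_lt (b : Bool) {c : ℕ} {K : List ℕ} (h : ∀ y ∈ K, c < y) :
    altList b (c :: K) = if decide (Even c) = b then altList (!b) K else 0 := by
  rw [altList]
  split_ifs <;> tauto

theorem sum_altList_erase (b : Bool) (L : List ℕ) (hL : L.Pairwise (· ≤ ·)) (h0 : L ≠ []) :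
    (L.map fun x => altList b (L.erase x)).sum = altList b L + altList (!b) L := by
  have two : ∀ z : ZMod 2, z + z = 0 := fun z => CharTwo.add_self_eq_zero z
  induction L generalizing b with
  | nil => exact absurd rfl h0
  | cons c K ih =>
    rw [List.pairwise_cons] at hL
    rw [List.map_cons, List.sum_cons, List.erase_cons_head]
    by_cases hlt : ∀ y ∈ K, c < y
    · have e1 : (K.map fun x => altList b ((c :: K).erase x)) =
          K.map fun x => if decide (Even c) = b then altList (!b) (K.erase x) else 0 := by
        refine List.map_congr_left fun x hx => ?_
        have hne : c ≠ x := (hlt x hx).ne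
        rw [List.erase_cons_tail (by simpa using hne),
          altList_cons_of_lt b fun y hy => hlt y (List.mem_of_mem_erase hy)]
      rw [e1]
      rcases eq_or_ne K [] with rfl | hK
      · cases b <;> by_cases hc : Even c <;> simp [altList, hc]
      · have := ih (!b) hL.2 hK
        have e3 : altList (!b) (c :: K) = if decide (Even c) = b then 0 else altList b K := by
          rw [altList_cons_of_lt _ hlt]
          cases b <;> by_cases hc : Even c <;> simp [hc]
        rw [altList_cons_of_lt b hlt, e3]
        split_ifs with hc
        · rw [this, Bool.not_not]
          linear_combination two (altList b K)
        · simp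
    · push Not at hlt
      obtain ⟨y, hy, hyc⟩ := hlt
      have hyc' : y = c := le_antisymm hyc (hL.1 y hy)
      subst hyc'
      obtain ⟨d, K', rfl⟩ : ∃ d K', K = d :: K' := List.exists_cons_of_ne_nil (List.ne_nil_of_mem
        hy)
      have hd : d = y := by
        rcases List.mem_cons.1 hy with h | h
        · exact h.symm
        · exact le_antisymm ((List.pairwise_cons.1 hL.2).1 y h) (hL.1 d (by simp))
      subst hd
      rw [altList_eq_zero_of_not_nodup b (d :: d :: K') (by simp),
        altList_eq_zero_of_not_nodup (!b) (d :: d :: K') (by simp), List.map_cons, List.sum_cons,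
        List.erase_cons_head, ← add_assoc, two, zero_add, add_zero]
      apply List.sum_eq_zero
      intro z hz
      obtain ⟨x, hx, rfl⟩ := List.mem_map.1 hz
      apply altList_eq_zero_of_not_nodup
      by_cases hxd : d = x
      · subst hxd
        rw [List.erase_cons_head]
        simp [hx]
      · rw [List.erase_cons_tail (by simpa using hxd), List.erase_cons_tail (by simpa using hxd)]
        simp

/-- `altList` of the sorted list of a multiset. -/
def altMultiset (b : Bool) (M : Multiset ℕ) : ZMod 2 := altList b (M.sort (· ≤ ·))

theorem sum_altMultiset_erase (b : Bool) (M : Multiset ℕ) (h0 : M ≠ 0) :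
    (M.map fun x => altMultiset b (M.erase x)).sum = altMultiset b M + altMultiset (!b) M := by
  have hs := Multiset.pairwise_sort M (· ≤ ·)
  have hM := Multiset.sort_eq M (· ≤ ·)
  set L := M.sort (· ≤ ·) with hL
  have key : ∀ x, altMultiset b (M.erase x) = altList b (L.erase x) := by
    intro x
    rw [altMultiset]
    congr 1
    refine List.Perm.eq_of_pairwise' (Multiset.pairwise_sort _ _) (hs.sublist List.erase_sublist) ?_
    rw [← Multiset.coe_eq_coe, Multiset.sort_eq, ← hM, Multiset.coe_erase]
  rw [altMultiset, altMultiset, ← hL, ← sum_altList_erase b L hs (by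
    rintro h; rw [h] at hM; exact h0 hM.symm)]
  simp_rw [key]
  rw [← hM, Multiset.map_coe, Multiset.sum_coe]

/-- The label with the same index and opposite sign. -/
def flipLabel (a : ℕ) : ℕ := if Even a then a + 1 else a - 1

theorem altList_map_flipLabel (b : Bool) (L : List ℕ)
    (hL : ∀ x ∈ L, ∀ y ∈ L, x < y ↔ flipLabel x < flipLabel y) :
    altList b (L.map flipLabel) = altList (!b) L := by
  induction L generalizing b with
  | nil => rfl
  | cons c K ih =>
    rw [List.map_cons, altList, altList,
      ih _ (fun x hx y hy => hL x (List.mem_cons_of_mem _ hx) y (List.mem_cons_of_mem _ hy))]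
    congr 1
    simp only [eq_iff_iff]
    refine and_congr ?_ ?_
    · have : Even (flipLabel c) ↔ ¬ Even c := by
        rw [flipLabel]; split_ifs with h
        · simp [h, Nat.even_add_one]
        · obtain ⟨k, rfl⟩ := Nat.not_even_iff_odd.1 h; simp
      by_cases h : Even c <;> cases b <;> simp [this, h]
    · simp only [List.mem_map, forall_exists_index, and_imp, forall_apply_eq_imp_iff₂]
      exact forall₂_congr fun y hy => (hL c (by simp) y (by simp [hy])).symm

theorem flipLabel_lt_iff {x y : ℕ} (h : x / 2 = y / 2 → x = y) :
    x < y ↔ flipLabel x < flipLabel y := by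
  unfold flipLabel
  rcases Nat.even_or_odd' x with ⟨k, rfl | rfl⟩ <;> rcases Nat.even_or_odd' y with ⟨l, rfl | rfl⟩
    <;>
  · simp
    try omega

theorem altMultiset_map_flipLabel (b : Bool) (M : Multiset ℕ)
    (hM : ∀ x ∈ M, ∀ y ∈ M, x / 2 = y / 2 → x = y) :
    altMultiset b (M.map flipLabel) = altMultiset (!b) M := by
  have hs := Multiset.pairwise_sort M (· ≤ ·)
  have hM' := Multiset.sort_eq M (· ≤ ·)
  rw [altMultiset, altMultiset]
  set L := M.sort (· ≤ ·) with hL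
  have hlt : ∀ x ∈ L, ∀ y ∈ L, x < y ↔ flipLabel x < flipLabel y := by
    intro x hx y hy
    exact flipLabel_lt_iff (hM x (by rw [← hM']; exact hx) y (by rw [← hM']; exact hy))
  rw [← altList_map_flipLabel b L hlt]
  congr 1
  refine List.Perm.eq_of_pairwise' (Multiset.pairwise_sort _ _) ?_ ?_
  · rw [List.pairwise_map]
    refine List.Pairwise.imp_of_mem ?_ hs
    intro x y hx hy hxy
    rcases hxy.lt_or_eq with h | rfl
    · exact ((hlt x hx y hy).1 h).le
    · exact le_rfl
  · rw [← Multiset.coe_eq_coe, Multiset.sort_eq, ← hM', Multiset.map_coe]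

theorem altMultiset_eq_zero_of_card {m : ℕ} (b : Bool) (M : Multiset ℕ)
    (hM : ∀ x ∈ M, ∀ y ∈ M, x / 2 = y / 2 → x = y) (hlt : ∀ x ∈ M, x < 2 * m)
    (hc : m < Multiset.card M) : altMultiset b M = 0 := by
  apply altList_eq_zero_of_not_nodup
  rw [← Multiset.coe_nodup, Multiset.sort_eq]
  intro hn
  have h1 : (M.map (· / 2)).Nodup := Multiset.Nodup.map_on hM hn
  have h2 : M.map (· / 2) ≤ Multiset.range m := by
    rw [Multiset.le_iff_subset h1]
    intro z hz
    obtain ⟨x, hx, rfl⟩ := Multiset.mem_map.1 hz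
    rw [Multiset.mem_range]
    have := hlt x hx
    omega
  have := Multiset.card_le_card h2
  simp at this
  omega

/-! ### Chains of simplices modulo two -/

/-- Formal sums modulo two of simplices, a simplex being a multiset of vertices. -/
abbrev Chain (E : Type*) := Multiset E →₀ ZMod 2

namespace Chain

variable {E F : Type*}

/-- The chain consisting of one simplex. -/
def simplex (M : Multiset E) : Chain E := Finsupp.single M 1

/-- Linear extension of a map defined on simplices. -/
def extend {V : Type*} [AddCommGroup V] [Module (ZMod 2) V] (f : Multiset E → V) :
    Chain E →ₗ[ZMod 2] V := Finsupp.linearCombination (ZMod 2) f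

@[simp] theorem extend_simplex {V : Type*} [AddCommGroup V] [Module (ZMod 2) V]
    (f : Multiset E → V) (M : Multiset E) : extend f (simplex M) = f M := by
  simp [extend, simplex]

theorem hom_ext {V : Type*} [AddCommGroup V] [Module (ZMod 2) V] {f g : Chain E →ₗ[ZMod 2] V}
    (h : ∀ M, f (simplex M) = g (simplex M)) : f = g := by
  refine Finsupp.lhom_ext fun M c => ?_
  have : (Finsupp.single M c : Chain E) = c • simplex M := by simp [simplex]
  rw [this, map_smul, map_smul, h]

/-- Chains all of whose simplices satisfy a property. -/
def allSat (Q : Multiset E → Prop) : Submodule (ZMod 2) (Chain E) :=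
  Submodule.span (ZMod 2) (simplex '' {M | Q M})

theorem simplex_mem {Q : Multiset E → Prop} {M : Multiset E} (h : Q M) : simplex M ∈ allSat Q :=
  Submodule.subset_span ⟨M, h, rfl⟩

theorem map_mem {V : Type*} [AddCommGroup V] [Module (ZMod 2) V] {Q : Multiset E → Prop}
    (f : Chain E →ₗ[ZMod 2] V) (W : Submodule (ZMod 2) V) (h : ∀ M, Q M → f (simplex M) ∈ W)
    {P : Chain E} (hP : P ∈ allSat Q) : f P ∈ W := by
  have : allSat Q ≤ W.comap f := by
    rw [allSat, Submodule.span_le]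
    rintro _ ⟨M, hM, rfl⟩
    exact h M hM
  exact this hP

theorem eq_on {V : Type*} [AddCommGroup V] [Module (ZMod 2) V] {Q : Multiset E → Prop}
    (f g : Chain E →ₗ[ZMod 2] V) (h : ∀ M, Q M → f (simplex M) = g (simplex M))
    {P : Chain E} (hP : P ∈ allSat Q) : f P = g P := by
  have := map_mem (f - g) ⊥ (fun M hM => by simp [h M hM]) hP
  simpa [sub_eq_zero] using this

theorem allSat_mono {Q Q' : Multiset E → Prop} (h : ∀ M, Q M → Q' M) : allSat Q ≤ allSat Q' :=
  Submodule.span_mono (Set.image_mono h)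

theorem add_self (P : Chain E) : P + P = 0 := by
  rw [← two_smul (ZMod 2) P]
  have : (2 : ZMod 2) = 0 := by decide
  rw [this, zero_smul]

/-- The boundary operator. -/
def bd : Chain E →ₗ[ZMod 2] Chain E := extend fun M => (M.map fun x => simplex (M.erase x)).sum

/-- The cone over a chain. -/
def cone (x : E) : Chain E →ₗ[ZMod 2] Chain E := extend fun M => simplex (x ::ₘ M)

/-- The image of a chain under a map of vertices. -/
def push (f : E → F) : Chain E →ₗ[ZMod 2] Chain F := extend fun M => simplex (M.map f)

theorem bd_cone (x : E) (P : Chain E) : bd (cone x P) = P + cone x (bd P) := by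
  have : bd ∘ₗ cone x = LinearMap.id + cone x ∘ₗ bd := by
    refine hom_ext fun M => ?_
    simp only [LinearMap.comp_apply, cone, bd, extend_simplex, LinearMap.add_apply,
      LinearMap.id_apply, Multiset.map_cons, Multiset.sum_cons, Multiset.erase_cons_head,
      map_multiset_sum, Multiset.map_map, Function.comp]
    congr 2
    refine Multiset.map_congr rfl fun y hy => ?_
    rw [Multiset.erase_cons_tail_of_mem hy]
  exact LinearMap.congr_fun this P

theorem bd_empty : bd (simplex (0 : Multiset E)) = 0 := by simp [bd]

theorem bd_bd (P : Chain E) : bd (bd P) = 0 := by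
  have : (bd ∘ₗ bd : Chain E →ₗ[ZMod 2] Chain E) = 0 := by
    refine hom_ext fun M => ?_
    induction M using Multiset.induction_on with
    | empty => simp [bd_empty]
    | cons x M ih =>
      have e : simplex (x ::ₘ M) = cone x (simplex M) := by simp [cone]
      simp only [LinearMap.comp_apply, LinearMap.zero_apply] at ih
      rw [e, LinearMap.comp_apply, bd_cone, map_add, bd_cone, ih]
      simp [add_self]
  exact LinearMap.congr_fun this P

theorem push_cone (f : E → F) (x : E) (P : Chain E) :
    push f (cone x P) = cone (f x) (push f P) := by
  have : push f ∘ₗ cone x = cone (f x) ∘ₗ push f := hom_ext fun M => by simp [push, cone]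
  exact LinearMap.congr_fun this P

theorem bd_push (f : E → F) (P : Chain E) : bd (push f P) = push f (bd P) := by
  have : bd ∘ₗ push f = push f ∘ₗ bd := by
    refine hom_ext fun M => ?_
    simp only [LinearMap.comp_apply, push, bd, extend_simplex, map_multiset_sum, Multiset.map_map,
      Function.comp]
    congr 1
    refine Multiset.map_congr rfl fun y hy => ?_
    rw [Multiset.map_erase_of_mem _ _ hy]
  exact LinearMap.congr_fun this P

theorem bd_mem {n : ℕ} {P : Chain E} (hP : P ∈ allSat fun M : Multiset E => M.card = n + 1) :
    bd P ∈ allSat fun M : Multiset E => M.card = n := by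
  refine map_mem bd _ (fun M hM => ?_) hP
  rw [bd, extend_simplex]
  refine multiset_sum_mem _ fun z hz => ?_
  obtain ⟨x, hx, rfl⟩ := Multiset.mem_map.1 hz
  exact simplex_mem (by rw [Multiset.card_erase_of_mem hx, hM]; rfl)

end Chain

namespace Chain

variable {E : Type*} [NormedAddCommGroup E] [NormedSpace ℝ E]

/-- The barycenter of a simplex. -/
def bary (M : Multiset E) : E := (M.card : ℝ)⁻¹ • M.sum

/-- Barycentric subdivision of simplices with `n` vertices. -/
def subdiv : ℕ → Chain E →ₗ[ZMod 2] Chain E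
  | 0 => LinearMap.id
  | n + 1 => extend fun M => cone (bary M) (subdiv n (bd (simplex M)))

theorem bd_subdiv_succ (n : ℕ) {P : Chain E}
    (hP : P ∈ allSat fun M : Multiset E => M.card = n + 1) :
    bd (subdiv (n + 1) P) = subdiv n (bd P) := by
  induction n generalizing P with
  | zero =>
    have h : ∀ M : Multiset E, M.card = 0 + 1 →
        (bd ∘ₗ subdiv (0 + 1)) (simplex M) = (subdiv 0 ∘ₗ bd) (simplex M) := ?_
    · exact eq_on _ _ h hP
    intro M hM
    obtain ⟨x, rfl⟩ := Multiset.card_eq_one.1 hM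
    have e : bd (simplex {x}) = simplex (0 : Multiset E) := by simp [bd]
    simp [subdiv, bd_cone, e, bd_empty]
  | succ n ih =>
    have h : ∀ M : Multiset E, M.card = n + 1 + 1 →
        (bd ∘ₗ subdiv (n + 1 + 1)) (simplex M) = (subdiv (n + 1) ∘ₗ bd) (simplex M) := ?_
    · exact eq_on _ _ h hP
    intro M hM
    have h1 := ih (bd_mem (simplex_mem hM))
    rw [LinearMap.comp_apply, subdiv, extend_simplex, bd_cone, h1, bd_bd]
    simp

theorem subdiv_push_neg (n : ℕ) (P : Chain E) :
    subdiv n (push (fun x : E => -x) P) = push (fun x : E => -x) (subdiv n P) := by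
  induction n generalizing P with
  | zero => rfl
  | succ n ih =>
    have : subdiv (n + 1) ∘ₗ push (fun x : E => -x) = push (fun x : E => -x) ∘ₗ subdiv (n + 1) := by
      refine hom_ext fun M => ?_
      have e : simplex (M.map fun x : E => -x) = push (fun x : E => -x) (simplex M) := by simp
        [push]
      rw [LinearMap.comp_apply, ← e, subdiv, extend_simplex, e, bd_push, ih, LinearMap.comp_apply,
        extend_simplex, push_cone]
      congr 2
      simp [bary, Multiset.sum_map_neg']
    exact LinearMap.congr_fun this P

/-- Simplices in a set `A` having `n` vertices and diameter at most `ε`. -/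
def IsSmall (A : Set E) (ε : ℝ) (n : ℕ) (M : Multiset E) : Prop :=
  M.card = n ∧ (∀ x ∈ M, x ∈ A) ∧ ∀ x ∈ M, ∀ y ∈ M, dist x y ≤ ε

theorem bary_mem_convexHull {M : Multiset E} (h0 : M ≠ 0) :
    bary M ∈ convexHull ℝ {x | x ∈ M} := by
  have hc : (M.card : ℝ) ≠ 0 := by simpa using h0
  have hsum : M.sum = ∑ x ∈ M.toFinset, (M.count x : ℝ) • x := by
    rw [Finset.sum_multiset_count]
    exact Finset.sum_congr rfl fun x _ => (Nat.cast_smul_eq_nsmul ℝ _ x).symm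
  rw [bary, hsum, Finset.smul_sum]
  simp_rw [smul_smul]
  refine (convex_convexHull ℝ _).sum_mem (fun x _ => by positivity) ?_ (fun x hx => ?_)
  · rw [← Finset.mul_sum, ← Nat.cast_sum, Multiset.toFinset_sum_count_eq, inv_mul_cancel₀ hc]
  · exact subset_convexHull ℝ _ (Multiset.mem_toFinset.1 hx)

theorem dist_bary_le {M : Multiset E} {ε : ℝ} {n : ℕ} (hc : M.card = n + 1)
    (hε : ∀ x ∈ M, ∀ y ∈ M, dist x y ≤ ε) {x : E} (hx : x ∈ M) :
    dist (bary M) x ≤ n / (n + 1) * ε := by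
  obtain ⟨K, rfl⟩ := Multiset.exists_cons_of_mem hx
  have hK : K.card = n := by simpa using hc
  have h1 : bary (x ::ₘ K) - x = ((n : ℝ) + 1)⁻¹ • (K.map fun y => y - x).sum := by
    rw [Multiset.sum_map_sub, bary, hc]
    simp only [Multiset.sum_cons, Multiset.map_id', Multiset.map_const', Multiset.sum_replicate, hK]
    have : ((n : ℝ) + 1) ≠ 0 := by positivity
    have e : x = ((n : ℝ) + 1)⁻¹ • (((n : ℝ) + 1) • x) := by rw [smul_smul, inv_mul_cancel₀ this,
      one_smul]
    rw [← Nat.cast_smul_eq_nsmul ℝ n x]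
    push_cast
    nth_rw 2 [e]
    rw [← smul_sub]
    congr 1
    module
  have h2 : ‖(K.map fun y => y - x).sum‖ ≤ n * ε := by
    have : ((K.map fun y => y - x).map norm).sum ≤ n * ε := by
      have := Multiset.sum_le_card_nsmul ((K.map fun y => y - x).map norm) ε (by
        intro z hz
        rw [Multiset.map_map, Multiset.mem_map] at hz
        obtain ⟨y, hy, rfl⟩ := hz
        have := hε y (by simp [hy]) x (by simp)
        rwa [dist_eq_norm] at this)
      simpa [hK] using this
    exact (norm_multiset_sum_le _).trans this
  rw [dist_eq_norm, h1, norm_smul, Real.norm_of_nonneg (by positivity), div_mul_eq_mul_div,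
    inv_mul_eq_div]
  gcongr

theorem subdiv_simplex_mem {m n : ℕ} (hn : n ≤ m + 1) {ε : ℝ} {M : Multiset E} (hc : M.card = n)
    (hε : ∀ x ∈ M, ∀ y ∈ M, dist x y ≤ ε) :
    subdiv n (simplex M) ∈
      allSat (IsSmall (convexHull ℝ {x | x ∈ M}) (m / (m + 1) * ε) n) := by
  induction n generalizing M with
  | zero =>
    rw [Multiset.card_eq_zero] at hc
    subst hc
    exact simplex_mem ⟨rfl, by simp, by simp⟩
  | succ n ih =>
    have h0 : M ≠ 0 := by rintro rfl; simp at hc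
    obtain ⟨x0, hx0⟩ := Multiset.exists_mem_of_ne_zero h0
    have hε0 : 0 ≤ ε := by simpa using hε x0 hx0 x0 hx0
    have h1 : subdiv n (bd (simplex M)) ∈
        allSat (IsSmall (convexHull ℝ {x | x ∈ M}) (m / (m + 1) * ε) n) := by
      rw [bd, extend_simplex, map_multiset_sum]
      refine multiset_sum_mem _ fun z hz => ?_
      rw [Multiset.map_map, Multiset.mem_map] at hz
      obtain ⟨x, hx, rfl⟩ := hz
      have hsub : ∀ y ∈ M.erase x, y ∈ M := fun y hy => Multiset.mem_of_mem_erase hy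
      refine allSat_mono ?_ (ih (by omega) (M := M.erase x)
        (by rw [Multiset.card_erase_of_mem hx, hc]; rfl)
        fun y hy z hz => hε y (hsub y hy) z (hsub z hz))
      rintro K ⟨a, b, c⟩
      exact ⟨a, fun y hy => convexHull_mono hsub (b y hy), c⟩
    rw [subdiv, extend_simplex]
    refine map_mem (cone (bary M)) _ ?_ h1
    rintro K ⟨a, b, c⟩
    rw [cone, extend_simplex]
    have hb : ∀ y ∈ K, dist (bary M) y ≤ m / (m + 1) * ε := by
      intro y hy
      have : convexHull ℝ {x | x ∈ M} ⊆ Metric.closedBall (bary M) (m / (m + 1) * ε) := by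
        refine convexHull_min (fun x hx => ?_) (convex_closedBall _ _)
        rw [Metric.mem_closedBall, dist_comm]
        refine (dist_bary_le hc hε hx).trans ?_
        gcongr ?_ * _
        rw [div_le_div_iff₀ (by positivity) (by positivity)]
        have : (n : ℝ) ≤ m := by exact_mod_cast Nat.le_of_succ_le_succ hn
        nlinarith
      simpa [dist_comm] using this (b y hy)
    have hnn : 0 ≤ (m : ℝ) / (m + 1) * ε := by positivity
    refine simplex_mem ⟨by simp [a], ?_, ?_⟩
    · intro x hx
      rcases Multiset.mem_cons.1 hx with rfl | hx
      · exact bary_mem_convexHull h0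
      · exact b x hx
    · intro x hx y hy
      rcases Multiset.mem_cons.1 hx with rfl | hx <;> rcases Multiset.mem_cons.1 hy with rfl | hy
      · simpa using hnn
      · exact hb y hy
      · rw [dist_comm]; exact hb x hx
      · exact c x hx y hy

theorem subdiv_mem {m n : ℕ} (hn : n ≤ m + 1) {ε : ℝ} {𝓐 : Set (Set E)} (hA : ∀ A ∈ 𝓐, Convex ℝ A)
    {P : Chain E} (hP : P ∈ allSat fun M => ∃ A ∈ 𝓐, IsSmall A ε n M) :
    subdiv n P ∈ allSat fun M => ∃ A ∈ 𝓐, IsSmall A (m / (m + 1) * ε) n M := by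
  refine map_mem (subdiv n) _ ?_ hP
  rintro M ⟨A, hA', a, b, c⟩
  refine allSat_mono ?_ (subdiv_simplex_mem hn a c)
  rintro K ⟨a', b', c'⟩
  exact ⟨A, hA', a', fun x hx => convexHull_min b (hA A hA') (b' x hx), c'⟩

theorem iterate_subdiv_mem {m n : ℕ} (hn : n ≤ m + 1) {ε : ℝ} {𝓐 : Set (Set E)}
    (hA : ∀ A ∈ 𝓐, Convex ℝ A) {P : Chain E}
    (hP : P ∈ allSat fun M => ∃ A ∈ 𝓐, IsSmall A ε n M) (r : ℕ) :
    (subdiv n)^[r] P ∈ allSat fun M => ∃ A ∈ 𝓐, IsSmall A ((m / (m + 1)) ^ r * ε) n M := by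
  induction r with
  | zero => simpa using hP
  | succ r ih =>
    rw [Function.iterate_succ_apply', pow_succ', mul_assoc]
    exact subdiv_mem hn hA ih

theorem bd_iterate_subdiv {n : ℕ} {P : Chain E}
    (hP : P ∈ allSat fun M : Multiset E => M.card = n + 1)
    (r : ℕ) : (subdiv (n + 1))^[r] P ∈ (allSat fun M : Multiset E => M.card = n + 1) ∧
      bd ((subdiv (n + 1))^[r] P) = (subdiv n)^[r] (bd P) := by
  induction r with
  | zero => exact ⟨hP, rfl⟩
  | succ r ih =>
    rw [Function.iterate_succ_apply', Function.iterate_succ_apply']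
    refine ⟨?_, by rw [bd_subdiv_succ n ih.1, ih.2]⟩
    refine map_mem (subdiv (n + 1)) _ ?_ ih.1
    intro M hM
    have hb : ∃ ε : ℝ, ∀ x ∈ M, ∀ y ∈ M, dist x y ≤ ε := by
      refine ⟨∑ x ∈ M.toFinset, ∑ y ∈ M.toFinset, dist x y, fun x hx y hy => ?_⟩
      refine (Finset.single_le_sum (f := fun y => dist x y) (fun _ _ => dist_nonneg)
        (Multiset.mem_toFinset.2 hy)).trans ?_
      exact Finset.single_le_sum (f := fun x => ∑ y ∈ M.toFinset, dist x y)
        (fun _ _ => Finset.sum_nonneg fun _ _ => dist_nonneg) (Multiset.mem_toFinset.2 hx)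
    obtain ⟨ε, hε⟩ := hb
    exact allSat_mono (fun K hK => hK.1) (subdiv_simplex_mem (m := n) le_rfl hM hε)

end Chain

namespace Chain

/-- The point `x ↦ -x` pushforward of a chain. -/
abbrev antipode {E : Type*} [NormedAddCommGroup E] : Chain E →ₗ[ZMod 2] Chain E :=
  push fun x : E => -x

/-- The `d`-th standard basis vector. -/
def stdVec (m d : ℕ) : Fin (m + 1) → ℝ := fun i => if (i : ℕ) = d then 1 else 0

/-- A triangulated `d`-dimensional hemisphere of the cross-polytope. -/
def hemi (m : ℕ) : ℕ → Chain (Fin (m + 1) → ℝ)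
  | 0 => simplex {stdVec m 0}
  | d + 1 => cone (stdVec m (d + 1)) (hemi m d + antipode (hemi m d))

theorem antipode_antipode {E : Type*} [NormedAddCommGroup E] (P : Chain E) :
    antipode (antipode P) = P := by
  have : antipode ∘ₗ antipode = (LinearMap.id : Chain E →ₗ[ZMod 2] Chain E) :=
    hom_ext fun M => by simp [antipode, push]
  exact LinearMap.congr_fun this P

theorem bd_hemi_zero (m : ℕ) : bd (hemi m 0) = simplex 0 := by simp [hemi, bd]

theorem bd_hemi_succ (m d : ℕ) : bd (hemi m (d + 1)) = hemi m d + antipode (hemi m d) := by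
  have h : antipode (bd (hemi m d)) = bd (hemi m d) := by
    induction d with
    | zero => rw [bd_hemi_zero]; simp [antipode, push]
    | succ d ih =>
      have : bd (hemi m (d + 1)) = hemi m d + antipode (hemi m d) := by
        rw [hemi, bd_cone, map_add, antipode, bd_push, ih, add_self, map_zero, add_zero]
      rw [this, map_add, antipode_antipode]
      exact add_comm _ _
  rw [hemi, bd_cone, map_add, antipode, bd_push, h, add_self, map_zero, add_zero]

/-- A face of the cross-polytope. -/
def crossFace {m : ℕ} (s : Fin (m + 1) → ℝ) : Set (Fin (m + 1) → ℝ) :=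
  {x | (∀ i, 0 ≤ s i * x i) ∧ ∑ i, s i * x i = 1}

/-- The faces of the cross-polytope. -/
def crossFaces (m : ℕ) : Set (Set (Fin (m + 1) → ℝ)) :=
  {A | ∃ s : Fin (m + 1) → ℝ, (∀ i, s i = 1 ∨ s i = -1) ∧ A = crossFace s}

theorem convex_of_mem_crossFaces {m : ℕ} {A : Set (Fin (m + 1) → ℝ)} (hA : A ∈ crossFaces m) :
    Convex ℝ A := by
  obtain ⟨s, -, rfl⟩ := hA
  intro x hx y hy a b ha hb hab
  refine ⟨fun i => ?_, ?_⟩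
  · have : s i * (a • x + b • y) i = a * (s i * x i) + b * (s i * y i) := by
      simp; ring
    rw [this]
    have := hx.1 i
    have := hy.1 i
    positivity
  · have : ∀ i, s i * (a • x + b • y) i = a * (s i * x i) + b * (s i * y i) := by
      intro i; simp; ring
    simp_rw [this, Finset.sum_add_distrib, ← Finset.mul_sum, hx.2, hy.2]
    linarith

theorem abs_sum_of_mem_crossFaces {m : ℕ} {A : Set (Fin (m + 1) → ℝ)} (hA : A ∈ crossFaces m)
    {x : Fin (m + 1) → ℝ} (hx : x ∈ A) : ∑ i, |x i| = 1 := by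
  obtain ⟨s, hs, rfl⟩ := hA
  rw [← hx.2]
  refine Finset.sum_congr rfl fun i _ => ?_
  have := hx.1 i
  rcases hs i with h | h <;> rw [h] at this ⊢
  · rw [abs_of_nonneg] <;> linarith
  · rw [abs_of_nonpos] <;> linarith

theorem hemi_mem_aux (m d : ℕ) : hemi m d ∈ allSat fun M =>
    M.card = d + 1 ∧ ∃ s : Fin (m + 1) → ℝ, (∀ i, s i = 1 ∨ s i = -1) ∧
      ∀ x ∈ M, ∃ k ≤ d, ∀ i, x i = s i * stdVec m k i := by
  induction d with
  | zero =>
    refine simplex_mem ⟨rfl, fun _ => 1, by simp, ?_⟩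
    intro x hx
    rw [Multiset.mem_singleton] at hx
    exact ⟨0, le_rfl, by simp [hx]⟩
  | succ d ih =>
    refine map_mem (cone _) _ (Q := fun M => M.card = d + 1 ∧ ∃ s : Fin (m + 1) → ℝ,
      (∀ i, s i = 1 ∨ s i = -1) ∧ ∀ x ∈ M, ∃ k ≤ d, ∀ i, x i = s i * stdVec m k i) ?_ ?_
    · rintro M ⟨hc, s, hs, hM⟩
      rw [cone, extend_simplex]
      refine simplex_mem ⟨by simp [hc], fun i => if (i : ℕ) = d + 1 then 1 else s i, ?_, ?_⟩
      · intro i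
        dsimp only
        split_ifs
        · simp
        · exact hs i
      · intro x hx
        rcases Multiset.mem_cons.1 hx with rfl | hx
        · refine ⟨d + 1, le_rfl, fun i => ?_⟩
          simp only [stdVec]
          split_ifs <;> simp
        · obtain ⟨k, hk, h⟩ := hM x hx
          refine ⟨k, by omega, fun i => ?_⟩
          rw [h i]
          simp only [stdVec]
          split_ifs <;> first | omega | simp
    · refine Submodule.add_mem _ ih (map_mem _ _ ?_ ih)
      rintro M ⟨hc, s, hs, hM⟩
      rw [antipode, push, extend_simplex]
      refine simplex_mem ⟨by simp [hc], fun i => - s i, ?_, ?_⟩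
      · intro i
        rcases hs i with h | h <;> simp [h]
      · intro x hx
        obtain ⟨y, hy, rfl⟩ := Multiset.mem_map.1 hx
        obtain ⟨k, hk, h⟩ := hM y hy
        exact ⟨k, hk, fun i => by simp [h i]⟩

theorem hemi_mem {m d : ℕ} (hd : d ≤ m) :
    hemi m d ∈ allSat fun M => ∃ A ∈ crossFaces m, IsSmall A 2 (d + 1) M := by
  refine allSat_mono ?_ (hemi_mem_aux m d)
  rintro M ⟨hc, s, hs, hM⟩
  have hface : ∀ x ∈ M, x ∈ crossFace s := by
    intro x hx
    obtain ⟨k, hk, h⟩ := hM x hx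
    have hss : ∀ i, s i * x i = stdVec m k i := by
      intro i
      rw [h i]
      rcases hs i with h | h <;> simp [h]
    refine ⟨fun i => ?_, ?_⟩
    · rw [hss, stdVec]; split_ifs <;> simp
    · simp_rw [hss, stdVec]
      rw [Finset.sum_eq_single (⟨k, by omega⟩ : Fin (m + 1))]
      · simp
      · intro b _ hb
        rw [if_neg]
        intro h
        exact hb (Fin.ext h)
      · simp
  refine ⟨crossFace s, ⟨s, hs, rfl⟩, hc, hface, ?_⟩
  have hn : ∀ x ∈ M, ‖x‖ ≤ 1 := by
    intro x hx
    rw [pi_norm_le_iff_of_nonneg zero_le_one]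
    intro i
    rw [Real.norm_eq_abs, ← abs_sum_of_mem_crossFaces ⟨s, hs, rfl⟩ (hface x hx)]
    exact Finset.single_le_sum (f := fun i => |x i|) (fun _ _ => abs_nonneg _) (Finset.mem_univ i)
  intro x hx y hy
  have := dist_le_norm_add_norm x y
  linarith [hn x hx, hn y hy]

/-- The functional counting alternating simplices of a labelled chain. -/
def altFun {E : Type*} (lab : E → ℕ) (b : Bool) : Chain E →ₗ[ZMod 2] ZMod 2 :=
  extend fun M => altMultiset b (M.map lab)

theorem altFun_bd {E : Type*} (lab : E → ℕ) (b : Bool) {n : ℕ} {P : Chain E}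
    (hP : P ∈ allSat fun M : Multiset E => M.card = n + 1) :
    altFun lab b (bd P) = altFun lab b P + altFun lab (!b) P := by
  refine eq_on (altFun lab b ∘ₗ bd) (altFun lab b + altFun lab (!b)) (fun M hM => ?_) hP
  have h0 : M ≠ 0 := by rintro rfl; simp at hM
  simp only [LinearMap.comp_apply, LinearMap.add_apply, altFun, bd, extend_simplex]
  rw [← sum_altMultiset_erase b (M.map lab) (by simpa using h0), map_multiset_sum, Multiset.map_map,
    Multiset.map_map]
  congr 1
  refine Multiset.map_congr rfl fun x hx => ?_
  simp only [Function.comp, extend_simplex]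
  rw [Multiset.map_erase_of_mem _ _ hx]

end Chain

open Chain

/-- **Borsuk–Ulam theorem**: an odd continuous map lowering the dimension has a nontrivial zero. -/
theorem exists_zero_of_odd {m : ℕ} (g : (Fin (m + 1) → ℝ) → (Fin m → ℝ)) (hg : Continuous g)
    (hodd : ∀ x, g (-x) = -g x) : ∃ x, x ≠ 0 ∧ g x = 0 := by
  by_contra! hne
  have hm : m ≠ 0 := by
    rintro rfl
    exact hne (fun _ => 1) (fun h => one_ne_zero (congrFun h 0)) (Subsingleton.elim _ _)
  have hNE : Nonempty (Fin m) := ⟨⟨0, Nat.pos_of_ne_zero hm⟩⟩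
  set K : Set (Fin (m + 1) → ℝ) := {x | ∑ i, |x i| = 1} with hK
  have hKc : IsCompact K := by
    refine Metric.isCompact_of_isClosed_isBounded ?_ ?_
    · exact isClosed_eq (by fun_prop) continuous_const
    · refine (Metric.isBounded_closedBall (x := (0 : Fin (m + 1) → ℝ)) (r := 1)).subset ?_
      intro x hx
      rw [mem_closedBall_zero_iff, pi_norm_le_iff_of_nonneg zero_le_one]
      intro i
      rw [Real.norm_eq_abs, ← (show ∑ i, |x i| = 1 from hx)]
      exact Finset.single_le_sum (f := fun i => |x i|) (fun _ _ => abs_nonneg _) (Finset.mem_univ i)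
  have hK0 : ∀ x ∈ K, g x ≠ 0 := by
    intro x hx
    refine hne x ?_
    rintro rfl
    simp [hK] at hx
  have hKne : K.Nonempty := by
    refine ⟨Pi.single 0 1, ?_⟩
    rw [hK, Set.mem_ofPred_eq, Finset.sum_eq_single 0] <;> simp +contextual
  obtain ⟨x0, hx0, hmin⟩ := hKc.exists_isMinOn hKne (hg.norm.continuousOn)
  set δ := ‖g x0‖ with hδ
  have hδ0 : 0 < δ := norm_pos_iff.2 (hK0 x0 hx0)
  have hargmax : ∀ v : Fin m → ℝ, ∃ i, ∀ j, v j ≤ v i := fun v => Finite.exists_max v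
  choose amax hamax using hargmax
  set idx : (Fin (m + 1) → ℝ) → Fin m := fun x => amax fun i => |g x i| with hidx
  have hidx_neg : ∀ x, idx (-x) = idx x := by
    intro x; simp [hidx, hodd]
  have hbig : ∀ x ∈ K, δ ≤ |g x (idx x)| := by
    intro x hx
    refine le_trans (hmin hx) ?_
    rw [pi_norm_le_iff_of_nonneg (abs_nonneg _)]
    exact fun j => hamax (fun i => |g x i|) j
  set lab : (Fin (m + 1) → ℝ) → ℕ := fun x => 2 * (idx x : ℕ) + if 0 < g x (idx x) then 0 else 1
    with hlab
  have hlab_neg : ∀ x ∈ K, lab (-x) = flipLabel (lab x) := by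
    intro x hx
    have h1 : g x (idx x) ≠ 0 := by
      have := hbig x hx
      intro h
      rw [h, abs_zero] at this
      linarith
    simp only [hlab, hidx_neg, hodd, Pi.neg_apply, flipLabel]
    rcases lt_or_gt_of_ne h1 with h | h
    · have h' : ¬ 0 < g x (idx x) := not_lt.2 h.le
      simp [h, h', parity_simps]
    · have h' : ¬ g x (idx x) < 0 := not_lt.2 h.le
      simp [h, h', parity_simps]
  have hlab_lt : ∀ x, lab x < 2 * m := by
    intro x
    have := (idx x).2
    simp only [hlab]
    split_ifs <;> omega
  have huc := hKc.uniformContinuousOn_of_continuous hg.continuousOn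
  rw [Metric.uniformContinuousOn_iff] at huc
  obtain ⟨η, hη, huc⟩ := huc δ hδ0
  have hsame : ∀ x ∈ K, ∀ y ∈ K, dist x y < η → lab x / 2 = lab y / 2 → lab x = lab y := by
    intro x hx y hy hxy h
    have h1 := huc x hx y hy hxy
    have hi : idx x = idx y := by
      apply Fin.ext
      simp only [hlab] at h
      split_ifs at h <;> omega
    have h2 : |g x (idx x) - g y (idx x)| < δ := by
      refine lt_of_le_of_lt ?_ h1
      rw [dist_eq_norm]
      exact norm_le_pi_norm (g x - g y) (idx x)
    have h3 := hbig x hx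
    have h4 := hbig y hy
    rw [← hi] at h4
    simp only [hlab, ← hi]
    rw [abs_lt] at h2
    by_cases hp : 0 < g x (idx x) <;> by_cases hq : 0 < g y (idx x) <;> simp only [hp, hq, if_true,
      if_false]
    · rw [abs_of_pos hp] at h3
      linarith [not_lt.1 hq]
    · rw [abs_of_pos hq] at h4
      linarith [not_lt.1 hp]
  obtain ⟨r, hr⟩ : ∃ r : ℕ, ((m : ℝ) / (m + 1)) ^ r * 2 < η := by
    have h1 : (m : ℝ) / (m + 1) < 1 := by rw [div_lt_one (by positivity)]; linarith
    obtain ⟨r, hr⟩ := exists_pow_lt_of_lt_one (half_pos hη) h1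
    exact ⟨r, by linarith⟩
  have hcard : ∀ d ≤ m, hemi m d ∈ allSat fun M : Multiset (Fin (m + 1) → ℝ) => M.card = d + 1 :=
    fun d hd => allSat_mono (fun M hM => hM.choose_spec.2.1) (hemi_mem hd)
  set H : ℕ → Chain (Fin (m + 1) → ℝ) := fun d => (subdiv (d + 1))^[r] (hemi m d) with hH
  have hsmall : ∀ d ≤ m, H d ∈ allSat fun M => M.card = d + 1 ∧ (∀ x ∈ M, x ∈ K) ∧
      ∀ x ∈ M, ∀ y ∈ M, lab x / 2 = lab y / 2 → lab x = lab y := by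
    intro d hd
    refine allSat_mono ?_ (iterate_subdiv_mem (m := m) (by omega)
      (fun A => convex_of_mem_crossFaces) (hemi_mem hd) r)
    rintro M ⟨A, hA, h1, h2, h3⟩
    have hMK : ∀ x ∈ M, x ∈ K := fun x hx => abs_sum_of_mem_crossFaces hA (h2 x hx)
    exact ⟨h1, hMK, fun x hx y hy => hsame x (hMK x hx) y (hMK y hy) ((h3 x hx y hy).trans_lt hr)⟩
  have hanti : ∀ d ≤ m, ∀ b, altFun lab b (antipode (H d)) = altFun lab (!b) (H d) := by
    intro d hd b
    refine eq_on (altFun lab b ∘ₗ antipode) (altFun lab (!b)) ?_ (hsmall d hd)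
    rintro M ⟨-, h2, h3⟩
    simp only [LinearMap.comp_apply, antipode, push, altFun, extend_simplex]
    rw [← altMultiset_map_flipLabel b, Multiset.map_map, Multiset.map_map]
    · congr 1
      exact Multiset.map_congr rfl fun x hx => hlab_neg x (h2 x hx)
    · intro x hx y hy
      obtain ⟨x, hx', rfl⟩ := Multiset.mem_map.1 hx
      obtain ⟨y, hy', rfl⟩ := Multiset.mem_map.1 hy
      exact h3 x hx' y hy'
  have hbd : ∀ d ≤ m, bd (H d) = (subdiv d)^[r] (bd (hemi m d)) :=
    fun d hd => (bd_iterate_subdiv (hcard d hd) r).2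
  have hone : ∀ d ≤ m, altFun lab true (H d) + altFun lab false (H d) = 1 := by
    intro d
    induction d with
    | zero =>
      intro hd
      have := altFun_bd lab true ((bd_iterate_subdiv (hcard 0 hd) r).1)
      rw [hbd 0 hd, bd_hemi_zero] at this
      rw [show altFun lab false (H 0) = altFun lab (!true) (H 0) from rfl, ← this]
      have h0 : (subdiv 0)^[r] (simplex (0 : Multiset (Fin (m + 1) → ℝ))) = simplex 0 := by
        simp [subdiv]
      rw [h0]
      simp [altFun, altMultiset, altList]
    | succ d ih =>
      intro hd
      have := altFun_bd lab true ((bd_iterate_subdiv (hcard (d + 1) hd) r).1)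
      rw [show altFun lab false (H (d + 1)) = altFun lab (!true) (H (d + 1)) from rfl, ← this,
        hbd (d + 1) hd, bd_hemi_succ]
      have h1 : ∀ (s : ℕ) (P Q : Chain (Fin (m + 1) → ℝ)), (subdiv (d + 1))^[s] (P + antipode Q) =
          (subdiv (d + 1))^[s] P + antipode ((subdiv (d + 1))^[s] Q) := by
        intro s
        induction s with
        | zero => intro P Q; rfl
        | succ s ihs =>
          intro P Q
          rw [Function.iterate_succ_apply, map_add, antipode, subdiv_push_neg]
          exact ihs _ _
      rw [h1, map_add, hanti d (by omega)]
      exact ih (by omega)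
  have hzero : ∀ b, altFun lab b (H m) = 0 := by
    intro b
    refine eq_on (altFun lab b) 0 ?_ (hsmall m le_rfl)
    rintro M ⟨h1, -, h3⟩
    rw [altFun, extend_simplex, LinearMap.zero_apply]
    refine altMultiset_eq_zero_of_card (m := m) b _ ?_ ?_ (by simp [h1])
    · intro x hx y hy
      obtain ⟨x, hx', rfl⟩ := Multiset.mem_map.1 hx
      obtain ⟨y, hy', rfl⟩ := Multiset.mem_map.1 hy
      exact h3 x hx' y hy'
    · intro x hx
      obtain ⟨x, hx, rfl⟩ := Multiset.mem_map.1 hx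
      exact hlab_lt x
  have := hone m le_rfl
  rw [hzero, hzero] at this
  exact absurd this (by decide)

open Filter Topology in
/-- **Discrete ham sandwich theorem**: some nontrivial combination of `m + 1` functions bisects `m`
weights on a finite set. -/
theorem exists_bisecting {α : Type*} {m : ℕ} (X : Finset α) (v : Fin (m + 1) → α → ℝ)
    (w : Fin m → α → ℝ) (hw : ∀ i x, 0 ≤ w i x) :
    ∃ c : Fin (m + 1) → ℝ, c ≠ 0 ∧ ∀ i,
      2 * ∑ x ∈ X with 0 < ∑ j, c j * v j x, w i x ≤ ∑ x ∈ X, w i x ∧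
      2 * ∑ x ∈ X with ∑ j, c j * v j x < 0, w i x ≤ ∑ x ∈ X, w i x := by
  set F : (Fin (m + 1) → ℝ) → α → ℝ := fun c x => ∑ j, c j * v j x with hF
  have hFc : ∀ x, Continuous fun c => F c x := fun x => by simp only [hF]; fun_prop
  have hFs : ∀ (t : ℝ) c x, F (t • c) x = t * F c x := fun t c x => by
    simp only [hF, Pi.smul_apply, smul_eq_mul, Finset.mul_sum, mul_assoc]
  have step : ∀ k : ℕ, ∃ c : Fin (m + 1) → ℝ, ‖c‖ = 1 ∧
      ∀ i, ∑ x ∈ X, w i x * max (-1) (min 1 (F c x * (k + 1))) = 0 := by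
    intro k
    obtain ⟨c, hc, h⟩ := exists_zero_of_odd
      (fun c i => ∑ x ∈ X, w i x * max (-‖c‖) (min ‖c‖ (F c x * (k + 1)))) (by fun_prop) (by
        intro c
        ext i
        rw [Pi.neg_apply, ← Finset.sum_neg_distrib]
        refine Finset.sum_congr rfl fun x _ => ?_
        have e : F (-c) x = - F c x := by simpa using hFs (-1) c x
        rw [norm_neg, e, ← mul_neg]
        congr 1
        have h0 := norm_nonneg c
        rw [neg_mul, max_def, max_def, min_def, min_def]
        split_ifs <;> linarith)
    have hn : 0 < ‖c‖ := norm_pos_iff.2 hc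
    refine ⟨‖c‖⁻¹ • c, by rw [norm_smul, norm_inv, norm_norm, inv_mul_cancel₀ hn.ne'], fun i => ?_⟩
    have h1 : ∑ x ∈ X, w i x * max (-‖c‖) (min ‖c‖ (F c x * (k + 1))) = 0 := congrFun h i
    have h2 : ∀ x, max (-‖c‖) (min ‖c‖ (F c x * (k + 1))) =
        ‖c‖ * max (-1) (min 1 (F (‖c‖⁻¹ • c) x * (k + 1))) := by
      intro x
      rw [mul_max_of_nonneg _ _ hn.le, mul_min_of_nonneg _ _ hn.le, hFs]
      congr 2
      · ring
      · ring
      · field_simp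
    simp_rw [h2, mul_left_comm _ ‖c‖, ← Finset.mul_sum] at h1
    exact (mul_eq_zero.1 h1).resolve_left hn.ne'
  choose c hc1 hc2 using step
  obtain ⟨a, ha, φ, hφ, hlim⟩ := (isCompact_sphere (0 : Fin (m + 1) → ℝ) 1).tendsto_subseq
    (x := c) (fun k => by simp [hc1 k])
  have ha1 : ‖a‖ = 1 := by simpa using ha
  have hpos : ∀ x, 0 < F a x → ∀ᶠ k in atTop, max (-1) (min 1 (F (c (φ k)) x * (φ k + 1))) = 1 := by
    intro x hx
    have h1 : Tendsto (fun k => F (c (φ k)) x) atTop (𝓝 (F a x)) :=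
      ((hFc x).tendsto a).comp hlim
    have h2 : Tendsto (fun k => ((φ k : ℕ) : ℝ) + 1) atTop atTop :=
      tendsto_atTop_add_const_right _ _ (tendsto_natCast_atTop_atTop.comp hφ.tendsto_atTop)
    filter_upwards [(h1.pos_mul_atTop hx h2).eventually_ge_atTop 1] with k hk
    rw [min_eq_left hk]; norm_num
  have hneg : ∀ x, F a x < 0 → ∀ᶠ k in atTop,
      max (-1) (min 1 (F (c (φ k)) x * (φ k + 1))) = -1 := by
    intro x hx
    have h1 : Tendsto (fun k => F (c (φ k)) x) atTop (𝓝 (F a x)) :=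
      ((hFc x).tendsto a).comp hlim
    have h2 : Tendsto (fun k => ((φ k : ℕ) : ℝ) + 1) atTop atTop :=
      tendsto_atTop_add_const_right _ _ (tendsto_natCast_atTop_atTop.comp hφ.tendsto_atTop)
    filter_upwards [(h1.neg_mul_atTop hx h2).eventually_le_atBot (-1)] with k hk
    rw [max_eq_left]
    exact (min_le_right _ _).trans hk
  have hall : ∀ᶠ k in atTop, ∀ x ∈ X,
      (0 < F a x → max (-1) (min 1 (F (c (φ k)) x * (φ k + 1))) = 1) ∧
      (F a x < 0 → max (-1) (min 1 (F (c (φ k)) x * (φ k + 1))) = -1) := by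
    rw [Filter.eventually_all_finset]
    intro x _
    refine Filter.Eventually.and ?_ ?_
    · by_cases h : 0 < F a x
      · filter_upwards [hpos x h] with k hk _ using hk
      · exact Filter.Eventually.of_forall fun _ h' => absurd h' h
    · by_cases h : F a x < 0
      · filter_upwards [hneg x h] with k hk _ using hk
      · exact Filter.Eventually.of_forall fun _ h' => absurd h' h
  obtain ⟨k, hk⟩ := hall.exists
  refine ⟨a, by rintro rfl; simp at ha1, fun i => ?_⟩
  have h0 := hc2 (φ k) i
  constructor
  · have h1 := Finset.sum_filter_add_sum_filter_not X (fun x => 0 < F a x) (w i)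
    have h2 := Finset.sum_filter_add_sum_filter_not X (fun x => 0 < F a x)
      (fun x => w i x * max (-1) (min 1 (F (c (φ k)) x * (φ k + 1))))
    have h3 : ∑ x ∈ X with 0 < F a x, w i x * max (-1) (min 1 (F (c (φ k)) x * (φ k + 1))) =
        ∑ x ∈ X with 0 < F a x, w i x := by
      refine Finset.sum_congr rfl fun x hx => ?_
      rw [Finset.mem_filter] at hx
      rw [(hk x hx.1).1 hx.2, mul_one]
    have h4 : ∑ x ∈ X with ¬ 0 < F a x, - w i x ≤
        ∑ x ∈ X with ¬ 0 < F a x, w i x * max (-1) (min 1 (F (c (φ k)) x * (φ k + 1))) := by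
      refine Finset.sum_le_sum fun x _ => ?_
      nlinarith [hw i x, le_max_left (-1) (min 1 (F (c (φ k)) x * (φ k + 1)))]
    rw [Finset.sum_neg_distrib] at h4
    linarith
  · have h1 := Finset.sum_filter_add_sum_filter_not X (fun x => F a x < 0) (w i)
    have h2 := Finset.sum_filter_add_sum_filter_not X (fun x => F a x < 0)
      (fun x => w i x * max (-1) (min 1 (F (c (φ k)) x * (φ k + 1))))
    have h3 : ∑ x ∈ X with F a x < 0, w i x * max (-1) (min 1 (F (c (φ k)) x * (φ k + 1))) =
        - ∑ x ∈ X with F a x < 0, w i x := by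
      rw [← Finset.sum_neg_distrib]
      refine Finset.sum_congr rfl fun x hx => ?_
      rw [Finset.mem_filter] at hx
      rw [(hk x hx.1).2 hx.2, mul_neg, mul_one]
    have h4 : ∑ x ∈ X with ¬ F a x < 0, w i x * max (-1) (min 1 (F (c (φ k)) x * (φ k + 1))) ≤
        ∑ x ∈ X with ¬ F a x < 0, w i x := by
      refine Finset.sum_le_sum fun x _ => ?_
      have : max (-1) (min 1 (F (c (φ k)) x * (φ k + 1))) ≤ 1 :=
        max_le (by norm_num) (min_le_left _ _)
      nlinarith [hw i x]
    linarith

/-! ### Lines and surfaces in three-space -/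

/-- Points of three-space. -/
abbrev Pt := Fin 3 → ℝ

/-- Real polynomials in three variables. -/
abbrev Poly3 := MvPolynomial (Fin 3) ℝ

/-- The line through `a` with direction `v`. -/
def lineThrough (a v : Pt) : Set Pt := Set.range fun t : ℝ => a + t • v

/-- The predicate that a set is a line. -/
def IsLine (l : Set Pt) : Prop := ∃ a v, v ≠ 0 ∧ l = lineThrough a v

/-- The real zero set of a polynomial. -/
def zeroSet (f : Poly3) : Set Pt := {x | MvPolynomial.eval x f = 0}

theorem mem_zeroSet {f : Poly3} {x : Pt} : x ∈ zeroSet f ↔ MvPolynomial.eval x f = 0 := Iff.rfl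

theorem base_mem_lineThrough (a v : Pt) : a ∈ lineThrough a v := ⟨0, by simp⟩

theorem lineThrough_eq_of_mem {a v b : Pt} (hb : b ∈ lineThrough a v) :
    lineThrough a v = lineThrough b v := by
  obtain ⟨s, rfl⟩ := hb
  ext x
  constructor
  · rintro ⟨t, rfl⟩
    exact ⟨t - s, by simp only; module⟩
  · rintro ⟨t, rfl⟩
    exact ⟨t + s, by simp only; module⟩

theorem lineThrough_smul (a v : Pt) {c : ℝ} (hc : c ≠ 0) :
    lineThrough a (c • v) = lineThrough a v := by
  ext x
  constructor
  · rintro ⟨t, rfl⟩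
    exact ⟨t * c, by simp only; module⟩
  · rintro ⟨t, rfl⟩
    exact ⟨t / c, by simp only [smul_smul]; rw [div_mul_cancel₀ _ hc]⟩

theorem IsLine.exists_dir {l : Set Pt} (hl : IsLine l) {x : Pt} (hx : x ∈ l) :
    ∃ v, v ≠ 0 ∧ l = lineThrough x v := by
  obtain ⟨a, v, hv, rfl⟩ := hl
  exact ⟨v, hv, lineThrough_eq_of_mem hx⟩

theorem IsLine.eq_lineThrough {l : Set Pt} (hl : IsLine l) {x y : Pt} (hx : x ∈ l) (hy : y ∈ l)
    (hxy : x ≠ y) : l = lineThrough x (y - x) := by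
  obtain ⟨v, hv, rfl⟩ := hl.exists_dir hx
  obtain ⟨t, rfl⟩ := hy
  have ht : t ≠ 0 := by rintro rfl; simp at hxy
  simp [lineThrough_smul, ht]

theorem IsLine.eq_of_mem {l l' : Set Pt} (hl : IsLine l) (hl' : IsLine l') {x y : Pt}
    (hxy : x ≠ y) (hx : x ∈ l) (hy : y ∈ l) (hx' : x ∈ l') (hy' : y ∈ l') : l = l' := by
  rw [hl.eq_lineThrough hx hy hxy, hl'.eq_lineThrough hx' hy' hxy]

theorem lineThrough_injective (a : Pt) {v : Pt} (hv : v ≠ 0) :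
    Function.Injective fun t : ℝ => a + t • v := by
  intro s t h
  have h' : s • v = t • v := add_left_cancel h
  rw [← sub_eq_zero, ← sub_smul, smul_eq_zero] at h'
  exact sub_eq_zero.1 (h'.resolve_right hv)

theorem IsLine.infinite {l : Set Pt} (hl : IsLine l) : l.Infinite := by
  obtain ⟨a, v, hv, rfl⟩ := hl
  exact Set.infinite_range_of_injective (lineThrough_injective a hv)

theorem IsLine.inter_subsingleton {l l' : Set Pt} (hl : IsLine l) (hl' : IsLine l') (h : l ≠ l') :
    (l ∩ l').Subsingleton := by
  intro x hx y hy
  by_contra hxy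
  exact h (hl.eq_of_mem hl' hxy hx.1 hy.1 hx.2 hy.2)

/-- The restriction of a polynomial to a parametrised line. -/
def restrictLine (a v : Pt) : Poly3 →ₐ[ℝ] Polynomial ℝ :=
  MvPolynomial.aeval fun i => Polynomial.C (a i) + Polynomial.C (v i) * Polynomial.X

theorem eval_restrictLine (a v : Pt) (f : Poly3) (t : ℝ) :
    (restrictLine a v f).eval t = MvPolynomial.eval (a + t • v) f := by
  have : (Polynomial.aeval t).comp (restrictLine a v) =
      (MvPolynomial.aeval (a + t • v) : Poly3 →ₐ[ℝ] ℝ) := by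
    apply MvPolynomial.algHom_ext
    intro i
    simp [restrictLine]
    ring
  have h := DFunLike.congr_fun this f
  simpa [MvPolynomial.aeval_eq_eval, Polynomial.aeval_def] using h

theorem natDegree_restrictLine_le (a v : Pt) (f : Poly3) :
    (restrictLine a v f).natDegree ≤ f.totalDegree := by
  rw [restrictLine, MvPolynomial.aeval_def, MvPolynomial.eval₂_eq]
  refine Polynomial.natDegree_sum_le_of_forall_le _ _ fun d hd => ?_
  refine (Polynomial.natDegree_C_mul_le _ _).trans ?_
  refine (Polynomial.natDegree_prod_le _ _).trans ?_
  refine le_trans ?_ (MvPolynomial.le_totalDegree hd)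
  rw [Finsupp.sum]
  refine Finset.sum_le_sum fun i _ => ?_
  refine Polynomial.natDegree_pow_le.trans ?_
  refine (Nat.mul_le_mul_left _ (?_ : _ ≤ 1)).trans (by simp)
  compute_degree

theorem restrictLine_eq_zero_of_subset {a v : Pt} {f : Poly3} (h : lineThrough a v ⊆ zeroSet f) :
    restrictLine a v f = 0 := by
  apply Polynomial.funext
  intro t
  rw [eval_restrictLine, Polynomial.eval_zero]
  exact h ⟨t, rfl⟩

theorem subset_zeroSet_of_restrictLine_eq_zero {a v : Pt} {f : Poly3} (h : restrictLine a v f = 0) :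
    lineThrough a v ⊆ zeroSet f := by
  rintro _ ⟨t, rfl⟩
  rw [mem_zeroSet, ← eval_restrictLine, h, Polynomial.eval_zero]

theorem IsLine.card_le_of_not_subset {l : Set Pt} (hl : IsLine l) {f : Poly3}
    (h : ¬ l ⊆ zeroSet f) (s : Finset Pt) (hs : ∀ x ∈ s, x ∈ l ∧ x ∈ zeroSet f) :
    s.card ≤ f.totalDegree := by
  obtain ⟨a, v, hv, rfl⟩ := hl
  have h0 : restrictLine a v f ≠ 0 := fun h' => h (subset_zeroSet_of_restrictLine_eq_zero h')
  have h1 : s ⊆ ((restrictLine a v f).roots.toFinset).image fun t => a + t • v := by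
    intro x hx
    obtain ⟨⟨t, rfl⟩, hx2⟩ := hs x hx
    refine Finset.mem_image.2 ⟨t, ?_, rfl⟩
    rw [Multiset.mem_toFinset, Polynomial.mem_roots h0, Polynomial.IsRoot, eval_restrictLine]
    exact hx2
  calc s.card ≤ _ := Finset.card_le_card h1
    _ ≤ _ := Finset.card_image_le
    _ ≤ _ := Multiset.toFinset_card_le _
    _ ≤ _ := Polynomial.card_roots' _
    _ ≤ _ := natDegree_restrictLine_le a v f

theorem IsLine.subset_zeroSet_of_card {l : Set Pt} (hl : IsLine l) {f : Poly3} (s : Finset Pt)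
    (hs : ∀ x ∈ s, x ∈ l ∧ x ∈ zeroSet f) (hc : f.totalDegree < s.card) : l ⊆ zeroSet f := by
  by_contra h
  exact absurd (hl.card_le_of_not_subset h s hs) (by omega)

theorem IsLine.finite_inter_of_not_subset {l : Set Pt} (hl : IsLine l) {f : Poly3}
    (h : ¬ l ⊆ zeroSet f) : (l ∩ zeroSet f).Finite := by
  by_contra hinf
  obtain ⟨s, hs, hc⟩ := Set.Infinite.exists_subset_card_eq hinf (f.totalDegree + 1)
  have := hl.card_le_of_not_subset h s (fun x hx => hs hx)
  omega

/-- The affine function vanishing at `a` with gradient `n`. -/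
def affinePoly (a n : Pt) : Poly3 :=
  ∑ i, MvPolynomial.C (n i) * (MvPolynomial.X i - MvPolynomial.C (a i))

theorem eval_affinePoly (a n x : Pt) : MvPolynomial.eval x (affinePoly a n) = n ⬝ᵥ (x - a) := by
  simp [affinePoly, dotProduct]

theorem totalDegree_affinePoly_le (a n : Pt) : (affinePoly a n).totalDegree ≤ 1 := by
  refine MvPolynomial.totalDegree_finsetSum_le fun i _ => ?_
  refine (MvPolynomial.totalDegree_mul _ _).trans ?_
  rw [MvPolynomial.totalDegree_C, zero_add]
  refine (MvPolynomial.totalDegree_sub _ _).trans ?_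
  simp

theorem exists_affine_separating_point {p q : Pt} (h : p ≠ q) :
    ∃ g : Poly3, g.totalDegree ≤ 1 ∧ MvPolynomial.eval p g ≠ 0 ∧ MvPolynomial.eval q g = 0 := by
  refine ⟨affinePoly q (p - q), totalDegree_affinePoly_le _ _, ?_, ?_⟩
  · rw [eval_affinePoly]
    rw [Ne, dotProduct_self_eq_zero, sub_eq_zero]
    exact h
  · simp [eval_affinePoly]

theorem IsLine.exists_affine_separating {l : Set Pt} (hl : IsLine l) {p : Pt} (h : p ∉ l) :
    ∃ g : Poly3, g.totalDegree ≤ 1 ∧ MvPolynomial.eval p g ≠ 0 ∧ l ⊆ zeroSet g := by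
  obtain ⟨a, v, hv, rfl⟩ := hl
  have hvv : v ⬝ᵥ v ≠ 0 := by simpa using hv
  set c : ℝ := (v ⬝ᵥ (p - a)) / (v ⬝ᵥ v) with hc
  set n : Pt := (p - a) - c • v with hn
  have hnv : n ⬝ᵥ v = 0 := by
    rw [hn, sub_dotProduct, smul_dotProduct, dotProduct_comm (p - a) v, hc, smul_eq_mul,
      div_mul_cancel₀ _ hvv, sub_self]
  have hn0 : n ≠ 0 := by
    intro h0
    refine h ⟨c, ?_⟩
    rw [hn, sub_eq_zero] at h0
    simp [← h0]
  refine ⟨affinePoly a n, totalDegree_affinePoly_le _ _, ?_, ?_⟩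
  · rw [eval_affinePoly]
    have : p - a = n + c • v := by simp [hn]
    rw [this, dotProduct_add, dotProduct_smul, hnv, smul_zero, add_zero]
    simpa using hn0
  · rintro _ ⟨t, rfl⟩
    rw [mem_zeroSet, eval_affinePoly]
    simp [dotProduct_smul, hnv]

/-! ### Spaces of polynomials of bounded degree -/

/-- Polynomials of total degree at most `m`. -/
abbrev polySpace (m : ℕ) : Submodule ℝ Poly3 := MvPolynomial.restrictTotalDegree (Fin 3) ℝ m

theorem mem_polySpace {m : ℕ} {f : Poly3} : f ∈ polySpace m ↔ f.totalDegree ≤ m :=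
  MvPolynomial.mem_restrictTotalDegree _ _ _

theorem finrank_polySpace (m : ℕ) : Module.finrank ℝ (polySpace m) = (m + 3).choose 3 := by
  have hsum : ∀ m : ℕ, ∑ k ∈ Finset.range (m + 1),
      ((Finset.univ : Finset (Fin 3)).card + k - 1).choose k = (m + 3).choose 3 := by
    intro m
    induction m with
    | zero => simp
    | succ m ih =>
      have e1 : (Finset.univ : Finset (Fin 3)).card + (m + 1) - 1 = 2 + (m + 1) := by simp; omega
      rw [Finset.sum_range_succ, ih, e1,
        Nat.choose_symm_of_eq_add (show 2 + (m + 1) = (m + 1) + 2 by ring),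
        show m + 1 + 3 = (m + 3) + 1 by ring, Nat.choose_succ_succ' (m + 3) 2, add_comm,
        show 2 + (m + 1) = m + 3 by ring]
  have e : {n : Fin 3 →₀ ℕ | (n.sum fun _ e => e) ≤ m} =
      ((Finset.range (m + 1)).biUnion fun k =>
        (Finset.univ : Finset (Fin 3)).finsuppAntidiag k : Finset (Fin 3 →₀ ℕ)) := by
    ext n
    simp only [Set.mem_ofPred_eq, Finset.coe_biUnion, Finset.mem_coe, Finset.mem_range,
      Set.mem_iUnion, Finset.mem_finsuppAntidiag', Finset.subset_univ, and_true]
    constructor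
    · intro h
      exact ⟨_, Nat.lt_succ_of_le h, rfl⟩
    · rintro ⟨k, hk, rfl⟩
      exact Nat.le_of_lt_succ hk
  have h1 : Module.finrank ℝ (polySpace m) =
      Nat.card {n : Fin 3 →₀ ℕ | (n.sum fun _ e => e) ≤ m} :=
    Module.finrank_eq_nat_card_basis (MvPolynomial.basisRestrictSupport ℝ _)
  rw [h1, e, Nat.card_coe_set_eq, Set.ncard_coe_finset, Finset.card_biUnion]
  · simp_rw [Finset.card_finsuppAntidiag_nat_eq_choose]
    exact hsum m
  · intro i _ j _ hij
    rw [Function.onFun, Finset.disjoint_left]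
    intro n hn hn'
    rw [Finset.mem_finsuppAntidiag'] at hn hn'
    exact hij (hn.1.symm.trans hn'.1)

theorem finrank_sum_ideal_ge {f g : Poly3} (hf : Irreducible f) (hfg : ¬ f ∣ g) (n : ℕ) :
    ∃ W : Submodule ℝ Poly3, W ≤ polySpace (n + f.totalDegree + g.totalDegree) ∧
      (∀ h ∈ W, ∃ p q, h = f * p + g * q) ∧
      (n + g.totalDegree + 3).choose 3 + (n + f.totalDegree + 3).choose 3 ≤
        Module.finrank ℝ W + (n + 3).choose 3 := by
  set a := n + g.totalDegree
  set b := n + f.totalDegree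
  have hg0 : g ≠ 0 := by rintro rfl; exact hfg (dvd_zero f)
  let Ψ : (polySpace a × polySpace b) →ₗ[ℝ] Poly3 :=
    ((LinearMap.mulLeft ℝ f) ∘ₗ (polySpace a).subtype).coprod
      ((LinearMap.mulLeft ℝ g) ∘ₗ (polySpace b).subtype)
  have hΨ : ∀ x, Ψ x = f * (x.1 : Poly3) + g * (x.2 : Poly3) := fun x => by simp [Ψ]
  let θ : polySpace n →ₗ[ℝ] Poly3 × Poly3 :=
    ((-(LinearMap.mulLeft ℝ g)) ∘ₗ (polySpace n).subtype).prod
      ((LinearMap.mulLeft ℝ f) ∘ₗ (polySpace n).subtype)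
  have hθ : ∀ x, θ x = (-(g * (x : Poly3)), f * (x : Poly3)) := fun x => by simp [θ]
  let ι : (polySpace a × polySpace b) →ₗ[ℝ] Poly3 × Poly3 :=
    (polySpace a).subtype.prodMap (polySpace b).subtype
  have hker : ∀ x ∈ LinearMap.ker Ψ, ι x ∈ LinearMap.range θ := by
    rintro ⟨⟨p, hp⟩, ⟨q, hq⟩⟩ hx
    rw [LinearMap.mem_ker, hΨ] at hx
    simp only at hx
    have h1 : f ∣ g * q := ⟨-p, by linear_combination hx⟩
    obtain ⟨c, rfl⟩ := (hf.prime.dvd_or_dvd h1).resolve_left hfg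
    have hpc : p = -(g * c) := by
      have : f * (p + g * c) = 0 := by linear_combination hx
      have := (mul_eq_zero.1 this).resolve_left hf.ne_zero
      linear_combination this
    have hc : c ∈ polySpace n := by
      rw [mem_polySpace] at hq ⊢
      rcases eq_or_ne c 0 with rfl | hc0
      · simp
      · rw [MvPolynomial.totalDegree_mul_of_isDomain hf.ne_zero hc0] at hq
        omega
    exact ⟨⟨c, hc⟩, by rw [hθ]; simp [ι, hpc]⟩
  have hle : Module.finrank ℝ (LinearMap.ker Ψ) ≤ (n + 3).choose 3 := by
    let j : LinearMap.ker Ψ →ₗ[ℝ] LinearMap.range θ :=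
      (ι ∘ₗ (LinearMap.ker Ψ).subtype).codRestrict _ fun x => hker x x.2
    have hj : Function.Injective j := by
      intro x y hxy
      have h1 : ι x = ι y := congrArg Subtype.val hxy
      apply Subtype.ext
      have h2 := Prod.ext_iff.1 h1
      exact Prod.ext (Subtype.ext h2.1) (Subtype.ext h2.2)
    calc _ ≤ _ := LinearMap.finrank_le_finrank_of_injective hj
      _ ≤ _ := LinearMap.finrank_range_le θ
      _ = _ := finrank_polySpace n
  refine ⟨LinearMap.range Ψ, ?_, ?_, ?_⟩
  · rintro _ ⟨⟨⟨p, hp⟩, ⟨q, hq⟩⟩, rfl⟩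
    rw [hΨ]
    refine Submodule.add_mem _ ?_ ?_
    · rw [mem_polySpace] at hp ⊢
      change (f * p).totalDegree ≤ _
      refine (MvPolynomial.totalDegree_mul _ _).trans ?_
      simp only [a] at hp
      omega
    · rw [mem_polySpace] at hq ⊢
      change (g * q).totalDegree ≤ _
      refine (MvPolynomial.totalDegree_mul _ _).trans ?_
      simp only [b] at hq
      omega
  · rintro _ ⟨x, rfl⟩
    exact ⟨_, _, hΨ x⟩
  · have h := LinearMap.finrank_range_add_finrank_ker Ψ
    rw [Module.finrank_prod, finrank_polySpace, finrank_polySpace] at h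
    omega

/-- A finite set on which polynomials of degree at most `m` can be interpolated imposes independent
conditions. -/
theorem card_add_finrank_le {m : ℕ} (S : Finset Pt)
    (hS : ∀ p ∈ S, ∃ q ∈ polySpace m, MvPolynomial.eval p q ≠ 0 ∧
      ∀ p' ∈ S, p' ≠ p → MvPolynomial.eval p' q = 0)
    (W : Submodule ℝ Poly3) (hW : W ≤ polySpace m)
    (hW0 : ∀ h ∈ W, ∀ p ∈ S, MvPolynomial.eval p h = 0) :
    S.card + Module.finrank ℝ W ≤ (m + 3).choose 3 := by
  let ev : polySpace m →ₗ[ℝ] (S → ℝ) :=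
    LinearMap.pi fun p => (MvPolynomial.aeval (R := ℝ) (p : Pt)).toLinearMap ∘ₗ (polySpace
      m).subtype
  have hev : ∀ h p, ev h p = MvPolynomial.eval (p : Pt) (h : Poly3) := fun h p => by
    simp [ev, MvPolynomial.aeval_eq_eval]
  have hsurj : Function.Surjective ev := by
    choose! q hq1 hq2 hq3 using hS
    intro y
    refine ⟨∑ p : S, (y p / MvPolynomial.eval (p : Pt) (q p)) • ⟨q p, hq1 p p.2⟩, ?_⟩
    ext p
    rw [map_sum, Finset.sum_apply, Finset.sum_eq_single p]
    · rw [map_smul, Pi.smul_apply, hev, smul_eq_mul, div_mul_cancel₀ _ (hq2 p p.2)]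
    · intro p' _ hne
      rw [map_smul, Pi.smul_apply, hev, hq3 p' p'.2 p p.2 (fun h => hne (Subtype.ext h.symm)),
        smul_zero]
    · simp
  have h1 := LinearMap.finrank_range_add_finrank_ker ev
  rw [LinearMap.range_eq_top.2 hsurj, finrank_top, finrank_polySpace,
    Module.finrank_fintype_fun_eq_card,
    Fintype.card_coe] at h1
  have h2 : Module.finrank ℝ W ≤ Module.finrank ℝ (LinearMap.ker ev) := by
    refine LinearMap.finrank_le_finrank_of_injective
      (f := (Submodule.inclusion hW).codRestrict (LinearMap.ker ev) ?_) ?_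
    · rintro ⟨h, hh⟩
      rw [LinearMap.mem_ker]
      ext p
      rw [hev]
      exact hW0 h hh p p.2
    · intro x y hxy
      have := congrArg (fun z : LinearMap.ker ev => ((z : polySpace m) : Poly3)) hxy
      exact Subtype.ext this
  omega

theorem exists_poly_isolating (A : Finset (Set Pt)) (hA : ∀ l ∈ A, IsLine l)
    (s : Set Pt → Finset Pt) (k : ℕ) (hsk : ∀ l ∈ A, (s l).card ≤ k)
    (hsl : ∀ l ∈ A, ∀ x ∈ s l, x ∈ l ∧ ∀ l' ∈ A, l' ≠ l → x ∉ l') {l : Set Pt} (hl : l ∈ A)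
    {p : Pt} (hp : p ∈ s l) :
    ∃ q ∈ polySpace (A.card + k), MvPolynomial.eval p q ≠ 0 ∧
      ∀ p' ∈ A.biUnion s, p' ≠ p → MvPolynomial.eval p' q = 0 := by
  have h1 : ∀ l' ∈ A.erase l, ∃ g : Poly3, g.totalDegree ≤ 1 ∧ MvPolynomial.eval p g ≠ 0 ∧
      l' ⊆ zeroSet g := by
    intro l' hl'
    rw [Finset.mem_erase] at hl'
    exact (hA l' hl'.2).exists_affine_separating ((hsl l hl p hp).2 l' hl'.2 hl'.1)
  have h2 : ∀ p' ∈ (s l).erase p, ∃ g : Poly3, g.totalDegree ≤ 1 ∧ MvPolynomial.eval p g ≠ 0 ∧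
      MvPolynomial.eval p' g = 0 := by
    intro p' hp'
    exact exists_affine_separating_point (Finset.ne_of_mem_erase hp').symm
  choose! g hg1 hg2 hg3 using h1
  choose! h hh1 hh2 hh3 using h2
  refine ⟨(∏ l' ∈ A.erase l, g l') * ∏ p' ∈ (s l).erase p, h p', ?_, ?_, ?_⟩
  · rw [mem_polySpace]
    refine (MvPolynomial.totalDegree_mul _ _).trans (add_le_add ?_ ?_)
    · refine (MvPolynomial.totalDegree_finsetProd _ _).trans ?_
      refine (Finset.sum_le_card_nsmul _ _ 1 hg1).trans ?_
      simpa using Finset.card_le_card (Finset.erase_subset l A)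
    · refine (MvPolynomial.totalDegree_finsetProd _ _).trans ?_
      refine (Finset.sum_le_card_nsmul _ _ 1 hh1).trans ?_
      simpa using (Finset.card_le_card (Finset.erase_subset p (s l))).trans (hsk l hl)
  · rw [map_mul, map_prod, map_prod]
    exact mul_ne_zero (Finset.prod_ne_zero_iff.2 hg2) (Finset.prod_ne_zero_iff.2 hh2)
  · intro p' hp' hne
    rw [Finset.mem_biUnion] at hp'
    obtain ⟨l', hl', hpl'⟩ := hp'
    rw [map_mul, map_prod, map_prod]
    by_cases hll : l' = l
    · subst hll
      rw [Finset.prod_eq_zero (Finset.mem_erase.2 ⟨hne, hpl'⟩)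
        (hh3 p' (Finset.mem_erase.2 ⟨hne, hpl'⟩)), mul_zero]
    · have hm : l' ∈ A.erase l := Finset.mem_erase.2 ⟨hll, hl'⟩
      rw [Finset.prod_eq_zero hm (mem_zeroSet.1 (hg3 l' hm (hsl l' hl' p' hpl').1)), zero_mul]

theorem choose_three_cast (x : ℕ) :
    (6 : ℝ) * ((x + 3).choose 3 : ℕ) = (x + 1) * (x + 2) * (x + 3) := by
  induction x with
  | zero => norm_num
  | succ x ih =>
    have h2 : (2 : ℝ) * ((x + 3).choose 2 : ℕ) = (x + 3) * (x + 2) := by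
      rw [Nat.cast_choose_two]; push_cast; ring
    rw [show x + 1 + 3 = (x + 3) + 1 by ring, Nat.choose_succ_succ' (x + 3) 2]
    push_cast
    linear_combination ih + 3 * h2

/-- **Bézout bound for lines**: two surfaces without common component, one of them irreducible,
have few lines in common. -/
theorem card_common_lines_le {f g : Poly3} (hf : Irreducible f) (hfg : ¬ f ∣ g)
    (A : Finset (Set Pt)) (hA : ∀ l ∈ A, IsLine l) (hAf : ∀ l ∈ A, l ⊆ zeroSet f)
    (hAg : ∀ l ∈ A, l ⊆ zeroSet g) : A.card ≤ f.totalDegree * g.totalDegree := by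
  set d := f.totalDegree with hd
  set e := g.totalDegree with he
  by_contra! hlt
  have key : ∀ k : ℕ, A.card * k ≤ d * e * (A.card + k + d + e + 2) := by
    intro k
    have hpts : ∀ l ∈ A, ∃ s : Finset Pt, s.card = k ∧
        ∀ x ∈ s, x ∈ l ∧ ∀ l' ∈ A, l' ≠ l → x ∉ l' := by
      intro l hl
      have hinf : (l \ ⋃ l' ∈ A.erase l, l ∩ l').Infinite := by
        refine Set.Infinite.sdiff (hA l hl).infinite ?_
        refine Set.Finite.biUnion (Finset.finite_toSet _) fun l' hl' => ?_
        rw [Finset.mem_coe, Finset.mem_erase] at hl'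
        exact ((hA l hl).inter_subsingleton (hA l' hl'.2) hl'.1.symm).finite
      obtain ⟨s, hs, hc⟩ := hinf.exists_subset_card_eq k
      refine ⟨s, hc, fun x hx => ⟨(hs hx).1, fun l' hl' hne hxl' => (hs hx).2 ?_⟩⟩
      exact Set.mem_biUnion (Finset.mem_coe.2 (Finset.mem_erase.2 ⟨hne, hl'⟩)) ⟨(hs hx).1, hxl'⟩
    choose! s hs1 hs2 using hpts
    obtain ⟨W, hW1, hW2, hW3⟩ := finrank_sum_ideal_ge hf hfg (A.card + k)
    have hcard : (A.biUnion s).card = A.card * k := by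
      rw [Finset.card_biUnion, Finset.sum_congr rfl hs1]
      · simp
      · intro l hl l' hl' hne
        rw [Function.onFun, Finset.disjoint_left]
        intro x hx hx'
        exact (hs2 l hl x hx).2 l' hl' hne.symm (hs2 l' hl' x hx').1
    have h := card_add_finrank_le (m := A.card + k + d + e) (A.biUnion s) (by
      intro p hp
      rw [Finset.mem_biUnion] at hp
      obtain ⟨l, hl, hpl⟩ := hp
      obtain ⟨q, hq1, hq2⟩ := exists_poly_isolating A hA s k (fun l hl => (hs1 l hl).le) hs2 hl hpl
      refine ⟨q, ?_, hq2⟩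
      rw [mem_polySpace] at hq1 ⊢
      omega) W hW1 (by
      intro h hh p hp
      obtain ⟨a, b, rfl⟩ := hW2 h hh
      rw [Finset.mem_biUnion] at hp
      obtain ⟨l, hl, hpl⟩ := hp
      have h1 := hAf l hl (hs2 l hl p hpl).1
      have h2 := hAg l hl (hs2 l hl p hpl).1
      rw [mem_zeroSet] at h1 h2
      simp [h1, h2])
    rw [hcard] at h
    rw [← hd, ← he] at hW3
    have h' : A.card * k + ((A.card + k + e + 3).choose 3 + (A.card + k + d + 3).choose 3) ≤
        (A.card + k + d + e + 3).choose 3 + (A.card + k + 3).choose 3 := by omega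
    have h6 : (A.card * k : ℝ) * 6 + (6 * ((A.card + k + e + 3).choose 3 : ℕ) +
        6 * ((A.card + k + d + 3).choose 3 : ℕ)) ≤ 6 * ((A.card + k + d + e + 3).choose 3 : ℕ) +
          6 * ((A.card + k + 3).choose 3 : ℕ) := by
      have : ((A.card * k + ((A.card + k + e + 3).choose 3 + (A.card + k + d + 3).choose 3)
        : ℕ) : ℝ)
        ≤ ((A.card + k + d + e + 3).choose 3 + (A.card + k + 3).choose 3 : ℕ) := by exact_mod_cast
          h'
      push_cast at this
      linarith
    rw [choose_three_cast, choose_three_cast, choose_three_cast, choose_three_cast] at h6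
    push_cast at h6
    have h7 : (A.card * k : ℝ) ≤ d * e * (A.card + k + d + e + 2) := by
      have : (0 : ℝ) ≤ d * e * (d + e) := by positivity
      nlinarith
    exact_mod_cast h7
  have := key (d * e * (A.card + d + e + 2) + 1)
  have h1 := Nat.mul_le_mul_right (d * e * (A.card + d + e + 2) + 1) (Nat.succ_le_of_lt hlt)
  have h2 : d * e * (A.card + (d * e * (A.card + d + e + 2) + 1) + d + e + 2) + 1 =
    (d * e).succ * (d * e * (A.card + d + e + 2) + 1) := by
    rw [Nat.succ_eq_add_one]
    ring
  omega

theorem pow_two_lt_finrank_polySpace (J : ℕ) :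
    2 ^ J + 1 ≤ Module.finrank ℝ (polySpace (4 * 2 ^ (J / 3))) := by
  rw [finrank_polySpace]
  set q := J / 3
  have h1 : (2 : ℝ) ^ J ≤ 4 * (2 ^ q) ^ 3 := by
    rw [← pow_mul, show (4 : ℝ) = 2 ^ 2 by norm_num, ← pow_add]
    exact pow_le_pow_right₀ (by norm_num) (by omega)
  have h2 := choose_three_cast (4 * 2 ^ q)
  push_cast at h2
  have h3 : (1 : ℝ) ≤ 2 ^ q := one_le_pow₀ (by norm_num)
  have h4 : ((2 ^ J + 1 : ℕ) : ℝ) ≤ ((4 * 2 ^ q + 3).choose 3 : ℕ) := by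
    push_cast
    have h5 : (0 : ℝ) ≤ (2 ^ q) ^ 3 := by positivity
    have h6 : (0 : ℝ) ≤ (2 ^ q) ^ 2 := by positivity
    nlinarith
  exact_mod_cast h4

theorem exists_poly_bisecting (J : ℕ) (S : Finset Pt) (w : Fin (2 ^ J) → Pt → ℝ)
    (hw : ∀ i x, 0 ≤ w i x) :
    ∃ f : Poly3, f ≠ 0 ∧ f.totalDegree ≤ 4 * 2 ^ (J / 3) ∧ ∀ i,
      2 * ∑ x ∈ S with 0 < MvPolynomial.eval x f, w i x ≤ ∑ x ∈ S, w i x ∧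
      2 * ∑ x ∈ S with MvPolynomial.eval x f < 0, w i x ≤ ∑ x ∈ S, w i x := by
  obtain ⟨b, hb⟩ := exists_linearIndependent_of_le_finrank (pow_two_lt_finrank_polySpace J)
  obtain ⟨c, hc0, hc⟩ := exists_bisecting S (fun j x => MvPolynomial.eval x (b j : Poly3)) w hw
  have hev : ∀ x, MvPolynomial.eval x ((∑ j, c j • b j : polySpace _) : Poly3) =
      ∑ j, c j * MvPolynomial.eval x (b j : Poly3) := by
    intro x
    simp [map_sum, MvPolynomial.smul_eval]
  refine ⟨(∑ j, c j • b j : polySpace _), ?_, ?_, fun i => ?_⟩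
  · intro h
    rw [ZeroMemClass.coe_eq_zero] at h
    exact hc0 (funext fun j => Fintype.linearIndependent_iff.1 hb c h j)
  · exact mem_polySpace.1 (∑ j, c j • b j : polySpace _).2
  · simp only [hev]
    exact hc i

/-- Iterated bisection: the label `c` is constant on segments avoiding the zero set of `g`. -/
theorem exists_iterated_bisection (S : Finset Pt) (w : Pt → ℝ) (hw : ∀ x, 0 ≤ w x) (J : ℕ) :
    ∃ (g : Poly3) (c : Pt → ℕ), g ≠ 0 ∧ g.totalDegree ≤ ∑ j ∈ Finset.range J, 4 * 2 ^ (j / 3) ∧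
      (∀ x, c x < 2 ^ J) ∧
      (∀ s, 2 ^ J * ∑ x ∈ S with MvPolynomial.eval x g ≠ 0 ∧ c x = s, w x ≤ ∑ x ∈ S, w x) ∧
      ∀ x y, (∀ t ∈ Set.Icc (0 : ℝ) 1, MvPolynomial.eval (x + t • (y - x)) g ≠ 0) → c x = c y := by
  induction J with
  | zero =>
    refine ⟨1, fun _ => 0, one_ne_zero, by simp, by simp, fun s => ?_, by simp⟩
    rw [pow_zero, one_mul]
    exact Finset.sum_le_sum_of_subset_of_nonneg (Finset.filter_subset _ _) fun x _ _ => hw x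
  | succ J ih =>
    obtain ⟨g, c, hg0, hgd, hc, hcell, hseg⟩ := ih
    obtain ⟨f, hf0, hfd, hf⟩ := exists_poly_bisecting J S
      (fun i x => if MvPolynomial.eval x g ≠ 0 ∧ c x = i then w x else 0)
      (fun i x => by split_ifs; exacts [hw x, le_rfl])
    refine ⟨g * f, fun x => 2 * c x + if 0 < MvPolynomial.eval x f then 1 else 0,
      mul_ne_zero hg0 hf0, ?_, ?_, ?_, ?_⟩
    · rw [Finset.sum_range_succ]
      exact (MvPolynomial.totalDegree_mul _ _).trans (add_le_add hgd hfd)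
    · intro x
      have := hc x
      rw [pow_succ]
      dsimp only
      split_ifs <;> omega
    · intro s
      have hs := hcell (s / 2)
      by_cases hlt : s / 2 < 2 ^ J
      · have hb := hf ⟨s / 2, hlt⟩
        simp only [← Finset.sum_filter, Finset.filter_filter] at hb
        have h2 : 2 * ∑ x ∈ S with MvPolynomial.eval x (g * f) ≠ 0 ∧
            (2 * c x + if 0 < MvPolynomial.eval x f then 1 else 0) = s, w x ≤
            ∑ x ∈ S with MvPolynomial.eval x g ≠ 0 ∧ c x = s / 2, w x := by
          rcases Nat.even_or_odd' s with ⟨k, hk | hk⟩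
          · refine le_trans ?_ hb.2
            refine mul_le_mul_of_nonneg_left
              (Finset.sum_le_sum_of_subset_of_nonneg ?_ fun _ _ _ => hw _) zero_le_two
            · intro x hx
              rw [Finset.mem_filter] at hx ⊢
              obtain ⟨hxS, hx0, hxs⟩ := hx
              rw [map_mul, mul_ne_zero_iff] at hx0
              split_ifs at hxs with hpos
              · omega
              · exact ⟨hxS, lt_of_le_of_ne (not_lt.1 hpos) hx0.2, hx0.1, by omega⟩
          · refine le_trans ?_ hb.1
            refine mul_le_mul_of_nonneg_left
              (Finset.sum_le_sum_of_subset_of_nonneg ?_ fun _ _ _ => hw _) zero_le_two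
            · intro x hx
              rw [Finset.mem_filter] at hx ⊢
              obtain ⟨hxS, hx0, hxs⟩ := hx
              rw [map_mul, mul_ne_zero_iff] at hx0
              split_ifs at hxs with hpos
              · exact ⟨hxS, hpos, hx0.1, by omega⟩
              · omega
        rw [pow_succ, mul_assoc]
        exact (mul_le_mul_of_nonneg_left h2 (by positivity)).trans hs
      · rw [Finset.sum_eq_zero, mul_zero]
        · exact Finset.sum_nonneg fun x _ => hw x
        · intro x hx
          rw [Finset.mem_filter] at hx
          have h1 := hx.2.2
          have h2 := hc x
          dsimp only at h1
          split_ifs at h1 <;> omega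
    · intro x y hxy
      simp only [map_mul, mul_ne_zero_iff] at hxy
      have h1 : c x = c y := hseg x y fun t ht => (hxy t ht).1
      have hcont : ContinuousOn (fun t : ℝ => MvPolynomial.eval (x + t • (y - x)) f)
          (Set.Icc 0 1) := by
        refine Continuous.continuousOn ?_
        exact (MvPolynomial.continuous_eval f).comp (by fun_prop)
      have hx0 : x + (0 : ℝ) • (y - x) = x := by simp
      have hy1 : x + (1 : ℝ) • (y - x) = y := by simp
      have h2 : 0 < MvPolynomial.eval x f ↔ 0 < MvPolynomial.eval y f := by
        constructor
        · intro h
          by_contra hle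
          obtain ⟨t, ht, ht0⟩ := intermediate_value_Icc' zero_le_one hcont
            (show (0 : ℝ) ∈ Set.Icc _ _ from ⟨by rw [hy1]; exact not_lt.1 hle, by rw [hx0]; exact
              h.le⟩)
          exact (hxy t ht).2 ht0
        · intro h
          by_contra hle
          obtain ⟨t, ht, ht0⟩ := intermediate_value_Icc zero_le_one hcont
            (show (0 : ℝ) ∈ Set.Icc _ _ from ⟨by rw [hx0]; exact not_lt.1 hle, by rw [hy1]; exact
              h.le⟩)
          exact (hxy t ht).2 ht0
      simp only [h1, h2]

theorem sum_bisection_degrees_le (i : ℕ) :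
    ∑ j ∈ Finset.range (3 * i), 4 * 2 ^ (j / 3) ≤ 12 * 2 ^ i := by
  induction i with
  | zero => simp
  | succ i ih =>
    rw [show 3 * (i + 1) = 3 * i + 1 + 1 + 1 by ring, Finset.sum_range_succ, Finset.sum_range_succ,
      Finset.sum_range_succ, show 3 * i / 3 = i by omega, show (3 * i + 1) / 3 = i by omega,
      show (3 * i + 1 + 1) / 3 = i by omega, pow_succ]
    omega

/-- The labels of points on a line off the surface `g = 0` take few values. -/
theorem card_image_label_le {g : Poly3} {c : Pt → ℕ}
    (hseg : ∀ x y, (∀ t ∈ Set.Icc (0 : ℝ) 1, MvPolynomial.eval (x + t • (y - x)) g ≠ 0) → c x = c y)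
    {l : Set Pt} (hl : IsLine l) (T : Finset Pt)
    (hT : ∀ x ∈ T, x ∈ l ∧ MvPolynomial.eval x g ≠ 0) :
    (T.image c).card ≤ g.totalDegree + 1 := by
  obtain ⟨a, v, hv, rfl⟩ := hl
  rcases T.eq_empty_or_nonempty with rfl | ⟨x₀, hx₀⟩
  · simp
  have hT' : ∀ x ∈ T, ∃ t : ℝ, x = a + t • v := by
    intro x hx
    obtain ⟨t, ht⟩ := (hT x hx).1
    exact ⟨t, ht.symm⟩
  choose! τ hτ using hT'
  set p := restrictLine a v g with hp
  have hev : ∀ t, p.eval t = MvPolynomial.eval (a + t • v) g := fun t => eval_restrictLine a v g t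
  have hp0 : p ≠ 0 := by
    intro h
    apply (hT x₀ hx₀).2
    rw [hτ x₀ hx₀, ← hev, h, Polynomial.eval_zero]
  have hcard : p.roots.toFinset.card ≤ g.totalDegree :=
    (Multiset.toFinset_card_le _).trans ((Polynomial.card_roots' p).trans
      (natDegree_restrictLine_le a v g))
  set ν : ℝ → ℕ := fun t => (p.roots.toFinset.filter (· < t)).card with hν
  have hkey : ∀ x ∈ T, ∀ y ∈ T, τ x ≤ τ y → ν (τ x) = ν (τ y) → c x = c y := by
    intro x hx y hy hle heq
    apply hseg
    intro t ht h0
    have hpt : x + t • (y - x) = a + (τ x + t * (τ y - τ x)) • v := by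
      conv_lhs => rw [hτ x hx, hτ y hy]
      module
    rw [hpt, ← hev] at h0
    have hx0 := (hT x hx).2
    have hy0 := (hT y hy).2
    rw [hτ x hx, ← hev] at hx0
    rw [hτ y hy, ← hev] at hy0
    set r := τ x + t * (τ y - τ x) with hr
    have hrx : τ x < r := by
      refine lt_of_le_of_ne ?_ (fun h => hx0 (h ▸ h0))
      have := mul_nonneg ht.1 (sub_nonneg.2 hle)
      linarith
    have hry : r < τ y := by
      refine lt_of_le_of_ne ?_ (fun h => hy0 (h ▸ h0))
      have := mul_le_mul_of_nonneg_right ht.2 (sub_nonneg.2 hle)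
      linarith
    have hlt : ν (τ x) < ν (τ y) := by
      apply Finset.card_lt_card
      rw [Finset.ssubset_iff_of_subset]
      · refine ⟨r, ?_, ?_⟩
        · rw [Finset.mem_filter, Multiset.mem_toFinset, Polynomial.mem_roots hp0]
          exact ⟨h0, hry⟩
        · rw [Finset.mem_filter, not_and, not_lt]
          exact fun _ => hrx.le
      · exact Finset.monotone_filter_right _ fun s _ hs => hs.trans_le hle
    omega
  have hfac : ∀ x ∈ T, ∀ y ∈ T, ν (τ x) = ν (τ y) → c x = c y := by
    intro x hx y hy h
    rcases le_total (τ x) (τ y) with hle | hle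
    · exact hkey x hx y hy hle h
    · exact (hkey y hy x hx hle h.symm).symm
  have h1 : (T.image c).card ≤ (T.image fun x => ν (τ x)).card := by
    choose! y hy using fun k (hk : k ∈ T.image fun x => ν (τ x)) => Finset.mem_image.1 hk
    refine Finset.card_le_card_of_surjOn (fun k => c (y k)) ?_
    intro s hs
    rw [Finset.mem_coe, Finset.mem_image] at hs
    obtain ⟨x, hx, rfl⟩ := hs
    have hm : ν (τ x) ∈ T.image fun x => ν (τ x) := Finset.mem_image_of_mem _ hx
    exact ⟨ν (τ x), hm, hfac _ (hy _ hm).1 _ hx (hy _ hm).2⟩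
  refine h1.trans ?_
  refine (Finset.card_le_card (t := Finset.range (g.totalDegree + 1)) ?_).trans (by simp)
  intro k hk
  rw [Finset.mem_image] at hk
  obtain ⟨x, hx, rfl⟩ := hk
  rw [Finset.mem_range, Nat.lt_succ_iff]
  exact (Finset.card_filter_le _ _).trans hcard

/-- **Polynomial partitioning**, weighted version. -/
theorem exists_partition (S : Finset Pt) (w : Pt → ℝ) (hw : ∀ x, 0 ≤ w x) (i : ℕ) :
    ∃ (g : Poly3) (c : Pt → ℕ), g ≠ 0 ∧ g.totalDegree ≤ 12 * 2 ^ i ∧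
      (∀ s, (2 ^ i) ^ 3 * ∑ x ∈ S with MvPolynomial.eval x g ≠ 0 ∧ c x = s, w x ≤ ∑ x ∈ S, w x) ∧
      ∀ l, IsLine l → ∀ T : Finset Pt, (∀ x ∈ T, x ∈ l ∧ MvPolynomial.eval x g ≠ 0) →
        (T.image c).card ≤ 13 * 2 ^ i := by
  obtain ⟨g, c, h0, hd, -, hcell, hseg⟩ := exists_iterated_bisection S w hw (3 * i)
  have hd' := hd.trans (sum_bisection_degrees_le i)
  refine ⟨g, c, h0, hd', fun s => ?_, fun l hl T hT => ?_⟩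
  · rw [← pow_mul, mul_comm i 3]
    exact hcell s
  · have := card_image_label_le hseg hl T hT
    have := Nat.one_le_two_pow (n := i)
    omega

/-- The Taylor expansion `f (x + t d(x))` as a polynomial in `t`, for a polynomial vector field
`d`. -/
def flowLine (d : Fin 3 → Poly3) : Poly3 →ₐ[ℝ] Polynomial Poly3 :=
  MvPolynomial.aeval fun m => Polynomial.C (MvPolynomial.X m) + Polynomial.X * Polynomial.C (d m)

theorem flowLine_X (d : Fin 3 → Poly3) (m : Fin 3) : flowLine d (MvPolynomial.X m) =
    Polynomial.C (MvPolynomial.X m) + Polynomial.X * Polynomial.C (d m) := by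
  simp [flowLine]

theorem map_eval_flowLine (d : Fin 3 → Poly3) (f : Poly3) (x : Pt) :
    (flowLine d f).map (MvPolynomial.eval x) =
      restrictLine x (fun m => MvPolynomial.eval x (d m)) f := by
  have : (Polynomial.mapAlgHom (MvPolynomial.aeval x)).comp (flowLine d) =
      restrictLine x (fun m => MvPolynomial.eval x (d m)) := by
    ext m : 1
    simp [flowLine, restrictLine]
  exact DFunLike.congr_fun this f

/-- Coefficientwise extension of a derivation of `Poly3`. -/
def coeffDer (T : Derivation ℝ Poly3 Poly3) : Derivation ℝ (Polynomial Poly3) (Polynomial Poly3) :=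
  (PolynomialModule.equivPolynomialSelf (R := Poly3)).toLinearMap.compDer T.mapCoeffs

theorem coeff_coeffDer (T : Derivation ℝ Poly3 Poly3) (p : Polynomial Poly3) (n : ℕ) :
    (coeffDer T p).coeff n = T (p.coeff n) := rfl

theorem coeffDer_C (T : Derivation ℝ Poly3 Poly3) (p : Poly3) :
    coeffDer T (Polynomial.C p) = Polynomial.C (T p) := by
  ext1 n
  rw [coeff_coeffDer, Polynomial.coeff_C, Polynomial.coeff_C]
  split_ifs <;> simp

theorem coeffDer_X (T : Derivation ℝ Poly3 Poly3) : coeffDer T Polynomial.X = 0 := by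
  ext1 n
  rw [coeff_coeffDer, Polynomial.coeff_X]
  split_ifs <;> simp

theorem coeffDer_flowLine {d : Fin 3 → Poly3} {T : Derivation ℝ Poly3 Poly3} {k : Fin 3}
    {q Φ : Poly3} (hX : ∀ m, T (MvPolynomial.X m) = d m)
    (hd : ∀ m, q * T (d m) = T q * d m - if m = k then Φ else 0) (p : Poly3) :
    Polynomial.C q * coeffDer T (flowLine d p) =
      (Polynomial.C q + Polynomial.X * Polynomial.C (T q)) * Polynomial.derivative (flowLine d p) -
        Polynomial.X * Polynomial.C Φ * flowLine d (MvPolynomial.pderiv k p) := by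
  induction p using MvPolynomial.induction_on with
  | C a =>
    have h : flowLine d (MvPolynomial.C a) = algebraMap ℝ (Polynomial Poly3) a :=
      (flowLine d).commutes a
    have h' : algebraMap ℝ (Polynomial Poly3) a = Polynomial.C (MvPolynomial.C a) := rfl
    rw [h, Derivation.map_algebraMap, h', Polynomial.derivative_C, MvPolynomial.pderiv_C]
    simp
  | add p q hp hq =>
    simp only [map_add]
    linear_combination hp + hq
  | mul_X p m hp =>
    have hm : Polynomial.C q * Polynomial.C (T (d m)) = Polynomial.C (T q) * Polynomial.C (d m) -
        if m = k then Polynomial.C Φ else 0 := by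
      rw [← Polynomial.C_mul, hd m, Polynomial.C_sub, Polynomial.C_mul]
      split_ifs <;> simp
    have h1 : coeffDer T (flowLine d (MvPolynomial.X m)) =
        Polynomial.C (d m) + Polynomial.X * Polynomial.C (T (d m)) := by
      rw [flowLine_X, map_add, Derivation.leibniz, coeffDer_C, coeffDer_C, coeffDer_X, hX]
      simp
    have h2 : Polynomial.derivative (flowLine d (MvPolynomial.X m)) = Polynomial.C (d m) := by
      simp [flowLine_X]
    have h3 : flowLine d (MvPolynomial.pderiv k (MvPolynomial.X m)) = if m = k then 1 else 0 := by
      rw [MvPolynomial.pderiv_X, Pi.single_apply]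
      split_ifs <;> simp
    simp only [map_mul, Derivation.leibniz, Polynomial.derivative_mul, smul_eq_mul, map_add, h1, h2,
      h3]
    split_ifs at hm ⊢ <;> linear_combination (flowLine d (MvPolynomial.X m)) * hp +
      (flowLine d p) * Polynomial.X * hm

theorem coeff_flowLine_zero (d : Fin 3 → Poly3) (p : Poly3) : (flowLine d p).coeff 0 = p := by
  have : ((Polynomial.aeval (0 : Poly3)).restrictScalars ℝ).comp (flowLine d) =
      AlgHom.id ℝ Poly3 := by
    ext m : 1
    simp [flowLine_X]
  have h := DFunLike.congr_fun this p
  rw [Polynomial.coeff_zero_eq_eval_zero]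
  exact h

/-- Recursion for the Taylor coefficients. -/
theorem flowLine_coeff_succ {d : Fin 3 → Poly3} {T : Derivation ℝ Poly3 Poly3} {k : Fin 3}
    {q Φ : Poly3} (hX : ∀ m, T (MvPolynomial.X m) = d m)
    (hd : ∀ m, q * T (d m) = T q * d m - if m = k then Φ else 0) (p : Poly3) (j : ℕ) :
    q * T ((flowLine d p).coeff (j + 1)) =
      (j + 2 : Poly3) * q * (flowLine d p).coeff (j + 2) +
        (j + 1 : Poly3) * T q * (flowLine d p).coeff (j + 1) -
        Φ * (flowLine d (MvPolynomial.pderiv k p)).coeff j := by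
  have h := congrArg (fun P => Polynomial.coeff P (j + 1)) (coeffDer_flowLine hX hd p)
  simp only [add_mul, mul_assoc, Polynomial.coeff_sub, Polynomial.coeff_add, Polynomial.coeff_C_mul,
    Polynomial.coeff_X_mul, Polynomial.coeff_derivative, coeff_coeffDer] at h
  push_cast at h
  linear_combination h

theorem flowLine_coeff_one {d : Fin 3 → Poly3} {T : Derivation ℝ Poly3 Poly3} {k : Fin 3}
    {q Φ : Poly3} (hq : q ≠ 0) (hX : ∀ m, T (MvPolynomial.X m) = d m)
    (hd : ∀ m, q * T (d m) = T q * d m - if m = k then Φ else 0) (p : Poly3) :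
    (flowLine d p).coeff 1 = T p := by
  have h := congrArg (fun P => Polynomial.coeff P 0) (coeffDer_flowLine hX hd p)
  simp only [add_mul, mul_assoc, Polynomial.coeff_sub, Polynomial.coeff_add, Polynomial.coeff_C_mul,
    Polynomial.coeff_X_mul_zero, Polynomial.coeff_derivative, coeff_coeffDer,
    coeff_flowLine_zero] at h
  apply mul_left_cancel₀ hq
  push_cast at h
  linear_combination -h

section Flow

variable {d : Fin 3 → Poly3} {T : Derivation ℝ Poly3 Poly3} {k : Fin 3} {f Φ : Poly3}

theorem two_mul_flowLine_coeff_two (hq : MvPolynomial.pderiv k f ≠ 0)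
    (hX : ∀ m, T (MvPolynomial.X m) = d m)
    (hd : ∀ m, MvPolynomial.pderiv k f * T (d m) =
      T (MvPolynomial.pderiv k f) * d m - if m = k then Φ else 0)
    (hf : T f = 0) : 2 * (flowLine d f).coeff 2 = Φ := by
  have h := flowLine_coeff_succ hX hd f 0
  rw [zero_add, zero_add, flowLine_coeff_one hq hX hd, hf, coeff_flowLine_zero] at h
  apply mul_left_cancel₀ hq
  simp only [map_zero, mul_zero, Nat.cast_zero, zero_add, add_zero] at h
  linear_combination -h

theorem six_mul_flowLine_coeff_three (hq : MvPolynomial.pderiv k f ≠ 0)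
    (hX : ∀ m, T (MvPolynomial.X m) = d m)
    (hd : ∀ m, MvPolynomial.pderiv k f * T (d m) =
      T (MvPolynomial.pderiv k f) * d m - if m = k then Φ else 0)
    (hf : T f = 0) : 6 * (flowLine d f).coeff 3 = T Φ := by
  have h := flowLine_coeff_succ hX hd f 1
  have h2 := two_mul_flowLine_coeff_two hq hX hd hf
  have h3 : T Φ = 2 * T ((flowLine d f).coeff 2) := by
    rw [← h2, two_mul, map_add, two_mul]
  rw [flowLine_coeff_one hq hX hd] at h
  apply mul_left_cancel₀ hq
  rw [h3]
  norm_num at h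
  linear_combination (-2 : Poly3) * h - 2 * T (MvPolynomial.pderiv k f) * h2

/-- If the second order condition `Φ = 0` implies the third order one along the surface, then it
implies all higher ones. -/
theorem exists_pow_mul_flowLine_coeff {Δ α β : Poly3} (hq : MvPolynomial.pderiv k f ≠ 0)
    (hX : ∀ m, T (MvPolynomial.X m) = d m)
    (hd : ∀ m, MvPolynomial.pderiv k f * T (d m) =
      T (MvPolynomial.pderiv k f) * d m - if m = k then Φ else 0)
    (hf : T f = 0) (hΔ : Δ * T Φ = α * Φ + β * f) (j : ℕ) :
    ∃ (K : ℕ) (a b : Poly3),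
      (Δ * MvPolynomial.pderiv k f) ^ K * (flowLine d f).coeff j = a * Φ + b * f := by
  set q := MvPolynomial.pderiv k f with hqdef
  match j with
  | 0 => exact ⟨0, 0, 1, by rw [coeff_flowLine_zero]; ring⟩
  | 1 => exact ⟨0, 0, 0, by rw [flowLine_coeff_one hq hX hd, hf]; ring⟩
  | j + 2 =>
    obtain ⟨K, a, b, h⟩ := exists_pow_mul_flowLine_coeff hq hX hd hf hΔ (j + 1)
    set θ := Δ * q with hθ
    set h1 := (flowLine d f).coeff (j + 1)
    have hrec := flowLine_coeff_succ hX hd f j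
    have hT : θ ^ (K + 1) * T h1 = (θ * T a + q * a * α - K * T θ * a) * Φ +
        (θ * T b + q * a * β - K * T θ * b) * f := by
      have h2 := congrArg T h
      simp only [Derivation.leibniz, Derivation.leibniz_pow, map_add, hf, smul_eq_mul,
        nsmul_eq_mul] at h2
      rcases K with _ | K
      · simp only [pow_zero, Nat.cast_zero, zero_mul, mul_zero, zero_add, pow_one, add_zero] at *
        linear_combination θ * h2 + q * a * hΔ
      · simp only [Nat.add_sub_cancel] at h2
        push_cast at *
        linear_combination θ * h2 + q * a * hΔ - ((K : Poly3) + 1) * T θ * h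
    have hunit : ((j : Poly3) + 2) * MvPolynomial.C ((j + 2 : ℝ)⁻¹) = 1 := by
      rw [show ((j : Poly3) + 2) = MvPolynomial.C (j + 2 : ℝ) by
        rw [map_add, map_natCast, map_ofNat], ← MvPolynomial.C_mul,
        mul_inv_cancel₀ (by positivity), MvPolynomial.C_1]
    refine ⟨K + 2, MvPolynomial.C ((j + 2 : ℝ)⁻¹) * Δ * (q *
      (θ * T a + q * a * α - (K : Poly3) * T θ * a) - ((j : Poly3) + 1) * T q * θ * a +
        θ ^ (K + 1) * (flowLine d (MvPolynomial.pderiv k f)).coeff j),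
      MvPolynomial.C ((j + 2 : ℝ)⁻¹) * Δ * (q * (θ * T b + q * a * β - (K : Poly3) * T θ * b) -
        ((j : Poly3) + 1) * T q * θ * b), ?_⟩
    have hu2 : (flowLine d f).coeff (j + 2) = MvPolynomial.C ((j + 2 : ℝ)⁻¹) *
        (((j : Poly3) + 2) * (flowLine d f).coeff (j + 2)) := by
      linear_combination (-(flowLine d f).coeff (j + 2)) * hunit
    rw [hu2]
    generalize (flowLine d f).coeff (j + 2) = h2 at *
    generalize MvPolynomial.C ((j + 2 : ℝ)⁻¹) = c at *
    linear_combination (c * Δ * q) * hT - c * Δ * θ ^ (K + 1) * hrec -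
      (c * Δ * (j + 1) * T q * θ) * h + (c * θ ^ (K + 1) * (j + 2) * h2) * hθ

theorem dvd_flowLine_coeff (hirr : Irreducible f) (hq : ¬ f ∣ MvPolynomial.pderiv k f)
    (hX : ∀ m, T (MvPolynomial.X m) = d m)
    (hd : ∀ m, MvPolynomial.pderiv k f * T (d m) =
      T (MvPolynomial.pderiv k f) * d m - if m = k then Φ else 0)
    (hf : T f = 0) (hΦ : f ∣ Φ) (j : ℕ) : f ∣ (flowLine d f).coeff j := by
  have hq0 : MvPolynomial.pderiv k f ≠ 0 := by
    intro h
    exact hq (h ▸ dvd_zero f)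
  match j with
  | 0 => rw [coeff_flowLine_zero]
  | 1 => rw [flowLine_coeff_one hq0 hX hd, hf]; exact dvd_zero f
  | j + 2 =>
    obtain ⟨a, ha⟩ := dvd_flowLine_coeff hirr hq hX hd hf hΦ (j + 1)
    obtain ⟨b, hb⟩ := hΦ
    have hrec := flowLine_coeff_succ hX hd f j
    rw [ha, Derivation.leibniz, hf, hb] at hrec
    simp only [smul_eq_mul, mul_zero, add_zero] at hrec
    have h1 : f ∣ ((j : Poly3) + 2) * MvPolynomial.pderiv k f * (flowLine d f).coeff (j + 2) :=
      ⟨MvPolynomial.pderiv k f * T a - (j + 1) * T (MvPolynomial.pderiv k f) * a +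
        b * (flowLine d (MvPolynomial.pderiv k f)).coeff j, by linear_combination -hrec⟩
    have hunit : IsUnit ((j : Poly3) + 2) := by
      rw [show ((j : Poly3) + 2) = MvPolynomial.C (j + 2 : ℝ) by
        rw [map_add, map_natCast, map_ofNat]]
      exact (IsUnit.mk0 (j + 2 : ℝ) (by positivity)).map _
    rw [mul_assoc] at h1
    exact ((hirr.prime.dvd_or_dvd (hunit.dvd_mul_left.1 h1)).resolve_left hq)

end Flow

theorem Fin.sum_three_distinct {M : Type*} [AddCommMonoid M] {i j k : Fin 3} (hij : i ≠ j)
    (hik : i ≠ k) (hjk : j ≠ k) (F : Fin 3 → M) : ∑ m, F m = F i + F j + F k := by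
  have h : (Finset.univ : Finset (Fin 3)) = {i, j, k} := by
    symm
    rw [← Finset.card_eq_iff_eq_univ, Finset.card_eq_three.2 ⟨i, j, k, hij, hik, hjk, rfl⟩]
    rfl
  rw [h, Finset.sum_insert (by simp [hij, hik]), Finset.sum_insert (by simp [hjk]),
    Finset.sum_singleton, add_assoc]

theorem Fin.eq_or_eq_or_eq_of_distinct {i j k : Fin 3} (hij : i ≠ j) (hik : i ≠ k) (hjk : j ≠ k)
    (m : Fin 3) : m = i ∨ m = j ∨ m = k := by
  omega

theorem sum_mul_pderiv_eq_zero {f : Poly3} {x w : Pt} (h : lineThrough x w ⊆ zeroSet f) :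
    ∑ m, w m * MvPolynomial.eval x (MvPolynomial.pderiv m f) = 0 := by
  let T : Derivation ℝ Poly3 Poly3 := ∑ m, w m • MvPolynomial.pderiv m
  have hT : ∀ p, T p = ∑ m, w m • MvPolynomial.pderiv m p := fun p => by
    simp only [T, Fin.sum_univ_three]
    rfl
  have hX : ∀ m, T (MvPolynomial.X m) = MvPolynomial.C (w m) := fun m => by
    rw [hT, Finset.sum_eq_single m]
    · rw [MvPolynomial.pderiv_X_self, MvPolynomial.smul_eq_C_mul, mul_one]
    · intro b _ hb
      rw [MvPolynomial.pderiv_X_of_ne hb.symm, smul_zero]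
    · simp
  have h1 := flowLine_coeff_one (k := 0) (q := 1) (Φ := 0) one_ne_zero hX (fun m => by simp) f
  have h2 := map_eval_flowLine (fun m => MvPolynomial.C (w m)) f x
  simp only [MvPolynomial.eval_C] at h2
  rw [restrictLine_eq_zero_of_subset h] at h2
  have h3 := congrArg (fun P => Polynomial.coeff P 1) h2
  simp only [Polynomial.coeff_map, Polynomial.coeff_zero, h1, hT, map_sum,
    MvPolynomial.smul_eval] at h3
  exact h3

/-- The derivation of the coordinate ring of `f = 0` obtained by moving in direction `i` and
compensating in direction `k`. -/
def tanDer (f : Poly3) (k i : Fin 3) : Derivation ℝ Poly3 Poly3 :=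
  MvPolynomial.pderiv k f • MvPolynomial.pderiv i - MvPolynomial.pderiv i f • MvPolynomial.pderiv k

theorem tanDer_apply (f : Poly3) (k i : Fin 3) (p : Poly3) :
    tanDer f k i p = MvPolynomial.pderiv k f * MvPolynomial.pderiv i p -
      MvPolynomial.pderiv i f * MvPolynomial.pderiv k p := rfl

theorem totalDegree_pderiv_le_sub_one (f : Poly3) (i : Fin 3) :
    (MvPolynomial.pderiv i f).totalDegree ≤ f.totalDegree - 1 := by
  conv_lhs => rw [f.as_sum, map_sum]
  refine MvPolynomial.totalDegree_finsetSum_le fun s hs => ?_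
  rw [MvPolynomial.pderiv_monomial]
  by_cases hsi : s i = 0
  · simp [hsi]
  refine (MvPolynomial.totalDegree_monomial_le _ _).trans ?_
  have h1 := MvPolynomial.le_totalDegree hs
  have h2 : (s - Finsupp.single i 1 : Fin 3 →₀ ℕ) + Finsupp.single i 1 = s :=
    tsub_add_cancel_of_le (by simpa using Nat.one_le_iff_ne_zero.2 hsi)
  have h3 := congrArg (fun s : Fin 3 →₀ ℕ => s.sum fun _ e => e) h2
  rw [Finsupp.sum_add_index' (fun _ => rfl) (fun _ _ _ => rfl), Finsupp.sum_single_index rfl] at h3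
  change (Finsupp.sum _ fun _ e => e) ≤ _
  omega

theorem totalDegree_pderiv_le (f : Poly3) (i : Fin 3) :
    (MvPolynomial.pderiv i f).totalDegree ≤ f.totalDegree :=
  (totalDegree_pderiv_le_sub_one f i).trans (Nat.sub_le _ _)

theorem totalDegree_mul_sub_mul_le {a b c d : Poly3} {m : ℕ}
    (h1 : a.totalDegree + b.totalDegree ≤ m) (h2 : c.totalDegree + d.totalDegree ≤ m) :
    (a * b - c * d).totalDegree ≤ m :=
  (MvPolynomial.totalDegree_sub _ _).trans
    (max_le ((MvPolynomial.totalDegree_mul _ _).trans h1)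
      ((MvPolynomial.totalDegree_mul _ _).trans h2))

theorem totalDegree_add_le_of {a b : Poly3} {m : ℕ} (h1 : a.totalDegree ≤ m)
    (h2 : b.totalDegree ≤ m) : (a + b).totalDegree ≤ m :=
  (MvPolynomial.totalDegree_add _ _).trans (max_le h1 h2)

theorem totalDegree_tanDer_le (f : Poly3) (k i : Fin 3) (p : Poly3) :
    (tanDer f k i p).totalDegree ≤ f.totalDegree + p.totalDegree :=
  totalDegree_mul_sub_mul_le (add_le_add (totalDegree_pderiv_le _ _) (totalDegree_pderiv_le _ _))
    (add_le_add (totalDegree_pderiv_le _ _) (totalDegree_pderiv_le _ _))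

/-- Coefficients of the second fundamental form of `f = 0`. -/
def secondForm (f : Poly3) (k i j : Fin 3) : Poly3 :=
  MvPolynomial.pderiv k f * tanDer f k i (MvPolynomial.pderiv j f) -
    MvPolynomial.pderiv j f * tanDer f k i (MvPolynomial.pderiv k f)

theorem totalDegree_secondForm_le (f : Poly3) (k i j : Fin 3) :
    (secondForm f k i j).totalDegree ≤ 3 * f.totalDegree := by
  have h := totalDegree_pderiv_le f
  have h' := totalDegree_tanDer_le f k i
  refine totalDegree_mul_sub_mul_le ?_ ?_
  · have := h k; have := h' (MvPolynomial.pderiv j f); have := h j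
    omega
  · have := h k; have := h' (MvPolynomial.pderiv k f); have := h j
    omega

/-- The mixed coefficient of the second fundamental form. -/
def secondFormMixed (f : Poly3) (k i j : Fin 3) : Poly3 := secondForm f k i j + secondForm f k j i

def flowDer (f : Poly3) (k i j : Fin 3) (u v : ℝ) : Derivation ℝ Poly3 Poly3 :=
  u • tanDer f k i + v • tanDer f k j

theorem flowDer_apply (f : Poly3) (k i j : Fin 3) (u v : ℝ) (p : Poly3) :
    flowDer f k i j u v p =
      MvPolynomial.C u * tanDer f k i p + MvPolynomial.C v * tanDer f k j p := by
  simp [flowDer, MvPolynomial.smul_eq_C_mul]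

def flowField (f : Poly3) (k i j : Fin 3) (u v : ℝ) (m : Fin 3) : Poly3 :=
  flowDer f k i j u v (MvPolynomial.X m)

def quadForm (f : Poly3) (k i j : Fin 3) (u v : ℝ) : Poly3 :=
  MvPolynomial.C (u ^ 2) * secondForm f k i i + MvPolynomial.C (u * v) * secondFormMixed f k i j +
    MvPolynomial.C (v ^ 2) * secondForm f k j j

section Distinct

variable {f : Poly3} {k i j : Fin 3} (u v : ℝ)

theorem flowDer_self : flowDer f k i j u v f = 0 := by
  simp only [flowDer_apply, tanDer_apply]
  ring

theorem flowField_fst (hij : i ≠ j) (hik : i ≠ k) :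
    flowField f k i j u v i = MvPolynomial.C u * MvPolynomial.pderiv k f := by
  simp [flowField, flowDer_apply, tanDer_apply, MvPolynomial.pderiv_X, hij, hik]

theorem flowField_snd (hij : i ≠ j) (hjk : j ≠ k) :
    flowField f k i j u v j = MvPolynomial.C v * MvPolynomial.pderiv k f := by
  simp [flowField, flowDer_apply, tanDer_apply, MvPolynomial.pderiv_X, hij.symm,
    hjk]

theorem flowField_thd (hik : i ≠ k) (hjk : j ≠ k) :
    flowField f k i j u v k = -(MvPolynomial.C u * MvPolynomial.pderiv i f +
      MvPolynomial.C v * MvPolynomial.pderiv j f) := by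
  simp [flowField, flowDer_apply, tanDer_apply, MvPolynomial.pderiv_X, hik.symm,
    hjk.symm]
  ring

theorem flowDer_flowField (hij : i ≠ j) (hik : i ≠ k) (hjk : j ≠ k) (m : Fin 3) :
    MvPolynomial.pderiv k f * flowDer f k i j u v (flowField f k i j u v m) =
      flowDer f k i j u v (MvPolynomial.pderiv k f) * flowField f k i j u v m -
        if m = k then quadForm f k i j u v else 0 := by
  have hC : ∀ (c : ℝ) (p : Poly3), flowDer f k i j u v (MvPolynomial.C c * p) =
      MvPolynomial.C c * flowDer f k i j u v p := by
    intro c p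
    rw [← MvPolynomial.smul_eq_C_mul, Derivation.map_smul, MvPolynomial.smul_eq_C_mul]
  rcases Fin.eq_or_eq_or_eq_of_distinct hij hik hjk m with rfl | rfl | rfl
  · rw [flowField_fst u v hij hik, hC, if_neg hik]
    ring
  · rw [flowField_snd u v hij hjk, hC, if_neg hjk]
    ring
  · rw [flowField_thd u v hik hjk, map_neg, map_add, hC, hC, if_pos rfl]
    simp only [flowDer_apply, quadForm, secondFormMixed, secondForm, map_mul, map_pow]
    ring

theorem eval_quadForm (x : Pt) : MvPolynomial.eval x (quadForm f k i j u v) =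
    MvPolynomial.eval x (secondForm f k i i) * u ^ 2 +
    MvPolynomial.eval x (secondFormMixed f k i j) * (u * v) +
    MvPolynomial.eval x (secondForm f k j j) * v ^ 2 := by
  simp only [quadForm, map_add, map_mul, MvPolynomial.eval_C]
  ring

/-- Coefficients of the third fundamental form of `f = 0`. -/
def thirdForm (f : Poly3) (k i j : Fin 3) : Fin 4 → Poly3 :=
  ![tanDer f k i (secondForm f k i i),
    tanDer f k i (secondFormMixed f k i j) + tanDer f k j (secondForm f k i i),
    tanDer f k i (secondForm f k j j) + tanDer f k j (secondFormMixed f k i j),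
    tanDer f k j (secondForm f k j j)]

theorem flowDer_quadForm : flowDer f k i j u v (quadForm f k i j u v) =
    MvPolynomial.C (u ^ 3) * thirdForm f k i j 0 +
      MvPolynomial.C (u ^ 2 * v) * thirdForm f k i j 1 +
    MvPolynomial.C (u * v ^ 2) * thirdForm f k i j 2 + MvPolynomial.C (v ^ 3) * thirdForm f k i j 3
    := by
  have hC : ∀ (c : ℝ) (p : Poly3), flowDer f k i j u v (MvPolynomial.C c * p) =
      MvPolynomial.C c * flowDer f k i j u v p := by
    intro c p
    rw [← MvPolynomial.smul_eq_C_mul, Derivation.map_smul, MvPolynomial.smul_eq_C_mul]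
  rw [quadForm, map_add, map_add, hC, hC, hC]
  simp only [flowDer_apply, thirdForm, map_mul, map_pow, Matrix.cons_val]
  ring

/-- A line in the surface is an integral line of the tangent field. -/
theorem eval_flowField_eq (hij : i ≠ j) (hik : i ≠ k) (hjk : j ≠ k) {x w : Pt}
    (hq : MvPolynomial.eval x (MvPolynomial.pderiv k f) ≠ 0)
    (hgrad : ∑ m, w m * MvPolynomial.eval x (MvPolynomial.pderiv m f) = 0) :
    (fun m => MvPolynomial.eval x (flowField f k i j
      (w i / MvPolynomial.eval x (MvPolynomial.pderiv k f))
      (w j / MvPolynomial.eval x (MvPolynomial.pderiv k f)) m)) = w := by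
  rw [Fin.sum_three_distinct hij hik hjk] at hgrad
  funext m
  rcases Fin.eq_or_eq_or_eq_of_distinct hij hik hjk m with rfl | rfl | rfl
  · rw [flowField_fst _ _ hij hik]
    simp [hq]
  · rw [flowField_snd _ _ hij hjk]
    simp [hq]
  · rw [flowField_thd _ _ hik hjk]
    simp only [map_neg, map_add, map_mul, MvPolynomial.eval_C]
    field_simp
    linear_combination -hgrad

theorem forms_eq_zero_of_line (hij : i ≠ j) (hik : i ≠ k) (hjk : j ≠ k) {x w : Pt}
    (hq : MvPolynomial.eval x (MvPolynomial.pderiv k f) ≠ 0)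
    (hl : lineThrough x w ⊆ zeroSet f) :
    MvPolynomial.eval x (secondForm f k i i) * w i ^ 2 +
      MvPolynomial.eval x (secondFormMixed f k i j) * (w i * w j) +
      MvPolynomial.eval x (secondForm f k j j) * w j ^ 2 = 0 ∧
    MvPolynomial.eval x (thirdForm f k i j 0) * w i ^ 3 +
      MvPolynomial.eval x (thirdForm f k i j 1) * (w i ^ 2 * w j) +
      MvPolynomial.eval x (thirdForm f k i j 2) * (w i * w j ^ 2) +
      MvPolynomial.eval x (thirdForm f k i j 3) * w j ^ 3 = 0 := by
  set q := MvPolynomial.eval x (MvPolynomial.pderiv k f) with hqd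
  have hq' : MvPolynomial.pderiv k f ≠ 0 := by
    intro h
    rw [h, map_zero] at hqd
    exact hq hqd
  set u := w i / q with hu
  set v := w j / q with hv
  have hw := eval_flowField_eq hij hik hjk hq (sum_mul_pderiv_eq_zero hl)
  rw [← hqd, ← hu, ← hv] at hw
  have h0 := map_eval_flowLine (flowField f k i j u v) f x
  rw [hw, restrictLine_eq_zero_of_subset hl] at h0
  have hcoef : ∀ n, MvPolynomial.eval x ((flowLine (flowField f k i j u v) f).coeff n) = 0 := by
    intro n
    have := congrArg (fun P => Polynomial.coeff P n) h0
    simpa only [Polynomial.coeff_map, Polynomial.coeff_zero] using this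
  have h2 := two_mul_flowLine_coeff_two (d := flowField f k i j u v) hq' (fun _ => rfl)
    (flowDer_flowField u v hij hik hjk) (flowDer_self u v)
  have h3 := six_mul_flowLine_coeff_three (d := flowField f k i j u v) hq'
    (fun _ => rfl)
    (flowDer_flowField u v hij hik hjk) (flowDer_self u v)
  have e2 := congrArg (MvPolynomial.eval x) h2
  have e3 := congrArg (MvPolynomial.eval x) h3
  rw [map_mul, hcoef, mul_zero, eval_quadForm] at e2
  rw [map_mul, hcoef, mul_zero, flowDer_quadForm] at e3
  simp only [map_add, map_mul, MvPolynomial.eval_C] at e3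
  have hwi : w i = u * q := by rw [hu]; field_simp
  have hwj : w j = v * q := by rw [hv]; field_simp
  rw [hwi, hwj]
  constructor
  · linear_combination -(q ^ 2) * e2
  · linear_combination -(q ^ 3) * e3

theorem exists_line_of_quadForm_eq_zero (hij : i ≠ j) (hik : i ≠ k) (hjk : j ≠ k) {u v : ℝ}
    {Δ α β : Poly3}
    (hΔ : Δ * flowDer f k i j u v (quadForm f k i j u v) = α * quadForm f k i j u v + β * f)
    {x : Pt} (hx : x ∈ zeroSet f) (hq : MvPolynomial.eval x (MvPolynomial.pderiv k f) ≠ 0)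
    (hΔx : MvPolynomial.eval x Δ ≠ 0) (huv : MvPolynomial.eval x (quadForm f k i j u v) = 0) :
    lineThrough x (fun m => MvPolynomial.eval x (flowField f k i j u v m)) ⊆ zeroSet f := by
  have hq' : MvPolynomial.pderiv k f ≠ 0 := by
    intro h
    rw [h, map_zero] at hq
    exact hq rfl
  apply subset_zeroSet_of_restrictLine_eq_zero
  rw [← map_eval_flowLine]
  ext n
  rw [Polynomial.coeff_map, Polynomial.coeff_zero]
  obtain ⟨K, a, b, h⟩ := exists_pow_mul_flowLine_coeff (d := flowField f k i j u v) hq'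
    (fun _ => rfl)
    (flowDer_flowField u v hij hik hjk) (flowDer_self u v) hΔ n
  have h' := congrArg (MvPolynomial.eval x) h
  simp only [map_add, map_mul, map_pow, huv, mem_zeroSet.1 hx, mul_zero, add_zero] at h'
  exact (mul_eq_zero.1 h').resolve_left (pow_ne_zero _ (mul_ne_zero hΔx hq))

theorem line_of_dvd_quadForm (hij : i ≠ j) (hik : i ≠ k) (hjk : j ≠ k) {u v : ℝ}
    (hf : Irreducible f) (hqf : ¬ f ∣ MvPolynomial.pderiv k f) (hΦ : f ∣ quadForm f k i j u v)
    {x : Pt} (hx : x ∈ zeroSet f) :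
    lineThrough x (fun m => MvPolynomial.eval x (flowField f k i j u v m)) ⊆ zeroSet f := by
  apply subset_zeroSet_of_restrictLine_eq_zero
  rw [← map_eval_flowLine]
  ext n
  rw [Polynomial.coeff_map, Polynomial.coeff_zero]
  obtain ⟨a, ha⟩ := dvd_flowLine_coeff (d := flowField f k i j u v) hf hqf (fun _ => rfl)
    (flowDer_flowField u v hij hik hjk) (flowDer_self u v) hΦ n
  rw [ha, map_mul, mem_zeroSet.1 hx, zero_mul]

end Distinct

theorem totalDegree_le_of_dvd {f g : Poly3} (h : f ∣ g) (hg : g ≠ 0) :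
    f.totalDegree ≤ g.totalDegree := by
  obtain ⟨c, rfl⟩ := h
  rw [mul_ne_zero_iff] at hg
  rw [MvPolynomial.totalDegree_mul_of_isDomain hg.1 hg.2]
  exact Nat.le_add_right _ _

theorem Irreducible.totalDegree_pos {f : Poly3} (hf : Irreducible f) : 0 < f.totalDegree := by
  rw [Nat.pos_iff_ne_zero]
  intro h
  rw [MvPolynomial.totalDegree_eq_zero_iff_eq_C] at h
  have h0 : f.coeff 0 ≠ 0 := by
    intro h0
    rw [h0, map_zero] at h
    exact hf.ne_zero h
  exact hf.not_isUnit (h ▸ (IsUnit.mk0 _ h0).map MvPolynomial.C)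

theorem exists_not_dvd_pderiv {f : Poly3} (hf : Irreducible f) :
    ∃ k, ¬ f ∣ MvPolynomial.pderiv k f := by
  by_contra! h
  have hpos := hf.totalDegree_pos
  have h0 : ∀ k, MvPolynomial.pderiv k f = 0 := by
    intro k
    by_contra hk
    have := totalDegree_le_of_dvd (h k) hk
    have := totalDegree_pderiv_le_sub_one f k
    omega
  have hle : f.totalDegree ≤ 0 := by
    rw [MvPolynomial.totalDegree]
    refine Finset.sup_le fun s hs => ?_
    have hs0 : s = 0 := by
      ext i
      by_contra hsi
      have h1 := MvPolynomial.coeff_pderiv (i := i) f (s - Finsupp.single i 1)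
      rw [h0 i, MvPolynomial.coeff_zero,
        tsub_add_cancel_of_le (by simpa using Nat.one_le_iff_ne_zero.2 hsi)] at h1
      have h2 := (mul_eq_zero.1 h1.symm).resolve_left (MvPolynomial.mem_support_iff.1 hs)
      have h3 : (0 : ℝ) ≤ ((s - Finsupp.single i 1 : Fin 3 →₀ ℕ) i : ℕ) := Nat.cast_nonneg _
      linarith
    simp [hs0]
  omega

theorem dvd_of_infinite_lines {f g : Poly3} (hf : Irreducible f) {B : Set (Set Pt)}
    (hB : B.Infinite) (h : ∀ l ∈ B, IsLine l ∧ l ⊆ zeroSet f ∧ l ⊆ zeroSet g) : f ∣ g := by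
  by_contra hfg
  obtain ⟨A, hA, hc⟩ := hB.exists_subset_card_eq (f.totalDegree * g.totalDegree + 1)
  have := card_common_lines_le hf hfg A (fun l hl => (h l (hA hl)).1)
    (fun l hl => (h l (hA hl)).2.1) (fun l hl => (h l (hA hl)).2.2)
  omega

theorem dvd_of_rich_lines {f g : Poly3} (hf : Irreducible f) (A : Finset (Set Pt)) {m : ℕ}
    (hg : g.totalDegree ≤ m) (hA : ∀ l ∈ A, IsLine l) (hAf : ∀ l ∈ A, l ⊆ zeroSet f)
    (hr : ∀ l ∈ A, ∃ T : Finset Pt, m < T.card ∧ ∀ x ∈ T, x ∈ l ∧ x ∈ zeroSet g)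
    (hc : f.totalDegree * m < A.card) : f ∣ g := by
  by_contra hfg
  have := card_common_lines_le hf hfg A hA hAf (fun l hl => by
    obtain ⟨T, hT, hT'⟩ := hr l hl
    exact (hA l hl).subset_zeroSet_of_card T hT' (hg.trans_lt hT))
  have := Nat.mul_le_mul_left f.totalDegree hg
  omega

theorem exists_line_not_subset {f g : Poly3} (hf : Irreducible f) (hfg : ¬ f ∣ g)
    (A : Finset (Set Pt)) (hA : ∀ l ∈ A, IsLine l) (hAf : ∀ l ∈ A, l ⊆ zeroSet f)
    (hc : f.totalDegree * g.totalDegree < A.card) : ∃ l ∈ A, ∃ x ∈ l, x ∉ zeroSet g := by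
  by_contra! h
  have := card_common_lines_le hf hfg A hA hAf h
  omega

theorem dir_proportional {f : Poly3} {k i j : Fin 3} (hij : i ≠ j) (hik : i ≠ k) (hjk : j ≠ k)
    {x w w' : Pt} (hq : MvPolynomial.eval x (MvPolynomial.pderiv k f) ≠ 0) (hw : w ≠ 0)
    (hl : lineThrough x w ⊆ zeroSet f) (hl' : lineThrough x w' ⊆ zeroSet f)
    (h : w i * w' j = w j * w' i) : ∃ c : ℝ, w' = c • w := by
  have h1 := sum_mul_pderiv_eq_zero hl
  have h2 := sum_mul_pderiv_eq_zero hl'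
  rw [Fin.sum_three_distinct hij hik hjk] at h1 h2
  set q := MvPolynomial.eval x (MvPolynomial.pderiv k f)
  set a := MvPolynomial.eval x (MvPolynomial.pderiv i f)
  set b := MvPolynomial.eval x (MvPolynomial.pderiv j f)
  have hall : ∀ P : Fin 3 → Prop, P i → P j → P k → ∀ m, P m := by
    intro P hi hj hk m
    rcases Fin.eq_or_eq_or_eq_of_distinct hij hik hjk m with rfl | rfl | rfl <;> assumption
  by_cases hi : w i = 0
  · by_cases hj : w j = 0
    · exfalso
      apply hw
      funext m
      revert m
      refine hall _ hi hj ?_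
      rw [hi, hj] at h1
      simpa [hq] using h1
    · refine ⟨w' j / w j, funext (hall _ ?_ ?_ ?_)⟩
      · rw [hi, zero_mul] at h
        have := (mul_eq_zero.1 h.symm).resolve_left hj
        simp [hi, this]
      · simp [hj]
      · simp only [Pi.smul_apply, smul_eq_mul]
        field_simp
        apply mul_right_cancel₀ hq
        linear_combination w j * h2 - w' j * h1 + a * h
  · refine ⟨w' i / w i, funext (hall _ ?_ ?_ ?_)⟩
    · simp [hi]
    · simp only [Pi.smul_apply, smul_eq_mul]
      field_simp
      linear_combination h
    · simp only [Pi.smul_apply, smul_eq_mul]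
      field_simp
      apply mul_right_cancel₀ hq
      linear_combination w i * h2 - w' i * h1 - b * h

theorem dir_independent {f : Poly3} {k i j : Fin 3} (hij : i ≠ j) (hik : i ≠ k) (hjk : j ≠ k)
    {x w w' : Pt} (hq : MvPolynomial.eval x (MvPolynomial.pderiv k f) ≠ 0) (hw : w ≠ 0)
    (hw' : w' ≠ 0) (hl : lineThrough x w ⊆ zeroSet f) (hl' : lineThrough x w' ⊆ zeroSet f)
    (hne : lineThrough x w ≠ lineThrough x w') : w i * w' j - w j * w' i ≠ 0 := by
  intro h
  obtain ⟨c, rfl⟩ := dir_proportional hij hik hjk hq hw hl hl' (sub_eq_zero.1 h)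
  apply hne
  rw [lineThrough_smul]
  rintro rfl
  simp at hw'

section Quadratic

variable {A B C u₁ v₁ u₂ v₂ : ℝ}

theorem quadratic_eq_of_roots (h₁ : A * u₁ ^ 2 + B * (u₁ * v₁) + C * v₁ ^ 2 = 0)
    (h₂ : A * u₂ ^ 2 + B * (u₂ * v₂) + C * v₂ ^ 2 = 0) (hD : u₁ * v₂ - v₁ * u₂ ≠ 0) :
    ∃ μ : ℝ, A = -(μ * (v₁ * v₂)) ∧ B = μ * (u₁ * v₂ + u₂ * v₁) ∧ C = -(μ * (u₁ * u₂)) := by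
  have hD2 := pow_ne_zero 2 hD
  obtain ⟨μ, hμ⟩ : ∃ μ, μ * (u₁ * v₂ - v₁ * u₂) ^ 2 =
      2 * A * u₁ * u₂ + B * (u₁ * v₂ + u₂ * v₁) + 2 * C * v₁ * v₂ := ⟨_, div_mul_cancel₀ _ hD2⟩
  refine ⟨μ, ?_, ?_, ?_⟩ <;> apply mul_right_cancel₀ hD2
  · linear_combination v₂ ^ 2 * h₁ + v₁ ^ 2 * h₂ + v₁ * v₂ * hμ
  · linear_combination -2 * u₂ * v₂ * h₁ - 2 * u₁ * v₁ * h₂ - (u₁ * v₂ + u₂ * v₁) * hμ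
  · linear_combination u₂ ^ 2 * h₁ + u₁ ^ 2 * h₂ + u₁ * u₂ * hμ

theorem quadratic_eq_zero_of_disc (h₁ : A * u₁ ^ 2 + B * (u₁ * v₁) + C * v₁ ^ 2 = 0)
    (h₂ : A * u₂ ^ 2 + B * (u₂ * v₂) + C * v₂ ^ 2 = 0) (hD : u₁ * v₂ - v₁ * u₂ ≠ 0)
    (hdisc : B ^ 2 - 4 * A * C = 0) : A = 0 ∧ B = 0 ∧ C = 0 := by
  obtain ⟨μ, rfl, rfl, rfl⟩ := quadratic_eq_of_roots h₁ h₂ hD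
  have h : (μ * (u₁ * v₂ - v₁ * u₂)) ^ 2 = 0 := by linear_combination hdisc
  have hμ : μ = 0 := (mul_eq_zero.1 (pow_eq_zero_iff two_ne_zero |>.1 h)).resolve_right hD
  simp [hμ]

theorem quadratic_root_cases (h₁ : A * u₁ ^ 2 + B * (u₁ * v₁) + C * v₁ ^ 2 = 0)
    (h₂ : A * u₂ ^ 2 + B * (u₂ * v₂) + C * v₂ ^ 2 = 0) (hD : u₁ * v₂ - v₁ * u₂ ≠ 0)
    {u v : ℝ} (h : A * u ^ 2 + B * (u * v) + C * v ^ 2 = 0) :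
    (A = 0 ∧ B = 0 ∧ C = 0) ∨ u₁ * v - v₁ * u = 0 ∨ u₂ * v - v₂ * u = 0 := by
  obtain ⟨μ, rfl, rfl, rfl⟩ := quadratic_eq_of_roots h₁ h₂ hD
  have h : μ * ((u₁ * v - v₁ * u) * (u₂ * v - v₂ * u)) = 0 := by linear_combination -h
  rcases mul_eq_zero.1 h with h | h
  · simp [h]
  · exact Or.inr (mul_eq_zero.1 h)

end Quadratic

/-- A surface which is totally flat is a plane. -/
theorem totalDegree_le_one_of_flat {f : Poly3} {k i j : Fin 3} (hij : i ≠ j) (hik : i ≠ k)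
    (hjk : j ≠ k) (hf : Irreducible f) (hqf : ¬ f ∣ MvPolynomial.pderiv k f)
    (hA : f ∣ secondForm f k i i) (hB : f ∣ secondFormMixed f k i j) (hC : f ∣ secondForm f k j j)
    {x : Pt} (hx : x ∈ zeroSet f) (hq : MvPolynomial.eval x (MvPolynomial.pderiv k f) ≠ 0) :
    f.totalDegree ≤ 1 := by
  set g := affinePoly x fun m => MvPolynomial.eval x (MvPolynomial.pderiv m f) with hg
  set d : ℝ → Pt := fun s m => MvPolynomial.eval x (flowField f k i j 1 s m) with hd
  have hdi : ∀ s, d s i = MvPolynomial.eval x (MvPolynomial.pderiv k f) := fun s => by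
    simp only [hd]
    rw [flowField_fst _ _ hij hik]
    simp
  have hdj : ∀ s, d s j = s * MvPolynomial.eval x (MvPolynomial.pderiv k f) := fun s => by
    simp only [hd]
    rw [flowField_snd _ _ hij hjk]
    simp
  have hdk : ∀ s, d s k = -(MvPolynomial.eval x (MvPolynomial.pderiv i f) +
      s * MvPolynomial.eval x (MvPolynomial.pderiv j f)) := fun s => by
    simp only [hd]
    rw [flowField_thd _ _ hik hjk]
    simp
  have hd0 : ∀ s, d s ≠ 0 := fun s h => hq (by rw [← hdi s, h]; rfl)
  have hline : ∀ s, lineThrough x (d s) ⊆ zeroSet f := fun s =>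
    line_of_dvd_quadForm hij hik hjk hf hqf
      (dvd_add (dvd_add (hA.mul_left _) (hB.mul_left _)) (hC.mul_left _)) hx
  have hdvd : f ∣ g := by
    refine dvd_of_infinite_lines hf (B := Set.range fun s => lineThrough x (d s))
      (Set.infinite_range_of_injective ?_) ?_
    · intro s s' hs
      have hmem : x + (1 : ℝ) • d s' ∈ lineThrough x (d s) := by
        simp only at hs
        rw [hs]
        exact ⟨1, rfl⟩
      obtain ⟨t, ht⟩ := hmem
      have ht' : t • d s = (1 : ℝ) • d s' := add_left_cancel ht
      have e1 := congrFun ht' i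
      have e2 := congrFun ht' j
      simp only [Pi.smul_apply, smul_eq_mul, hdi, hdj, one_mul] at e1 e2
      have ht1 : t = 1 := mul_right_cancel₀ hq (by rw [e1, one_mul])
      rw [ht1, one_mul] at e2
      exact mul_right_cancel₀ hq e2
    · rintro _ ⟨s, rfl⟩
      refine ⟨⟨x, d s, hd0 s, rfl⟩, hline s, ?_⟩
      rintro _ ⟨t, rfl⟩
      rw [mem_zeroSet, hg, eval_affinePoly]
      simp only [add_sub_cancel_left, dotProduct]
      rw [Fin.sum_three_distinct hij hik hjk]
      simp only [Pi.smul_apply, smul_eq_mul, hdi, hdj, hdk]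
      ring
  have hg0 : g ≠ 0 := by
    intro h0
    have h1 := eval_affinePoly x (fun m => MvPolynomial.eval x (MvPolynomial.pderiv m f))
      (x + Pi.single k 1)
    rw [← hg, h0] at h1
    simp only [map_zero, add_sub_cancel_left, dotProduct_single, mul_one] at h1
    exact hq h1.symm
  exact (totalDegree_le_of_dvd hdvd hg0).trans (totalDegree_affinePoly_le _ _)

theorem exists_fin3_distinct (k : Fin 3) : ∃ i j : Fin 3, i ≠ j ∧ i ≠ k ∧ j ≠ k :=
  ⟨k + 1, k + 2, by omega, by omega, by omega⟩

theorem totalDegree_mul_le_of {a b : Poly3} {m n : ℕ} (h1 : a.totalDegree ≤ m)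
    (h2 : b.totalDegree ≤ n) : (a * b).totalDegree ≤ m + n :=
  (MvPolynomial.totalDegree_mul _ _).trans (add_le_add h1 h2)

theorem totalDegree_secondFormMixed_le (f : Poly3) (k i j : Fin 3) :
    (secondFormMixed f k i j).totalDegree ≤ 3 * f.totalDegree :=
  totalDegree_add_le_of (totalDegree_secondForm_le _ _ _ _) (totalDegree_secondForm_le _ _ _ _)

/-- If the second fundamental form vanishes at many points of many lines, the surface is a plane. -/
theorem totalDegree_le_one_of_flat_points {f : Poly3} {k i j : Fin 3} (hij : i ≠ j) (hik : i ≠ k)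
    (hjk : j ≠ k) (hf : Irreducible f) (hqf : ¬ f ∣ MvPolynomial.pderiv k f)
    (A : Finset (Set Pt)) (hA : ∀ l ∈ A, IsLine l) (hAf : ∀ l ∈ A, l ⊆ zeroSet f)
    (hr : ∀ l ∈ A, ∃ T : Finset Pt, 4 * f.totalDegree < T.card ∧ ∀ x ∈ T, x ∈ l ∧
      (MvPolynomial.eval x (MvPolynomial.pderiv k f) ≠ 0 →
        MvPolynomial.eval x (secondForm f k i i) = 0 ∧
        MvPolynomial.eval x (secondFormMixed f k i j) = 0 ∧
        MvPolynomial.eval x (secondForm f k j j) = 0))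
    (hc : f.totalDegree * (4 * f.totalDegree) < A.card) : f.totalDegree ≤ 1 := by
  have hq := totalDegree_pderiv_le f k
  have key : ∀ g : Poly3, g.totalDegree ≤ 3 * f.totalDegree →
      (∀ x, (MvPolynomial.eval x (secondForm f k i i) = 0 ∧
        MvPolynomial.eval x (secondFormMixed f k i j) = 0 ∧
        MvPolynomial.eval x (secondForm f k j j) = 0) → MvPolynomial.eval x g = 0) → f ∣ g := by
    intro g hg hg0
    have h : f ∣ MvPolynomial.pderiv k f * g := by
      refine dvd_of_rich_lines hf A (m := 4 * f.totalDegree) ?_ hA hAf ?_ hc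
      · exact (totalDegree_mul_le_of hq hg).trans (by omega)
      · intro l hl
        obtain ⟨T, hT, hT'⟩ := hr l hl
        refine ⟨T, hT, fun x hx => ⟨(hT' x hx).1, ?_⟩⟩
        rw [mem_zeroSet, map_mul]
        by_cases h0 : MvPolynomial.eval x (MvPolynomial.pderiv k f) = 0
        · rw [h0, zero_mul]
        · rw [hg0 x ((hT' x hx).2 h0), mul_zero]
    exact (hf.prime.dvd_or_dvd h).resolve_left hqf
  obtain ⟨l, hl, x, hxl, hx⟩ := exists_line_not_subset hf hqf A hA hAf
    ((Nat.mul_le_mul_left _ (hq.trans (by omega))).trans_lt hc)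
  exact totalDegree_le_one_of_flat hij hik hjk hf hqf
    (key _ (totalDegree_secondForm_le _ _ _ _) fun x h => h.1)
    (key _ (totalDegree_secondFormMixed_le _ _ _ _) fun x h => h.2.1)
    (key _ (totalDegree_secondForm_le _ _ _ _) fun x h => h.2.2) (hAf l hl hxl) hx

/-- **Flat lines.** A surface that is not a plane contains few lines with many points at which
three lines of the surface meet. -/
theorem card_flat_lines_le {f : Poly3} (hf : Irreducible f) (hdeg : 2 ≤ f.totalDegree)
    (A : Finset (Set Pt)) (hA : ∀ l ∈ A, IsLine l) (hAf : ∀ l ∈ A, l ⊆ zeroSet f)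
    (hr : ∀ l ∈ A, ∃ T : Finset Pt, 4 * f.totalDegree < T.card ∧ ∀ x ∈ T, x ∈ l ∧
      ∃ l₁ l₂, IsLine l₁ ∧ IsLine l₂ ∧ x ∈ l₁ ∧ x ∈ l₂ ∧ l₁ ⊆ zeroSet f ∧ l₂ ⊆ zeroSet f ∧
        l ≠ l₁ ∧ l ≠ l₂ ∧ l₁ ≠ l₂) :
    A.card ≤ f.totalDegree * (4 * f.totalDegree) := by
  by_contra! hc
  obtain ⟨k, hqf⟩ := exists_not_dvd_pderiv hf
  obtain ⟨i, j, hij, hik, hjk⟩ := exists_fin3_distinct k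
  have := totalDegree_le_one_of_flat_points hij hik hjk hf hqf A hA hAf (fun l hl => by
    obtain ⟨T, hT, hT'⟩ := hr l hl
    refine ⟨T, hT, fun x hx => ⟨(hT' x hx).1, fun hq => ?_⟩⟩
    obtain ⟨hxl, l₁, l₂, h₁, h₂, hx₁, hx₂, hs₁, hs₂, hn₁, hn₂, hn⟩ := hT' x hx
    obtain ⟨w, hw, rfl⟩ := (hA l hl).exists_dir hxl
    obtain ⟨w₁, hw₁, rfl⟩ := h₁.exists_dir hx₁
    obtain ⟨w₂, hw₂, rfl⟩ := h₂.exists_dir hx₂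
    have hs := hAf _ hl
    rcases quadratic_root_cases (forms_eq_zero_of_line hij hik hjk hq hs).1
      (forms_eq_zero_of_line hij hik hjk hq hs₁).1 (dir_independent hij hik hjk hq hw hw₁ hs hs₁
        hn₁)
      (forms_eq_zero_of_line hij hik hjk hq hs₂).1 with h | h | h
    · exact h
    · exact absurd h (dir_independent hij hik hjk hq hw hw₂ hs hs₂ hn₂)
    · exact absurd h (dir_independent hij hik hjk hq hw₁ hw₂ hs₁ hs₂ hn)) hc
  omega

theorem det_submatrix_succAbove_eq_zero (R : Matrix (Fin 3) (Fin 4) ℝ) {p q : Fin 4 → ℝ}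
    (hp : R.mulVec p = 0) (hq : R.mulVec q = 0) {a b : Fin 4} (h : p a * q b - p b * q a ≠ 0)
    (d : Fin 4) : (R.submatrix id d.succAbove).det = 0 := by
  obtain ⟨r, hr, hr0, hrd⟩ : ∃ r : Fin 4 → ℝ, R.mulVec r = 0 ∧ r ≠ 0 ∧ r d = 0 := by
    by_cases hpd : p d = 0
    · by_cases hp0 : p = 0
      · simp [hp0] at h
      · exact ⟨p, hp, hp0, hpd⟩
    · refine ⟨q d • p - p d • q, ?_, ?_, ?_⟩
      · rw [Matrix.mulVec_sub, Matrix.mulVec_smul, Matrix.mulVec_smul, hp, hq]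
        simp
      · intro h0
        have ha := congrFun h0 a
        have hb := congrFun h0 b
        simp only [Pi.sub_apply, Pi.smul_apply, smul_eq_mul, Pi.zero_apply] at ha hb
        exact h (mul_left_cancel₀ hpd (by linear_combination p b * ha - p a * hb))
      · simp only [Pi.sub_apply, Pi.smul_apply, smul_eq_mul]
        ring
  refine Matrix.exists_mulVec_eq_zero_iff.1 ⟨r ∘ d.succAbove, ?_, ?_⟩
  · intro h0
    apply hr0
    funext m
    induction m using d.succAboveCases with
    | x => exact hrd
    | p m => exact congrFun h0 m
  · funext c
    have := congrFun hr c
    simp only [Matrix.mulVec, dotProduct, Fin.sum_univ_succAbove _ d, hrd, mul_zero,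
      zero_add] at this
    simpa [Matrix.mulVec, dotProduct] using this

/-- A binary cubic and a binary quadratic form with two common roots have vanishing
resultant minors. -/
theorem cubic_minors_eq_zero {A B C u₁ v₁ u₂ v₂ c₀ c₁ c₂ c₃ : ℝ}
    (h₁ : A * u₁ ^ 2 + B * (u₁ * v₁) + C * v₁ ^ 2 = 0)
    (h₂ : A * u₂ ^ 2 + B * (u₂ * v₂) + C * v₂ ^ 2 = 0)
    (h₁' : c₀ * u₁ ^ 3 + c₁ * (u₁ ^ 2 * v₁) + c₂ * (u₁ * v₁ ^ 2) + c₃ * v₁ ^ 3 = 0)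
    (h₂' : c₀ * u₂ ^ 3 + c₁ * (u₂ ^ 2 * v₂) + c₂ * (u₂ * v₂ ^ 2) + c₃ * v₂ ^ 3 = 0)
    (hD : u₁ * v₂ - v₁ * u₂ ≠ 0) :
    c₁ * (C * C) - c₂ * (B * C) + c₃ * (B * B - A * C) = 0 ∧
    c₀ * (C * C) - c₂ * (A * C) + c₃ * (A * B) = 0 ∧
    c₀ * (B * C) - c₁ * (A * C) + c₃ * (A * A) = 0 ∧
    c₀ * (B * B - A * C) - c₁ * (A * B) + c₂ * (A * A) = 0 := by
  have hR : ∀ {u v : ℝ}, A * u ^ 2 + B * (u * v) + C * v ^ 2 = 0 →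
      c₀ * u ^ 3 + c₁ * (u ^ 2 * v) + c₂ * (u * v ^ 2) + c₃ * v ^ 3 = 0 →
      Matrix.mulVec !![c₀, c₁, c₂, c₃; A, B, C, 0; 0, A, B, C]
        ![u ^ 3, u ^ 2 * v, u * v ^ 2, v ^ 3] = 0 := by
    intro u v h h'
    funext m
    fin_cases m
    · simpa [Matrix.mulVec, dotProduct, Fin.sum_univ_four] using h'
    · simp [Matrix.mulVec, dotProduct, Fin.sum_univ_four]
      linear_combination u * h
    · simp [Matrix.mulVec, dotProduct, Fin.sum_univ_four]
      linear_combination v * h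
  have hne : u₁ ^ 3 * v₂ ^ 3 - v₁ ^ 3 * u₂ ^ 3 ≠ 0 := by
    rw [← mul_pow, ← mul_pow, sub_ne_zero]
    intro h
    exact hD (sub_eq_zero.2 ((Odd.strictMono_pow (by decide : Odd 3)).injective h))
  have key := det_submatrix_succAbove_eq_zero _ (hR h₁ h₁') (hR h₂ h₂') (a := 0) (b := 3)
    (by simpa using hne)
  have k0 := key 0
  have k1 := key 1
  have k2 := key 2
  have k3 := key 3
  rw [Matrix.det_fin_three] at k0 k1 k2 k3
  simp [Fin.succAbove, Fin.lt_def] at k0 k1 k2 k3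
  refine ⟨?_, ?_, ?_, ?_⟩
  · linear_combination k0
  · linear_combination k1
  · linear_combination k2
  · linear_combination k3

theorem exists_second_root {A B C u v : ℝ} (h : A * u ^ 2 + B * (u * v) + C * v ^ 2 = 0)
    (huv : u ≠ 0 ∨ v ≠ 0) (hdisc : B ^ 2 - 4 * A * C ≠ 0) :
    ∃ u' v', A * u' ^ 2 + B * (u' * v') + C * v' ^ 2 = 0 ∧ u * v' - v * u' ≠ 0 := by
  by_cases hv : v = 0
  · subst hv
    have hu : u ≠ 0 := by simpa using huv
    have hA : A = 0 := by simpa [hu] using h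
    subst hA
    refine ⟨-C, B, by ring, ?_⟩
    have hB : B ≠ 0 := by
      rintro rfl
      simp at hdisc
    simp [hu, hB]
  · refine ⟨B * v + u * A, -(A * v), by linear_combination A * A * h + 0 * h, ?_⟩
    intro h0
    have h1 : v * (2 * A * u + B * v) = 0 := by linear_combination -h0
    have h2 := (mul_eq_zero.1 h1).resolve_left hv
    have h3 : (B ^ 2 - 4 * A * C) * v ^ 2 = 0 := by
      linear_combination (2 * A * u + B * v) * h2 - 4 * A * h
    exact hdisc ((mul_eq_zero.1 h3).resolve_right (pow_ne_zero 2 hv))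

theorem totalDegree_thirdForm_le (f : Poly3) (k i j : Fin 3) (m : Fin 4) :
    (thirdForm f k i j m).totalDegree ≤ 4 * f.totalDegree := by
  have h1 : ∀ a (p : Poly3), p.totalDegree ≤ 3 * f.totalDegree →
      (tanDer f k a p).totalDegree ≤ 4 * f.totalDegree := fun a p hp =>
    (totalDegree_tanDer_le f k a p).trans (by omega)
  have hA := totalDegree_secondForm_le f k i i
  have hC := totalDegree_secondForm_le f k j j
  have hB := totalDegree_secondFormMixed_le f k i j
  fin_cases m
  · exact h1 _ _ hA
  · exact totalDegree_add_le_of (h1 _ _ hB) (h1 _ _ hA)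
  · exact totalDegree_add_le_of (h1 _ _ hC) (h1 _ _ hB)
  · exact h1 _ _ hC

/-- Off the zero set of `θ`, the asymptotic directions of the surface `f = 0` are distinct and
every real one spans a line contained in the surface. -/
structure IsRuledOff (f : Poly3) (k i j : Fin 3) (θ : Poly3) : Prop where
  hij : i ≠ j
  hik : i ≠ k
  hjk : j ≠ k
  irreducible : Irreducible f
  not_dvd : ¬ f ∣ θ
  eval_pderiv_ne : ∀ x, MvPolynomial.eval x θ ≠ 0 →
    MvPolynomial.eval x (MvPolynomial.pderiv k f) ≠ 0
  disc_ne : ∀ x, MvPolynomial.eval x θ ≠ 0 → MvPolynomial.eval x (secondFormMixed f k i j) ^ 2 -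
    4 * MvPolynomial.eval x (secondForm f k i i) * MvPolynomial.eval x (secondForm f k j j) ≠ 0
  line_subset : ∀ x ∈ zeroSet f, MvPolynomial.eval x θ ≠ 0 → ∀ u v : ℝ,
    MvPolynomial.eval x (quadForm f k i j u v) = 0 →
    lineThrough x (fun m => MvPolynomial.eval x (flowField f k i j u v m)) ⊆ zeroSet f

theorem exists_cramer {f A B C c₀ c₁ c₂ c₃ : Poly3}
    (hABC : ¬ (f ∣ A ∧ f ∣ B ∧ f ∣ C))
    (h0 : f ∣ c₁ * (C * C) - c₂ * (B * C) + c₃ * (B * B - A * C))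
    (h1 : f ∣ c₀ * (C * C) - c₂ * (A * C) + c₃ * (A * B))
    (h2 : f ∣ c₀ * (B * C) - c₁ * (A * C) + c₃ * (A * A))
    (h3 : f ∣ c₀ * (B * B - A * C) - c₁ * (A * B) + c₂ * (A * A)) :
    ∃ E α β, (E = A ∨ E = B ∨ E = C) ∧ ¬ f ∣ E ∧ f ∣ E * E * c₀ - α * A ∧
      f ∣ E * E * c₁ - (α * B + β * A) ∧ f ∣ E * E * c₂ - (α * C + β * B) ∧
      f ∣ E * E * c₃ - β * C := by
  obtain ⟨a0, h0⟩ := h0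
  obtain ⟨a1, h1⟩ := h1
  obtain ⟨a2, h2⟩ := h2
  obtain ⟨a3, h3⟩ := h3
  by_cases hA : f ∣ A
  · by_cases hC : f ∣ C
    · have hB : ¬ f ∣ B := fun hB => hABC ⟨hA, hB, hC⟩
      obtain ⟨A', rfl⟩ := hA
      obtain ⟨C', rfl⟩ := hC
      refine ⟨B, B * c₁, B * c₂, Or.inr (Or.inl rfl), hB,
        ⟨a3 + c₀ * A' * (f * C') + c₁ * (A' * B) - c₂ * A' * (f * A') - B * c₁ * A', ?_⟩,
        ⟨-(B * c₂ * A'), ?_⟩, ⟨-(B * c₁ * C'), ?_⟩,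
        ⟨a0 + c₃ * A' * (f * C') + c₂ * (C' * B) - c₁ * C' * (f * C') - B * c₂ * C', ?_⟩⟩
      · linear_combination h3
      · ring
      · ring
      · linear_combination h0
    · refine ⟨C, C * c₂ - B * c₃, C * c₃, Or.inr (Or.inr rfl), hC, ⟨a1, ?_⟩, ⟨a0, ?_⟩,
        ⟨0, ?_⟩, ⟨0, ?_⟩⟩
      · linear_combination h1
      · linear_combination h0
      · ring
      · ring
  · refine ⟨A, A * c₀, A * c₁ - B * c₀, Or.inl rfl, hA, ⟨0, ?_⟩, ⟨0, ?_⟩, ⟨a3, ?_⟩, ⟨a2, ?_⟩⟩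
    · ring
    · ring
    · linear_combination h3
    · linear_combination h2

/-- A surface of degree at least two with many lines, each crossing many other lines of the
surface, is generically ruled along its asymptotic directions. -/
theorem exists_isRuledOff {f : Poly3} {k i j : Fin 3} (hij : i ≠ j) (hik : i ≠ k)
    (hjk : j ≠ k) (hf : Irreducible f) (hqf : ¬ f ∣ MvPolynomial.pderiv k f)
    (hdeg : 2 ≤ f.totalDegree)
    (A : Finset (Set Pt)) (hA : ∀ l ∈ A, IsLine l) (hAf : ∀ l ∈ A, l ⊆ zeroSet f)
    (hr : ∀ l ∈ A, ∃ T : Finset Pt, 11 * f.totalDegree < T.card ∧ ∀ x ∈ T, x ∈ l ∧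
      ∃ l', IsLine l' ∧ x ∈ l' ∧ l' ⊆ zeroSet f ∧ l ≠ l')
    (hc : f.totalDegree * (11 * f.totalDegree) < A.card) :
    ∃ θ, θ.totalDegree ≤ 13 * f.totalDegree ∧ IsRuledOff f k i j θ := by
  set e := f.totalDegree with he
  set q := MvPolynomial.pderiv k f with hq
  set a := secondForm f k i i with ha
  set b := secondFormMixed f k i j with hb
  set c := secondForm f k j j with hcc
  set t := thirdForm f k i j with ht
  have hqd : q.totalDegree ≤ e := totalDegree_pderiv_le f k
  have had : a.totalDegree ≤ 3 * e := totalDegree_secondForm_le _ _ _ _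
  have hbd : b.totalDegree ≤ 3 * e := totalDegree_secondFormMixed_le _ _ _ _
  have hcd : c.totalDegree ≤ 3 * e := totalDegree_secondForm_le _ _ _ _
  have htd : ∀ m, (t m).totalDegree ≤ 4 * e := totalDegree_thirdForm_le _ _ _ _
  have two : ∀ l ∈ A, ∃ T : Finset Pt, 11 * e < T.card ∧ ∀ x ∈ T, x ∈ l ∧ x ∈ zeroSet f ∧
      ∃ w w' : Pt, lineThrough x w ⊆ zeroSet f ∧ lineThrough x w' ⊆ zeroSet f ∧
        (MvPolynomial.eval x q ≠ 0 → w i * w' j - w j * w' i ≠ 0) := by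
    intro l hl
    obtain ⟨T, hT, hT'⟩ := hr l hl
    refine ⟨T, hT, fun x hx => ?_⟩
    obtain ⟨hxl, l', hl', hxl', hs', hne⟩ := hT' x hx
    refine ⟨hxl, hAf l hl hxl, ?_⟩
    obtain ⟨w, hw, rfl⟩ := (hA l hl).exists_dir hxl
    obtain ⟨w', hw', rfl⟩ := hl'.exists_dir hxl'
    exact ⟨w, w', hAf _ hl, hs', fun hq0 =>
      dir_independent hij hik hjk hq0 hw hw' (hAf _ hl) hs' hne⟩
  have hdvd : ∀ g : Poly3, g.totalDegree ≤ 10 * e →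
      (∀ x, MvPolynomial.eval x q ≠ 0 → ∀ w w' : Pt, lineThrough x w ⊆ zeroSet f →
        lineThrough x w' ⊆ zeroSet f → w i * w' j - w j * w' i ≠ 0 →
        MvPolynomial.eval x g = 0) → f ∣ g := by
    intro g hg hg0
    have h : f ∣ q * g := by
      refine dvd_of_rich_lines hf A (m := 11 * e) ?_ hA hAf ?_ hc
      · exact (totalDegree_mul_le_of hqd hg).trans (by omega)
      · intro l hl
        obtain ⟨T, hT, hT'⟩ := two l hl
        refine ⟨T, hT, fun x hx => ⟨(hT' x hx).1, ?_⟩⟩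
        obtain ⟨-, -, w, w', h1, h2, h3⟩ := hT' x hx
        rw [mem_zeroSet, map_mul]
        by_cases h0 : MvPolynomial.eval x q = 0
        · rw [h0, zero_mul]
        · rw [hg0 x h0 w w' h1 h2 (h3 h0), mul_zero]
    exact (hf.prime.dvd_or_dvd h).resolve_left hqf
  have hmin : f ∣ t 1 * (c * c) - t 2 * (b * c) + t 3 * (b * b - a * c) ∧
      f ∣ t 0 * (c * c) - t 2 * (a * c) + t 3 * (a * b) ∧
      f ∣ t 0 * (b * c) - t 1 * (a * c) + t 3 * (a * a) ∧
      f ∣ t 0 * (b * b - a * c) - t 1 * (a * b) + t 2 * (a * a) := by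
    have hz : ∀ x, MvPolynomial.eval x q ≠ 0 → ∀ w w' : Pt, lineThrough x w ⊆ zeroSet f →
        lineThrough x w' ⊆ zeroSet f → w i * w' j - w j * w' i ≠ 0 → _ :=
      fun x hx w w' h1 h2 h3 => cubic_minors_eq_zero
        (forms_eq_zero_of_line hij hik hjk hx h1).1 (forms_eq_zero_of_line hij hik hjk hx h2).1
        (forms_eq_zero_of_line hij hik hjk hx h1).2 (forms_eq_zero_of_line hij hik hjk hx h2).2 h3
    have hd2 : ∀ {x y : Poly3}, x.totalDegree ≤ 3 * e → y.totalDegree ≤ 3 * e →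
        (x * y).totalDegree ≤ 6 * e := fun h1 h2 => (totalDegree_mul_le_of h1 h2).trans (by omega)
    have hd3 : ∀ m {x : Poly3}, x.totalDegree ≤ 6 * e → (t m * x).totalDegree ≤ 10 * e :=
      fun m x h => (totalDegree_mul_le_of (htd m) h).trans (by omega)
    have hds : ∀ {x y : Poly3} {n : ℕ}, x.totalDegree ≤ n → y.totalDegree ≤ n →
        (x - y).totalDegree ≤ n := fun h1 h2 =>
      (MvPolynomial.totalDegree_sub _ _).trans (max_le h1 h2)
    refine ⟨hdvd _ ?_ fun x hx w w' h1 h2 h3 => ?_, hdvd _ ?_ fun x hx w w' h1 h2 h3 => ?_,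
      hdvd _ ?_ fun x hx w w' h1 h2 h3 => ?_, hdvd _ ?_ fun x hx w w' h1 h2 h3 => ?_⟩
    · exact totalDegree_add_le_of (hds (hd3 _ (hd2 hcd hcd)) (hd3 _ (hd2 hbd hcd)))
        (hd3 _ (hds (hd2 hbd hbd) (hd2 had hcd)))
    · simpa using (hz x hx w w' h1 h2 h3).1
    · exact totalDegree_add_le_of (hds (hd3 _ (hd2 hcd hcd)) (hd3 _ (hd2 had hcd)))
        (hd3 _ (hd2 had hbd))
    · simpa using (hz x hx w w' h1 h2 h3).2.1
    · exact totalDegree_add_le_of (hds (hd3 _ (hd2 hbd hcd)) (hd3 _ (hd2 had hcd)))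
        (hd3 _ (hd2 had had))
    · simpa using (hz x hx w w' h1 h2 h3).2.2.1
    · exact totalDegree_add_le_of (hds (hd3 _ (hds (hd2 hbd hbd) (hd2 had hcd)))
        (hd3 _ (hd2 had hbd))) (hd3 _ (hd2 had had))
    · simpa using (hz x hx w w' h1 h2 h3).2.2.2
  have hdisc : ¬ f ∣ b ^ 2 - MvPolynomial.C 4 * a * c := by
    rintro ⟨g, hg⟩
    have := totalDegree_le_one_of_flat_points hij hik hjk hf hqf A hA hAf (fun l hl => by
      obtain ⟨T, hT, hT'⟩ := two l hl
      refine ⟨T, by omega, fun x hx => ⟨(hT' x hx).1, fun hq => ?_⟩⟩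
      obtain ⟨-, hxf, w, w', h1, h2, h3⟩ := hT' x hx
      have hev := congrArg (MvPolynomial.eval x) hg
      rw [map_mul, mem_zeroSet.1 hxf, zero_mul] at hev
      exact quadratic_eq_zero_of_disc (forms_eq_zero_of_line hij hik hjk hq h1).1
        (forms_eq_zero_of_line hij hik hjk hq h2).1 (h3 hq) (by simpa using hev))
      ((Nat.mul_le_mul_left _ (by omega)).trans_lt hc)
    omega
  have hABC : ¬ (f ∣ a ∧ f ∣ b ∧ f ∣ c) := fun h =>
    hdisc (dvd_sub (h.2.1.trans (dvd_pow_self _ two_ne_zero)) (h.2.2.mul_left _))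
  obtain ⟨E, α, β, hE, hfE, ⟨g0, h0⟩, ⟨g1, h1⟩, ⟨g2, h2⟩, ⟨g3, h3⟩⟩ :=
    exists_cramer hABC hmin.1 hmin.2.1 hmin.2.2.1 hmin.2.2.2
  have hEd : E.totalDegree ≤ 3 * e := by
    rcases hE with h | h | h <;> rw [h]
    exacts [had, hbd, hcd]
  refine ⟨E * E * q * (b ^ 2 - MvPolynomial.C 4 * a * c), ?_, hij, hik, hjk, hf, ?_, ?_, ?_, ?_⟩
  · have h1 : (E * E * q).totalDegree ≤ 3 * e + 3 * e + e :=
      totalDegree_mul_le_of (totalDegree_mul_le_of hEd hEd) hqd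
    have h2 : (b ^ 2 - MvPolynomial.C 4 * a * c).totalDegree ≤ 6 * e := by
      refine (MvPolynomial.totalDegree_sub _ _).trans (max_le ?_ ?_)
      · exact (MvPolynomial.totalDegree_pow _ _).trans (by omega)
      · exact (totalDegree_mul_le_of (totalDegree_mul_le_of
          (m := 0) (by simp) had) hcd).trans (by omega)
    exact (totalDegree_mul_le_of h1 h2).trans (by omega)
  · intro h
    rcases hf.prime.dvd_or_dvd h with h | h
    · rcases hf.prime.dvd_or_dvd h with h | h
      · rcases hf.prime.dvd_or_dvd h with h | h <;> exact hfE h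
      · exact hqf h
    · exact hdisc h
  · intro x hx hq0
    apply hx
    rw [map_mul, map_mul, hq0]
    ring
  · intro x hx h0
    apply hx
    rw [map_mul]
    simp only [map_sub, map_mul, map_pow, MvPolynomial.eval_C]
    rw [h0, mul_zero]
  · intro x hxf hx u v huv
    simp only [map_mul, ne_eq, mul_eq_zero, not_or] at hx
    refine exists_line_of_quadForm_eq_zero hij hik hjk (Δ := E * E)
      (α := α * MvPolynomial.C u + β * MvPolynomial.C v)
      (β := MvPolynomial.C (u ^ 3) * g0 + MvPolynomial.C (u ^ 2 * v) * g1 +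
        MvPolynomial.C (u * v ^ 2) * g2 + MvPolynomial.C (v ^ 3) * g3) ?_ hxf hx.1.2
      (by rw [map_mul]; exact mul_ne_zero hx.1.1.1 hx.1.1.1) huv
    rw [flowDer_quadForm, quadForm, ← ha, ← hb, ← hcc, ← ht]
    simp only [map_mul, map_pow]
    linear_combination MvPolynomial.C u ^ 3 * h0 + MvPolynomial.C u ^ 2 * MvPolynomial.C v * h1 +
      MvPolynomial.C u * MvPolynomial.C v ^ 2 * h2 + MvPolynomial.C v ^ 3 * h3

def cross3 (a b : Pt) : Pt := ![a 1 * b 2 - a 2 * b 1, a 2 * b 0 - a 0 * b 2, a 0 * b 1 - a 1 * b 0]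

theorem cross3_zero (a b : Pt) : cross3 a b 0 = a 1 * b 2 - a 2 * b 1 := rfl

theorem cross3_one (a b : Pt) : cross3 a b 1 = a 2 * b 0 - a 0 * b 2 := rfl

theorem cross3_two (a b : Pt) : cross3 a b 2 = a 0 * b 1 - a 1 * b 0 := rfl

def det3 (a b c : Pt) : ℝ := cross3 a b ⬝ᵥ c

theorem det3_eq (a b c : Pt) : det3 a b c = (a 1 * b 2 - a 2 * b 1) * c 0 +
    (a 2 * b 0 - a 0 * b 2) * c 1 + (a 0 * b 1 - a 1 * b 0) * c 2 := by
  simp [det3, cross3, dotProduct, Fin.sum_univ_three]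

theorem det3_add_smul_left (a b c : Pt) (t : ℝ) : det3 (a + t • b) b c = det3 a b c := by
  simp only [det3_eq, Pi.add_apply, Pi.smul_apply, smul_eq_mul]
  ring

theorem det3_add_smul_right (a b c : Pt) (t : ℝ) : det3 (a + t • c) b c = det3 a b c := by
  simp only [det3_eq, Pi.add_apply, Pi.smul_apply, smul_eq_mul]
  ring

/-- Three normals orthogonal to a common nonzero vector are linearly dependent. -/
theorem det3_eq_zero_of_orthogonal {a b c m : Pt} (hm : m ≠ 0) (ha : a ⬝ᵥ m = 0) (hb : b ⬝ᵥ m = 0)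
    (hc : c ⬝ᵥ m = 0) : det3 a b c = 0 := by
  by_contra h
  apply hm
  simp only [dotProduct, Fin.sum_univ_three] at ha hb hc
  rw [det3_eq] at h
  funext i
  apply mul_left_cancel₀ h
  fin_cases i <;> simp only [Fin.mk_one, Fin.zero_eta, Fin.reduceFinMk, Pi.zero_apply]
  · linear_combination (b 1 * c 2 - b 2 * c 1) * ha + (c 1 * a 2 - c 2 * a 1) * hb +
      (a 1 * b 2 - a 2 * b 1) * hc
  · linear_combination (b 2 * c 0 - b 0 * c 2) * ha + (c 2 * a 0 - c 0 * a 2) * hb +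
      (a 2 * b 0 - a 0 * b 2) * hc
  · linear_combination (b 0 * c 1 - b 1 * c 0) * ha + (c 0 * a 1 - c 1 * a 0) * hb +
      (a 0 * b 1 - a 1 * b 0) * hc

/-- The locus of points from which three given lines are seen to have a common transversal is a
quadric. -/
theorem exists_transversal_quadric (a₁ w₁ a₂ w₂ a₃ w₃ : Pt) :
    ∃ g : Poly3, g.totalDegree ≤ 2 ∧ ∀ z, MvPolynomial.eval z g =
      det3 (cross3 (z - a₁) w₁) (cross3 (z - a₂) w₂) (cross3 (z - a₃) w₃) := by
  set c₁ := cross3 w₁ a₁ with h₁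
  set c₂ := cross3 w₂ a₂ with h₂
  set c₃ := cross3 w₃ a₃ with h₃
  refine ⟨affinePoly 0 c₁ * affinePoly 0 (cross3 w₂ w₃) +
    affinePoly 0 c₂ * affinePoly 0 (cross3 w₃ w₁) + affinePoly 0 c₃ * affinePoly 0 (cross3 w₁ w₂) +
    affinePoly 0 (cross3 w₃ (cross3 c₁ c₂) + cross3 w₁ (cross3 c₂ c₃) +
      cross3 w₂ (cross3 c₃ c₁)) + MvPolynomial.C (det3 c₁ c₂ c₃), ?_, fun z => ?_⟩
  · have h := fun n : Pt => totalDegree_affinePoly_le 0 n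
    have h' := fun n m : Pt => totalDegree_mul_le_of (h n) (h m)
    refine totalDegree_add_le_of (totalDegree_add_le_of (totalDegree_add_le_of
      (totalDegree_add_le_of (h' _ _) (h' _ _)) (h' _ _)) ((h _).trans one_le_two)) (by simp)
  · simp only [map_add, map_mul, eval_affinePoly, MvPolynomial.eval_C, sub_zero, det3_eq, h₁,
      h₂, h₃,
      cross3_zero, cross3_one, cross3_two, dotProduct, Fin.sum_univ_three, Pi.add_apply,
      Pi.sub_apply, Pi.zero_apply]
    ring

theorem exists_coplanar_poly (a w : Pt) (d : Fin 3 → Poly3) :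
    ∃ P : Poly3, ∀ z,
      MvPolynomial.eval z P = det3 (z - a) w fun m => MvPolynomial.eval z (d m) := by
  refine ⟨(affinePoly a ![0, w 2, -w 1]) * d 0 + affinePoly a ![-w 2, 0, w 0] * d 1 +
    affinePoly a ![w 1, -w 0, 0] * d 2, fun z => ?_⟩
  simp only [map_add, map_mul, eval_affinePoly, det3_eq, dotProduct, Fin.sum_univ_three,
    Matrix.cons_val, Pi.sub_apply]
  ring

theorem exists_smul_of_lineThrough_eq {x w w' : Pt} (h : lineThrough x w = lineThrough x w') :
    ∃ c : ℝ, w' = c • w := by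
  have : x + (1 : ℝ) • w' ∈ lineThrough x w := h ▸ ⟨1, rfl⟩
  obtain ⟨t, ht⟩ := this
  exact ⟨t, by simpa using (add_left_cancel ht).symm⟩

theorem IsLine.infinite_diff_zeroSet {θ : Poly3} {l : Set Pt} (hl : IsLine l) {x : Pt} (hx : x ∈ l)
    (hθ : x ∉ zeroSet θ) : (l \ zeroSet θ).Infinite := by
  rw [← Set.sdiff_self_inter]
  exact hl.infinite.sdiff (hl.finite_inter_of_not_subset fun hs => hθ (hs hx))

theorem dvd_of_transversal_lines {f g : Poly3} (hf : Irreducible f) {l : Set Pt} (hl : IsLine l)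
    {S : Set Pt} (hS : S.Infinite) (hSl : S ⊆ l) (m : Pt → Set Pt)
    (hm : ∀ x ∈ S, IsLine (m x) ∧ x ∈ m x ∧ m x ⊆ zeroSet f ∧ m x ≠ l)
    (hg : ∀ x ∈ S, m x ⊆ zeroSet g) : f ∣ g := by
  refine dvd_of_infinite_lines hf (B := m '' S) (hS.image ?_) ?_
  · intro x hx y hy hxy
    exact (hm x hx).1.inter_subsingleton hl (hm x hx).2.2.2 ⟨(hm x hx).2.1, hSl hx⟩
      ⟨by rw [hxy]; exact (hm y hy).2.1, hSl hy⟩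
  · rintro _ ⟨x, hx, rfl⟩
    exact ⟨(hm x hx).1, (hm x hx).2.2.1, hg x hx⟩

namespace IsRuledOff

variable {f θ : Poly3} {k i j : Fin 3}

theorem exists_second_line (h : IsRuledOff f k i j θ) {l : Set Pt} (hl : IsLine l) (hlf : l ⊆
    zeroSet f) {x : Pt} (hx : x ∈ l)
    (hθ : x ∉ zeroSet θ) : ∃ m, IsLine m ∧ x ∈ m ∧ m ⊆ zeroSet f ∧ m ≠ l := by
  obtain ⟨w, hw, rfl⟩ := hl.exists_dir hx
  have hq := h.eval_pderiv_ne x hθ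
  have hquad := (forms_eq_zero_of_line h.hij h.hik h.hjk hq hlf).1
  have hw' : w i ≠ 0 ∨ w j ≠ 0 := by
    by_contra! h0
    have h1 := sum_mul_pderiv_eq_zero hlf
    rw [Fin.sum_three_distinct h.hij h.hik h.hjk, h0.1, h0.2] at h1
    apply hw
    funext m
    rcases Fin.eq_or_eq_or_eq_of_distinct h.hij h.hik h.hjk m with rfl | rfl | rfl
    · exact h0.1
    · exact h0.2
    · simpa [hq] using h1
  obtain ⟨u, v, huv, hne⟩ := exists_second_root hquad hw' (h.disc_ne x hθ)
  have hsub := h.line_subset x (hlf hx) hθ u v (by rw [eval_quadForm]; exact huv)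
  have hi := congrArg (MvPolynomial.eval x) (flowField_fst (f := f) u v h.hij h.hik)
  have hj := congrArg (MvPolynomial.eval x) (flowField_snd (f := f) u v h.hij h.hjk)
  rw [map_mul, MvPolynomial.eval_C] at hi hj
  set d : Pt := fun m => MvPolynomial.eval x (flowField f k i j u v m) with hd
  have hdi : d i = _ := hi
  have hdj : d j = _ := hj
  have hind : w i * d j - w j * d i ≠ 0 := by
    rw [hdi, hdj]
    intro h0
    exact mul_ne_zero hq hne (by linear_combination h0)
  refine ⟨lineThrough x d, ⟨x, d, ?_, rfl⟩, base_mem_lineThrough _ _, hsub, ?_⟩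
  · intro h0
    simp [h0] at hind
  · intro heq
    obtain ⟨c, hc⟩ := exists_smul_of_lineThrough_eq heq.symm
    rw [hc] at hind
    apply hind
    simp only [Pi.smul_apply, smul_eq_mul]
    ring

/-- Of two lines of a ruled surface through a generic point, one is coplanar with any given
generic line of the surface. -/
theorem coplanar_or (h : IsRuledOff f k i j θ) {a w : Pt} (hw : w ≠ 0) (hl : lineThrough a w ⊆
    zeroSet f) {x₀ : Pt}
    (hx₀ : x₀ ∈ lineThrough a w) (hx₀θ : x₀ ∉ zeroSet θ) {z n₁ n₂ : Pt} (hz : z ∉ zeroSet θ)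
    (hn₁ : n₁ ≠ 0) (hn₂ : n₂ ≠ 0) (h₁ : lineThrough z n₁ ⊆ zeroSet f)
    (h₂ : lineThrough z n₂ ⊆ zeroSet f) (hne : lineThrough z n₁ ≠ lineThrough z n₂) :
    det3 (z - a) w n₁ = 0 ∨ det3 (z - a) w n₂ = 0 := by
  obtain ⟨P, hP⟩ := exists_coplanar_poly a w (flowField f k i j 1 0)
  obtain ⟨Q, hQ⟩ := exists_coplanar_poly a w (flowField f k i j 0 1)
  set q := MvPolynomial.pderiv k f with hq
  set A := secondForm f k i i
  set B := secondFormMixed f k i j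
  set C := secondForm f k j j
  have hdet : ∀ y n : Pt, lineThrough y n ⊆ zeroSet f → MvPolynomial.eval y q *
      det3 (y - a) w n = n i * MvPolynomial.eval y P + n j * MvPolynomial.eval y Q := by
    intro y n hn
    have hgrad := sum_mul_pderiv_eq_zero hn
    rw [Fin.sum_three_distinct h.hij h.hik h.hjk] at hgrad
    have hv : ∀ m, MvPolynomial.eval y q * n m =
        n i * MvPolynomial.eval y (flowField f k i j 1 0 m) +
        n j * MvPolynomial.eval y (flowField f k i j 0 1 m) := by
      intro m
      rcases Fin.eq_or_eq_or_eq_of_distinct h.hij h.hik h.hjk m with rfl | rfl | rfl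
      · rw [flowField_fst _ _ h.hij h.hik, flowField_fst _ _ h.hij h.hik]
        simp [hq, mul_comm]
      · rw [flowField_snd _ _ h.hij h.hjk, flowField_snd _ _ h.hij h.hjk]
        simp [hq, mul_comm]
      · rw [flowField_thd _ _ h.hik h.hjk, flowField_thd _ _ h.hik h.hjk]
        simp only [map_neg, map_add, map_mul, MvPolynomial.eval_C]
        linear_combination hgrad
    rw [hP, hQ, det3_eq, det3_eq, det3_eq]
    linear_combination ((y - a) 1 * w 2 - (y - a) 2 * w 1) * hv 0 +
      ((y - a) 2 * w 0 - (y - a) 0 * w 2) * hv 1 + ((y - a) 0 * w 1 - (y - a) 1 * w 0) * hv 2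
  have hΘ : f ∣ A * Q ^ 2 - B * (P * Q) + C * P ^ 2 := by
    have hL : IsLine (lineThrough a w) := ⟨a, w, hw, rfl⟩
    have hex : ∀ x, ∃ m, x ∈ lineThrough a w \ zeroSet θ →
        IsLine m ∧ x ∈ m ∧ m ⊆ zeroSet f ∧ m ≠ lineThrough a w := by
      intro x
      by_cases hx : x ∈ lineThrough a w \ zeroSet θ
      · obtain ⟨m, hm⟩ := h.exists_second_line hL hl hx.1 hx.2
        exact ⟨m, fun _ => hm⟩
      · exact ⟨∅, fun hx' => absurd hx' hx⟩
    choose m hm using hex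
    have hfq : ¬ f ∣ q := by
      intro hfq
      obtain ⟨g, hg⟩ := hfq
      have := h.eval_pderiv_ne x₀ hx₀θ
      rw [← hq, hg, map_mul, mem_zeroSet.1 (hl hx₀), zero_mul] at this
      exact this rfl
    refine (h.irreducible.prime.dvd_or_dvd (a := q) ?_).resolve_left hfq
    refine dvd_of_transversal_lines h.irreducible hL (hL.infinite_diff_zeroSet hx₀ hx₀θ)
      Set.sdiff_subset m hm ?_
    intro x hx y hy
    obtain ⟨hml, hxm, hmf, hmne⟩ := hm x hx
    obtain ⟨n, hn, hmn⟩ := hml.exists_dir hxm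
    have hyn : lineThrough y n ⊆ zeroSet f := by
      rw [← lineThrough_eq_of_mem (hmn ▸ hy), ← hmn]
      exact hmf
    have hcop : det3 (y - a) w n = 0 := by
      rw [hmn] at hy
      obtain ⟨t, rfl⟩ := hy
      obtain ⟨s, rfl⟩ := hx.1
      have : a + s • w + t • n - a = (0 + s • w) + t • n := by
        funext m
        simp only [Pi.add_apply, Pi.sub_apply, Pi.smul_apply, smul_eq_mul, Pi.zero_apply]
        ring
      simp only
      rw [this, det3_add_smul_right, det3_add_smul_left, det3_eq]
      simp
    rw [mem_zeroSet, map_mul]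
    by_cases hqy : MvPolynomial.eval y q = 0
    · rw [hqy, zero_mul]
    · have h1 := hdet y n hyn
      rw [hcop, mul_zero] at h1
      have h2 := (forms_eq_zero_of_line h.hij h.hik h.hjk hqy hyn).1
      simp only [map_add, map_sub, map_mul, map_pow]
      by_cases hni : n i = 0
      · have hnj : n j ≠ 0 := by
          intro hnj
          have h3 := sum_mul_pderiv_eq_zero hyn
          rw [Fin.sum_three_distinct h.hij h.hik h.hjk, hni, hnj] at h3
          apply hn
          funext m
          rcases Fin.eq_or_eq_or_eq_of_distinct h.hij h.hik h.hjk m with rfl | rfl | rfl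
          · exact hni
          · exact hnj
          · simpa [← hq, hqy] using h3
        rw [hni] at h1 h2
        have hQ0 : MvPolynomial.eval y Q = 0 := by simpa [hnj] using h1
        have hC0 : MvPolynomial.eval y C = 0 := by simpa [hnj] using h2
        rw [hQ0, hC0]
        ring
      · apply mul_left_cancel₀ (pow_ne_zero 2 hni)
        linear_combination MvPolynomial.eval y q * MvPolynomial.eval y Q ^ 2 * h2 +
          MvPolynomial.eval y q * (-(MvPolynomial.eval y C) * (n i * MvPolynomial.eval y P -
            n j * MvPolynomial.eval y Q) + MvPolynomial.eval y B * n i * MvPolynomial.eval y Q) * h1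
  have hqz := h.eval_pderiv_ne z hz
  have hind := dir_independent h.hij h.hik h.hjk hqz hn₁ hn₂ h₁ h₂ hne
  have hf₁ := (forms_eq_zero_of_line h.hij h.hik h.hjk hqz h₁).1
  have hf₂ := (forms_eq_zero_of_line h.hij h.hik h.hjk hqz h₂).1
  obtain ⟨g, hg⟩ := hΘ
  have hev := congrArg (MvPolynomial.eval z) hg
  rw [map_mul, mem_zeroSet.1 (h₁ (base_mem_lineThrough _ _)), zero_mul] at hev
  simp only [map_add, map_sub, map_mul, map_pow] at hev
  have hroot := quadratic_root_cases hf₁ hf₂ hind (u := MvPolynomial.eval z Q)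
    (v := -MvPolynomial.eval z P) (by linear_combination hev)
  rcases hroot with h0 | h0 | h0
  · exfalso
    apply h.disc_ne z hz
    rw [h0.1, h0.2.1]
    ring
  · left
    apply mul_left_cancel₀ hqz
    rw [hdet z n₁ h₁]
    linear_combination -h0
  · right
    apply mul_left_cancel₀ hqz
    rw [hdet z n₂ h₂]
    linear_combination -h0

/-- A ruled surface with a generic line is a plane or a quadric. -/
theorem totalDegree_le_two (h : IsRuledOff f k i j θ) {l : Set Pt} (hl : IsLine l) (hlf : l ⊆
    zeroSet f) {x₀ : Pt}
    (hx₀ : x₀ ∈ l) (hx₀θ : x₀ ∉ zeroSet θ) : f.totalDegree ≤ 2 := by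
  by_contra! hdeg
  obtain ⟨μ, hμ, hlμ⟩ := hl.exists_dir hx₀
  obtain ⟨l₁, hl₁, hxl₁, hl₁f, hl₁ne⟩ := h.exists_second_line hl hlf hx₀ hx₀θ
  obtain ⟨w₁, hw₁, hlw₁⟩ := hl₁.exists_dir hxl₁
  have hsec : ∀ {l : Set Pt}, IsLine l → l ⊆ zeroSet f → ∀ x, ∃ w, x ∈ l \ zeroSet θ →
      w ≠ 0 ∧ lineThrough x w ⊆ zeroSet f ∧ lineThrough x w ≠ l := by
    intro l hl hlf x
    by_cases hx : x ∈ l \ zeroSet θ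
    · obtain ⟨m, hm, hxm, hmf, hml⟩ := h.exists_second_line hl hlf hx.1 hx.2
      obtain ⟨w, hw, rfl⟩ := hm.exists_dir hxm
      exact ⟨w, fun _ => ⟨hw, hmf, hml⟩⟩
    · exact ⟨0, fun hx' => absurd hx' hx⟩
  choose w hw using hsec hl hlf
  have hcross : ∃ c, cross3 μ w₁ c ≠ 0 := by
    by_contra! h0
    have e0 := h0 0
    have e1 := h0 1
    have e2 := h0 2
    simp only [cross3, Matrix.cons_val] at e0 e1 e2
    obtain ⟨c, hc⟩ := Function.ne_iff.1 hμ
    have hprop : w₁ = (w₁ c / μ c) • μ := by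
      funext m
      simp only [Pi.smul_apply, smul_eq_mul]
      have : μ c ≠ 0 := hc
      field_simp
      fin_cases c <;> fin_cases m <;>
        simp only [Fin.mk_one, Fin.zero_eta, Fin.reduceFinMk] <;>
        first | ring1 | linear_combination e0 | linear_combination e1 | linear_combination e2 |
          linear_combination -e0 | linear_combination -e1 | linear_combination -e2
    apply hl₁ne
    rw [hlw₁, hlμ, hprop, lineThrough_smul]
    intro h0
    rw [h0, zero_smul] at hprop
    exact hw₁ hprop
  have hbad : ({x ∈ l \ zeroSet θ | det3 μ w₁ (w x) = 0}).Finite := by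
    by_contra hinf
    have hdvd : f ∣ affinePoly x₀ (cross3 μ w₁) := by
      refine dvd_of_transversal_lines h.irreducible hl hinf
        (fun x hx => hx.1.1) (fun x => lineThrough x (w x)) ?_ ?_
      · intro x hx
        obtain ⟨h1, h2, h3⟩ := hw x hx.1
        exact ⟨⟨x, w x, h1, rfl⟩, base_mem_lineThrough _ _, h2, h3⟩
      · rintro x ⟨hx, hx0⟩ _ ⟨t, rfl⟩
        obtain ⟨s, hs⟩ := hlμ ▸ hx.1
        rw [mem_zeroSet, eval_affinePoly]
        change det3 _ _ _ = 0
        simp only at hs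
        rw [← hs]
        rw [det3_eq] at hx0 ⊢
        simp only [Pi.add_apply, Pi.sub_apply, Pi.smul_apply, smul_eq_mul]
        rw [hs]
        linear_combination t * hx0
    have hne : affinePoly x₀ (cross3 μ w₁) ≠ 0 := by
      intro h0
      obtain ⟨c, hc⟩ := hcross
      have h1 := eval_affinePoly x₀ (cross3 μ w₁) (x₀ + Pi.single c 1)
      rw [h0] at h1
      simp only [map_zero, add_sub_cancel_left, dotProduct_single, mul_one] at h1
      exact hc h1.symm
    have := (totalDegree_le_of_dvd hdvd hne).trans (totalDegree_affinePoly_le _ _)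
    omega
  have hinf := ((hl.infinite_diff_zeroSet hx₀ hx₀θ).sdiff hbad).sdiff (Set.finite_singleton x₀)
  obtain ⟨z₂, ⟨⟨hz₂, hz₂b⟩, hz₂x⟩⟩ := hinf.nonempty
  obtain ⟨z₃, ⟨⟨⟨hz₃, hz₃b⟩, hz₃x⟩, hz₃ne⟩⟩ := (hinf.sdiff (Set.finite_singleton z₂)).nonempty
  have hd₂ : det3 μ w₁ (w z₂) ≠ 0 := fun h0 => hz₂b ⟨hz₂, h0⟩
  have hd₃ : det3 μ w₁ (w z₃) ≠ 0 := fun h0 => hz₃b ⟨hz₃, h0⟩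
  have hparam : ∀ z ∈ l, ∃ s : ℝ, z = x₀ + s • μ := by
    intro z hz
    rw [hlμ] at hz
    obtain ⟨s, hs⟩ := hz
    exact ⟨s, hs.symm⟩
  choose v hv using hsec hl₁ hl₁f
  have hcop : ∀ z ∈ l \ zeroSet θ, z ≠ x₀ → det3 μ w₁ (w z) ≠ 0 → ∀ x ∈ l₁ \ zeroSet θ,
      det3 (x - z) (w z) (v x) = 0 := by
    intro z hz hzx hdz x hx
    obtain ⟨hw0, hwf, -⟩ := hw z hz
    obtain ⟨hv0, hvf, hvl⟩ := hv x hx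
    have hl₁x : l₁ = lineThrough x w₁ := by
      rw [hlw₁]
      exact lineThrough_eq_of_mem (hlw₁ ▸ hx.1)
    refine (h.coplanar_or hw0 hwf (base_mem_lineThrough _ _) hz.2 hx.2 hw₁ hv0 (hl₁x ▸ hl₁f) hvf
      (hl₁x ▸ hvl.symm)).resolve_left fun h0 => ?_
    obtain ⟨s, rfl⟩ := hparam z hz.1
    obtain ⟨t, rfl⟩ := hlw₁ ▸ hx.1
    have hs : s ≠ 0 := by
      rintro rfl
      simp at hzx
    apply mul_ne_zero hs hdz
    rw [det3_eq] at h0 ⊢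
    simp only [Pi.add_apply, Pi.sub_apply, Pi.smul_apply, smul_eq_mul] at h0 ⊢
    linear_combination h0
  obtain ⟨g, hgd, hg⟩ := exists_transversal_quadric x₀ w₁ z₂ (w z₂) z₃ (w z₃)
  have hdvd : f ∣ g := by
    refine dvd_of_transversal_lines h.irreducible hl₁ (hl₁.infinite_diff_zeroSet hxl₁ hx₀θ)
      Set.sdiff_subset (fun x => lineThrough x (v x)) ?_ ?_
    · intro x hx
      obtain ⟨h1, h2, h3⟩ := hv x hx
      exact ⟨⟨x, v x, h1, rfl⟩, base_mem_lineThrough _ _, h2, h3⟩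
    · rintro x hx _ ⟨t, rfl⟩
      have hmove : ∀ z, x + t • v x - z = x - z + t • v x := fun z => by
        rw [add_sub_right_comm]
      rw [mem_zeroSet, hg]
      refine det3_eq_zero_of_orthogonal (hv x hx).1 ?_ ?_ ?_ <;> change det3 _ _ _ = 0 <;>
        simp only [hmove] <;> rw [det3_add_smul_right]
      · obtain ⟨r, rfl⟩ := hlw₁ ▸ hx.1
        simp only [det3_eq, Pi.add_apply, Pi.sub_apply, Pi.smul_apply, smul_eq_mul]
        ring
      · exact hcop z₂ hz₂ hz₂x hd₂ x hx
      · exact hcop z₃ hz₃ hz₃x hd₃ x hx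
  have hg0 : g ≠ 0 := by
    rintro rfl
    have h1 := hg (x₀ + w₁ + μ)
    obtain ⟨s₂, hs₂⟩ := hparam z₂ hz₂.1
    obtain ⟨s₃, hs₃⟩ := hparam z₃ hz₃.1
    have hs : s₃ - s₂ ≠ 0 := by
      intro h0
      apply hz₃ne
      rw [Set.mem_singleton_iff, hs₃, hs₂, sub_eq_zero.1 h0]
    apply mul_ne_zero hs (mul_ne_zero hd₂ hd₃)
    rw [map_zero] at h1
    generalize w z₂ = w₂ at *
    generalize w z₃ = w₃ at *
    subst hs₂ hs₃
    simp only [det3_eq, cross3_zero, cross3_one, cross3_two, Pi.add_apply, Pi.sub_apply,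
      Pi.smul_apply, smul_eq_mul] at h1 ⊢
    linear_combination -h1
  exact absurd ((totalDegree_le_of_dvd hdvd hg0).trans hgd) (by omega)

end IsRuledOff

/-- **Crossing lines.** A surface that is neither a plane nor a quadric contains few lines with
many points at which another line of the surface passes. -/
theorem card_crossing_lines_le {f : Poly3} (hf : Irreducible f) (hdeg : 3 ≤ f.totalDegree)
    (A : Finset (Set Pt)) (hA : ∀ l ∈ A, IsLine l) (hAf : ∀ l ∈ A, l ⊆ zeroSet f)
    (hr : ∀ l ∈ A, ∃ T : Finset Pt, 11 * f.totalDegree < T.card ∧ ∀ x ∈ T, x ∈ l ∧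
      ∃ l', IsLine l' ∧ x ∈ l' ∧ l' ⊆ zeroSet f ∧ l ≠ l') :
    A.card ≤ f.totalDegree * (13 * f.totalDegree) := by
  by_contra! hc
  obtain ⟨k, hqf⟩ := exists_not_dvd_pderiv hf
  obtain ⟨i, j, hij, hik, hjk⟩ := exists_fin3_distinct k
  obtain ⟨θ, hθ, h⟩ := exists_isRuledOff hij hik hjk hf hqf (by omega) A hA hAf hr
    ((Nat.mul_le_mul_left _ (by omega)).trans_lt hc)
  obtain ⟨l, hl, x, hx, hxθ⟩ := exists_line_not_subset hf h.not_dvd A hA hAf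
    ((Nat.mul_le_mul_left _ hθ).trans_lt hc)
  have := h.totalDegree_le_two (hA l hl) (hAf l hl) hx hxθ
  omega

/-- The lines of `𝓐` passing through `x`. -/
def linesAt (𝓐 : Finset (Set Pt)) (x : Pt) : Finset (Set Pt) := 𝓐.filter fun l => x ∈ l

theorem mem_linesAt {𝓐 : Finset (Set Pt)} {x : Pt} {l : Set Pt} :
    l ∈ linesAt 𝓐 x ↔ l ∈ 𝓐 ∧ x ∈ l := Finset.mem_filter

theorem linesAt_mono {𝓐 𝓑 : Finset (Set Pt)} (h : 𝓐 ⊆ 𝓑) (x : Pt) : linesAt 𝓐 x ⊆ linesAt 𝓑 x :=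
  Finset.filter_subset_filter _ h

/-- A set of at most `n ^ 2` lines, at most `n` of them concurrent and at most `7 * n` of them on
a common plane or quadric. -/
structure WellSpread (n : ℕ) (𝓑 : Finset (Set Pt)) : Prop where
  isLine : ∀ l ∈ 𝓑, IsLine l
  card_le : 𝓑.card ≤ n ^ 2
  card_linesAt_le : ∀ x, (linesAt 𝓑 x).card ≤ n
  card_quadric_le : ∀ f : Poly3, Irreducible f → f.totalDegree ≤ 2 →
    (𝓑.filter fun l => l ⊆ zeroSet f).card ≤ 7 * n

theorem WellSpread.mono {n : ℕ} {𝓐 𝓑 : Finset (Set Pt)} (h : WellSpread n 𝓑) (hAB : 𝓐 ⊆ 𝓑) :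
    WellSpread n 𝓐 where
  isLine l hl := h.isLine l (hAB hl)
  card_le := (Finset.card_le_card hAB).trans h.card_le
  card_linesAt_le x := (Finset.card_le_card (linesAt_mono hAB x)).trans (h.card_linesAt_le x)
  card_quadric_le f hf hd :=
    (Finset.card_le_card (Finset.filter_subset_filter _ hAB)).trans (h.card_quadric_le f hf hd)

/-- Pairs of distinct lines of a family `Q` of pairs determine their intersection point. -/
theorem sum_card_pairs_le {𝓐 : Finset (Set Pt)} (hA : ∀ l ∈ 𝓐, IsLine l) (S : Finset Pt)
    (G : Pt → Finset (Set Pt)) (hG : ∀ x ∈ S, ∀ l ∈ G x, l ∈ 𝓐 ∧ x ∈ l)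
    (Q : Finset (Set Pt × Set Pt))
    (hQ : ∀ x ∈ S, ∀ l ∈ G x, ∀ l' ∈ G x, (l, l') ∈ Q) :
    ∑ x ∈ S, (G x).card * ((G x).card - 1) ≤ Q.card := by
  have h1 : ∀ x, (G x).card * ((G x).card - 1) = (G x).offDiag.card := by
    intro x
    rw [Finset.offDiag_card, Nat.mul_sub, mul_one]
  simp only [h1]
  rw [← Finset.card_sigma]
  refine Finset.card_le_card_of_injOn (fun y => y.2) ?_ ?_
  · rintro ⟨x, l, l'⟩ hy
    simp only [Finset.coe_sigma, Set.mem_sigma_iff, Finset.mem_coe, Finset.mem_offDiag] at hy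
    exact hQ x hy.1 l hy.2.1 l' hy.2.2.1
  · rintro ⟨x, l, l'⟩ hy ⟨x', m, m'⟩ hy' heq
    simp only [Prod.mk.injEq] at heq
    obtain ⟨rfl, rfl⟩ := heq
    simp only [Finset.coe_sigma, Set.mem_sigma_iff, Finset.mem_coe, Finset.mem_offDiag] at hy hy'
    obtain ⟨hl, hxl⟩ := hG x hy.1 l hy.2.1
    obtain ⟨hl', hxl'⟩ := hG x hy.1 l' hy.2.2.1
    have : x = x' := (hA l hl).inter_subsingleton (hA l' hl') hy.2.2.2 ⟨hxl, hxl'⟩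
      ⟨(hG x' hy'.1 l hy'.2.1).2, (hG x' hy'.1 l' hy'.2.2.1).2⟩
    rw [this]

theorem card_mul_sq_le_of_pairs {𝓐 : Finset (Set Pt)} (hA : ∀ l ∈ 𝓐, IsLine l) (S : Finset Pt)
    (G : Pt → Finset (Set Pt)) (hG : ∀ x ∈ S, ∀ l ∈ G x, l ∈ 𝓐 ∧ x ∈ l)
    (Q : Finset (Set Pt × Set Pt))
    (hQ : ∀ x ∈ S, ∀ l ∈ G x, ∀ l' ∈ G x, (l, l') ∈ Q) {k : ℕ} (hk : 2 ≤ k)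
    (hGk : ∀ x ∈ S, k ≤ (G x).card) : S.card * k ^ 2 ≤ 2 * Q.card := by
  have h1 := sum_card_pairs_le hA S G hG Q hQ
  have h2 : ∑ x ∈ S, k ^ 2 ≤ ∑ x ∈ S, 2 * ((G x).card * ((G x).card - 1)) := by
    refine Finset.sum_le_sum fun x hx => ?_
    obtain ⟨m, hm⟩ : ∃ m, (G x).card = m + 2 := ⟨_, (Nat.sub_add_cancel (hk.trans (hGk x hx))).symm⟩
    have := hGk x hx
    rw [hm] at this ⊢
    have h3 := Nat.pow_le_pow_left this 2
    have : m + 2 - 1 = m + 1 := by omega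
    rw [this]
    nlinarith
  rw [← Finset.mul_sum, Finset.sum_const, smul_eq_mul] at h2
  omega

theorem card_mul_sq_le_two_mul_sq {𝓐 : Finset (Set Pt)} (hA : ∀ l ∈ 𝓐, IsLine l) (S : Finset Pt)
    {k : ℕ} (hk : 2 ≤ k) (hS : ∀ x ∈ S, k ≤ (linesAt 𝓐 x).card) :
    S.card * k ^ 2 ≤ 2 * 𝓐.card ^ 2 := by
  have := card_mul_sq_le_of_pairs hA S (linesAt 𝓐) (fun x _ l hl => mem_linesAt.1 hl) (𝓐 ×ˢ 𝓐)
    (fun x _ l hl l' hl' => Finset.mem_product.2 ⟨(mem_linesAt.1 hl).1, (mem_linesAt.1 hl').1⟩)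
      hk hS
  rwa [Finset.card_product, ← sq] at this

theorem sum_card_linesAt (𝓐 : Finset (Set Pt)) (S : Finset Pt) :
    ∑ x ∈ S, (linesAt 𝓐 x).card = ∑ l ∈ 𝓐, (S.filter fun x => x ∈ l).card := by
  simp only [linesAt, Finset.card_filter]
  exact Finset.sum_comm

/-- Few points span few repeated incidences. -/
theorem sum_card_linesAt_le {𝓐 : Finset (Set Pt)} (hA : ∀ l ∈ 𝓐, IsLine l) (S : Finset Pt) :
    ∑ x ∈ S, (linesAt 𝓐 x).card ≤ 𝓐.card + S.card ^ 2 := by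
  rw [sum_card_linesAt]
  have h1 : ∀ l : Set Pt, (S.filter fun x => x ∈ l).card ≤
      1 + ((S.filter fun x => x ∈ l).offDiag).card := by
    intro l
    rw [Finset.offDiag_card]
    rcases Nat.eq_zero_or_pos (S.filter fun x => x ∈ l).card with h | h
    · rw [h]
      omega
    · obtain ⟨m, hm⟩ : ∃ m, (S.filter fun x => x ∈ l).card = m + 1 :=
        ⟨_, (Nat.sub_add_cancel h).symm⟩
      rw [hm]
      have : (m + 1) * (m + 1) - (m + 1) = m * m + m := by
        rw [Nat.sub_eq_iff_eq_add (by nlinarith)]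
        ring
      rw [this]
      nlinarith
  refine (Finset.sum_le_sum fun l _ => h1 l).trans ?_
  rw [Finset.sum_add_distrib, Finset.sum_const, smul_eq_mul, mul_one, ← Finset.card_sigma, sq,
    ← Finset.card_product]
  refine add_le_add le_rfl (Finset.card_le_card_of_injOn (fun y => y.2) ?_ ?_)
  · rintro ⟨l, x, y⟩ hy
    simp only [Finset.coe_sigma, Set.mem_sigma_iff, Finset.mem_coe, Finset.mem_offDiag,
      Finset.mem_filter] at hy
    simp [hy.2.1.1, hy.2.2.1.1]
  · rintro ⟨l, x, y⟩ hy ⟨l', x', y'⟩ hy' heq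
    simp only [Prod.mk.injEq] at heq
    obtain ⟨rfl, rfl⟩ := heq
    simp only [Finset.coe_sigma, Set.mem_sigma_iff, Finset.mem_coe, Finset.mem_offDiag,
      Finset.mem_filter] at hy hy'
    have : l = l' := (hA l hy.1).eq_of_mem (hA l' hy'.1) hy.2.2.2 hy.2.1.2 hy.2.2.1.2 hy'.2.1.2
      hy'.2.2.1.2
    rw [this]

theorem card_mul_le_two_mul {𝓐 : Finset (Set Pt)} (hA : ∀ l ∈ 𝓐, IsLine l) (S : Finset Pt)
    {k : ℕ} (hk : 2 * S.card ≤ k) (hS : ∀ x ∈ S, k ≤ (linesAt 𝓐 x).card) :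
    S.card * k ≤ 2 * 𝓐.card := by
  have h1 := sum_card_linesAt_le hA S
  have h2 := Finset.card_nsmul_le_sum S _ k hS
  rw [smul_eq_mul] at h2
  nlinarith

/-- Irreducible components of a surface. -/
theorem exists_components {g : Poly3} (hg : g ≠ 0) : ∃ (r : ℕ) (F : ℕ → Poly3),
    (∀ j < r, Irreducible (F j)) ∧ ∑ j ∈ Finset.range r, (F j).totalDegree ≤ g.totalDegree ∧
    ∀ x ∈ zeroSet g, ∃ j < r, x ∈ zeroSet (F j) := by
  induction g using WfDvdMonoid.induction_on_irreducible with
  | zero => exact absurd rfl hg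
  | unit u hu =>
    refine ⟨0, fun _ => 0, by simp, by simp, fun x hx => ?_⟩
    exact absurd (mem_zeroSet.1 hx) (hu.map (MvPolynomial.eval x)).ne_zero
  | mul a p ha hp ih =>
    obtain ⟨r, F, h1, h2, h3⟩ := ih ha
    refine ⟨r + 1, fun j => if j < r then F j else p, ?_, ?_, ?_⟩
    · intro j hj
      dsimp only
      split_ifs with h
      · exact h1 j h
      · exact hp
    · rw [Finset.sum_range_succ, MvPolynomial.totalDegree_mul_of_isDomain hp.ne_zero ha]
      dsimp only
      rw [if_neg (lt_irrefl _), add_comm]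
      refine add_le_add le_rfl (le_trans (le_of_eq ?_) h2)
      exact Finset.sum_congr rfl fun j hj => by rw [if_pos (Finset.mem_range.1 hj)]
    · intro x hx
      rw [mem_zeroSet, map_mul, mul_eq_zero] at hx
      rcases hx with hx | hx
      · exact ⟨r, by omega, by simpa [mem_zeroSet] using hx⟩
      · obtain ⟨j, hj, hxj⟩ := h3 x hx
        exact ⟨j, by omega, by simpa [hj] using hxj⟩

/-- The first of the components `F 0, F 1, …` containing the set `s`. -/
def compIdx (F : ℕ → Poly3) (s : Set Pt) : ℕ := sInf {j | s ⊆ zeroSet (F j)}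

/-- The incidence `x ∈ l` is transversal to one of the first `r` components. -/
def CrossesComp (r : ℕ) (F : ℕ → Poly3) (x : Pt) (l : Set Pt) : Prop :=
  ∃ j < r, x ∈ zeroSet (F j) ∧ ¬ l ⊆ zeroSet (F j)

theorem card_crossesComp_le {r : ℕ} {F : ℕ → Poly3} {l : Set Pt} (hl : IsLine l) (T : Finset Pt)
    (hT : ∀ x ∈ T, x ∈ l ∧ CrossesComp r F x l) :
    T.card ≤ ∑ j ∈ Finset.range r, (F j).totalDegree := by
  have hsub : T ⊆ (Finset.range r).biUnion fun j =>
      if l ⊆ zeroSet (F j) then ∅ else T.filter fun x => x ∈ zeroSet (F j) := by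
    intro x hx
    obtain ⟨-, j, hj, hxj, hlj⟩ := hT x hx
    simp only [Finset.mem_biUnion, Finset.mem_range]
    exact ⟨j, hj, by rw [if_neg hlj]; exact Finset.mem_filter.2 ⟨hx, hxj⟩⟩
  refine (Finset.card_le_card hsub).trans (Finset.card_biUnion_le.trans ?_)
  refine Finset.sum_le_sum fun j _ => ?_
  split_ifs with h
  · simp
  · refine hl.card_le_of_not_subset h _ fun x hx => ?_
    rw [Finset.mem_filter] at hx
    exact ⟨(hT x hx.1).1, hx.2⟩

theorem compIdx_of_not_crossesComp {r : ℕ} {F : ℕ → Poly3} {x : Pt} {l : Set Pt}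
    (hx : ∃ j < r, x ∈ zeroSet (F j)) (hxl : x ∈ l) (h : ¬ CrossesComp r F x l) :
    compIdx F {x} < r ∧ l ⊆ zeroSet (F (compIdx F {x})) ∧ compIdx F l = compIdx F {x} := by
  obtain ⟨j, hj, hxj⟩ := hx
  have hmem : ({x} : Set Pt) ⊆ zeroSet (F (compIdx F {x})) :=
    Nat.sInf_mem (s := {j | ({x} : Set Pt) ⊆ zeroSet (F j)})
      ⟨j, Set.singleton_subset_iff.2 hxj⟩
  have hlt : compIdx F {x} < r :=
    (Nat.sInf_le (s := {j | ({x} : Set Pt) ⊆ zeroSet (F j)})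
      (Set.singleton_subset_iff.2 hxj)).trans_lt hj
  have hl : l ⊆ zeroSet (F (compIdx F {x})) := by
    by_contra hl
    exact h ⟨_, hlt, Set.singleton_subset_iff.1 hmem, hl⟩
  refine ⟨hlt, hl, le_antisymm (Nat.sInf_le hl) (Nat.sInf_le ?_)⟩
  exact (Set.singleton_subset_iff.2 hxl).trans (Nat.sInf_mem (s := {j | l ⊆ zeroSet (F j)}) ⟨_, hl⟩)

/-- A family of lines is small if its members in each component number at most a multiple of the
squared degree. -/
theorem card_le_of_components {r : ℕ} {F : ℕ → Poly3} (R : Finset (Set Pt)) {C m : ℕ}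
    (hm : ∑ j ∈ Finset.range r, (F j).totalDegree ≤ m) (hR : ∀ l ∈ R, compIdx F l < r)
    (hc : ∀ j < r, (R.filter fun l => compIdx F l = j).card ≤
      (F j).totalDegree * (C * (F j).totalDegree)) : R.card ≤ C * m ^ 2 := by
  rw [Finset.card_eq_sum_card_fiberwise (f := compIdx F) (t := Finset.range r)
    (fun l hl => by simpa using hR l hl)]
  have h1 : ∀ j ∈ Finset.range r, (F j).totalDegree ≤ m := fun j hj =>
    (Finset.single_le_sum (f := fun j => (F j).totalDegree) (fun _ _ => Nat.zero_le _) hj).trans hm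
  calc _ ≤ ∑ j ∈ Finset.range r, (F j).totalDegree * (C * m) := by
        refine Finset.sum_le_sum fun j hj => (hc j (Finset.mem_range.1 hj)).trans ?_
        gcongr
        exact h1 j hj
    _ ≤ m * (C * m) := by rw [← Finset.sum_mul]; gcongr
    _ = C * m ^ 2 := by ring

/-- The lines of `𝓐` meeting `S` inside the cell labelled `s`. -/
def cellLines (𝓐 : Finset (Set Pt)) (S : Finset Pt) (c : Pt → ℕ) (s : ℕ) : Finset (Set Pt) :=
  𝓐.filter fun l => ∃ x ∈ S, c x = s ∧ x ∈ l

theorem sum_card_cellLines_le {𝓐 : Finset (Set Pt)} {S : Finset Pt} {c : Pt → ℕ} {m : ℕ}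
    (h : ∀ l ∈ 𝓐, ((S.filter fun x => x ∈ l).image c).card ≤ m) :
    ∑ s ∈ S.image c, (cellLines 𝓐 S c s).card ≤ m * 𝓐.card := by
  simp only [cellLines, Finset.card_filter]
  rw [Finset.sum_comm, mul_comm, ← smul_eq_mul, ← Finset.sum_const]
  refine Finset.sum_le_sum fun l hl => ?_
  rw [← Finset.card_filter]
  refine (Finset.card_le_card ?_).trans (h l hl)
  intro s hs
  obtain ⟨x, hx, hxs, hxl⟩ := (Finset.mem_filter.1 hs).2
  exact Finset.mem_image.2 ⟨x, Finset.mem_filter.2 ⟨hx, hxl⟩, hxs⟩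

theorem card_cellLines_ge {𝓐 : Finset (Set Pt)} {S : Finset Pt} {c : Pt → ℕ} {s k : ℕ}
    (hS : ∀ x ∈ S, k ≤ (linesAt 𝓐 x).card) :
    ∀ x ∈ S.filter fun x => c x = s, k ≤ (linesAt (cellLines 𝓐 S c s) x).card := by
  intro x hx
  rw [Finset.mem_filter] at hx
  refine (hS x hx.1).trans (Finset.card_le_card fun l hl => ?_)
  rw [mem_linesAt] at hl ⊢
  exact ⟨Finset.mem_filter.2 ⟨hl.1, x, hx.1, hx.2, hl.2⟩, hl.2⟩

theorem cellLines_subset (𝓐 : Finset (Set Pt)) (S : Finset Pt) (c : Pt → ℕ) (s : ℕ) :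
    cellLines 𝓐 S c s ⊆ 𝓐 := Finset.filter_subset _ _

/-- The cell estimate when the number of points per cell is large compared with `k`. -/
theorem card_sq_mul_le_of_cells {𝓐 : Finset (Set Pt)} (hA : ∀ l ∈ 𝓐, IsLine l) {S : Finset Pt}
    {c : Pt → ℕ} {k D N : ℕ} (hk : 2 ≤ k) (hD : 0 < D) (hS : ∀ x ∈ S, k ≤ (linesAt 𝓐 x).card)
    (hl : ∀ l ∈ 𝓐, ((S.filter fun x => x ∈ l).image c).card ≤ 13 * D)
    (hN : ∀ s, D ^ 3 * (S.filter fun x => c x = s).card ≤ N) :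
    S.card ^ 2 * k ^ 2 * D ≤ 338 * N * 𝓐.card ^ 2 := by
  set q : ℝ := √(2 * N * D ^ 3) with hq
  have hD' : (0 : ℝ) < D := by exact_mod_cast hD
  have hcell : ∀ s, (D : ℝ) ^ 3 * k * (S.filter fun x => c x = s).card ≤
      q * (cellLines 𝓐 S c s).card := by
    intro s
    have h1 := card_mul_sq_le_two_mul_sq (fun l hl => hA l (cellLines_subset 𝓐 S c s hl)) _ hk
      (card_cellLines_ge (c := c) (s := s) hS)
    have h2 := hN s
    set a := (S.filter fun x => c x = s).card
    set b := (cellLines 𝓐 S c s).card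
    have h1' : (a : ℝ) * k ^ 2 ≤ 2 * b ^ 2 := by exact_mod_cast h1
    have h2' : (D : ℝ) ^ 3 * a ≤ N := by exact_mod_cast h2
    refine abs_le_of_sq_le_sq' ?_ (by positivity) |>.2
    rw [mul_pow, mul_pow q, hq, Real.sq_sqrt (by positivity)]
    calc ((D : ℝ) ^ 3 * k) ^ 2 * (a : ℝ) ^ 2 = D ^ 3 * (D ^ 3 * a) * (a * k ^ 2) := by ring
      _ ≤ (D : ℝ) ^ 3 * N * (2 * b ^ 2) := by gcongr
      _ = _ := by ring
  have hsum : (D : ℝ) ^ 3 * k * S.card ≤ q * (13 * D * 𝓐.card) := by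
    have h1 : ((∑ s ∈ S.image c, (S.filter fun x => c x = s).card : ℕ) : ℝ) = S.card := by
      rw [← Finset.card_eq_sum_card_image]
    have h2 : ((∑ s ∈ S.image c, (cellLines 𝓐 S c s).card : ℕ) : ℝ) ≤ 13 * D * 𝓐.card := by
      exact_mod_cast sum_card_cellLines_le hl
    rw [← h1]
    refine le_trans ?_ (mul_le_mul_of_nonneg_left h2 (Real.sqrt_nonneg _))
    push_cast
    rw [Finset.mul_sum, Finset.mul_sum]
    exact Finset.sum_le_sum fun s _ => hcell s
  have h3 := pow_le_pow_left₀ (by positivity) hsum 2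
  rw [mul_pow q, hq, Real.sq_sqrt (by positivity)] at h3
  have h4 : (D : ℝ) ^ 5 * (S.card ^ 2 * k ^ 2 * D) ≤ D ^ 5 * (338 * N * 𝓐.card ^ 2) := by
    calc _ = ((D : ℝ) ^ 3 * k * S.card) ^ 2 := by ring
      _ ≤ _ := h3
      _ = _ := by ring
  exact_mod_cast le_of_mul_le_mul_left h4 (by positivity)

/-- The cell estimate when the number of points per cell is small compared with `k`. -/
theorem card_mul_le_of_cells {𝓐 : Finset (Set Pt)} (hA : ∀ l ∈ 𝓐, IsLine l) {S : Finset Pt}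
    {c : Pt → ℕ} {k D : ℕ} (hS : ∀ x ∈ S, k ≤ (linesAt 𝓐 x).card)
    (hl : ∀ l ∈ 𝓐, ((S.filter fun x => x ∈ l).image c).card ≤ 13 * D)
    (hN : ∀ s, 2 * (S.filter fun x => c x = s).card ≤ k) :
    S.card * k ≤ 26 * D * 𝓐.card := by
  have h1 := sum_card_cellLines_le hl
  rw [Finset.card_eq_sum_card_image c S, Finset.sum_mul]
  calc _ ≤ ∑ s ∈ S.image c, 2 * (cellLines 𝓐 S c s).card :=
        Finset.sum_le_sum fun s _ => card_mul_le_two_mul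
          (fun l hl => hA l (cellLines_subset 𝓐 S c s hl)) _ (hN s)
          (card_cellLines_ge (c := c) (s := s) hS)
    _ ≤ _ := by rw [← Finset.mul_sum]; linarith

theorem sum_card_filter_linesAt_le {𝓐 : Finset (Set Pt)} {S : Finset Pt} (p : Pt → Set Pt → Prop)
    {m : ℕ} (hm : ∀ l ∈ 𝓐, (S.filter fun x => x ∈ l ∧ p x l).card ≤ m) :
    ∑ x ∈ S, ((linesAt 𝓐 x).filter fun l => p x l).card ≤ m * 𝓐.card :=
  calc _ = ∑ l ∈ 𝓐, (S.filter fun x => x ∈ l ∧ p x l).card := by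
        simp only [linesAt, Finset.filter_filter, Finset.card_filter]
        exact Finset.sum_comm
    _ ≤ ∑ l ∈ 𝓐, m := Finset.sum_le_sum hm
    _ = _ := by rw [Finset.sum_const, smul_eq_mul, mul_comm]

/-- Points lying on many marked incidences are few. -/
theorem card_mul_le_of_incidences {𝓐 : Finset (Set Pt)} {S : Finset Pt} (p : Pt → Set Pt → Prop)
    {k m : ℕ} (hS : ∀ x ∈ S, k ≤ 8 * ((linesAt 𝓐 x).filter fun l => p x l).card)
    (hm : ∀ l ∈ 𝓐, (S.filter fun x => x ∈ l ∧ p x l).card ≤ m) :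
    S.card * k ≤ 8 * (m * 𝓐.card) := by
  have h1 := Finset.card_nsmul_le_sum S _ k hS
  rw [smul_eq_mul, ← Finset.mul_sum] at h1
  exact h1.trans (Nat.mul_le_mul_left _ (sum_card_filter_linesAt_le p hm))

/-- Pairs of lines lying in the same component, of degree at most two. -/
theorem card_pairs_compIdx_le {n r : ℕ} {𝓐 𝓑 : Finset (Set Pt)} (hB : WellSpread n 𝓑)
    {F : ℕ → Poly3} (hF : ∀ j < r, Irreducible (F j)) :
    ((𝓐 ×ˢ 𝓑).filter fun y => compIdx F y.1 < r ∧ (F (compIdx F y.1)).totalDegree ≤ 2 ∧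
      y.2 ⊆ zeroSet (F (compIdx F y.1))).card ≤ 7 * n * 𝓐.card := by
  have := Finset.card_le_mul_card_image_of_maps_to (s := (𝓐 ×ˢ 𝓑).filter fun y =>
      compIdx F y.1 < r ∧ (F (compIdx F y.1)).totalDegree ≤ 2 ∧
      y.2 ⊆ zeroSet (F (compIdx F y.1))) (f := Prod.fst) (t := 𝓐)
    (fun y hy => (Finset.mem_product.1 (Finset.mem_filter.1 hy).1).1) (7 * n) ?_
  · exact this
  · intro l _
    by_cases h : compIdx F l < r ∧ (F (compIdx F l)).totalDegree ≤ 2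
    · refine le_trans (Finset.card_le_card_of_injOn Prod.snd ?_ ?_)
        (hB.card_quadric_le _ (hF _ h.1) h.2)
      · rintro ⟨l₁, l₂⟩ hy
        simp only [Finset.coe_filter, Finset.mem_filter, Finset.mem_product, Set.mem_ofPred_eq]
          at hy
        obtain ⟨⟨⟨h1, h2⟩, h3, h4, h5⟩, rfl⟩ := hy
        simpa using ⟨h2, h5⟩
      · rintro ⟨l₁, l₂⟩ hy ⟨l₁', l₂'⟩ hy' heq
        simp only [Finset.coe_filter, Finset.mem_filter, Set.mem_ofPred_eq] at hy hy'
        simp only at heq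
        rw [hy.2, hy'.2, heq]
    · rw [Finset.card_eq_zero.2]
      · exact Nat.zero_le _
      · rw [Finset.filter_eq_empty_iff]
        rintro ⟨l₁, l₂⟩ hy rfl
        rw [Finset.mem_filter] at hy
        exact h ⟨hy.2.1, hy.2.2.1⟩

/-- Surface estimate: apart from controlled exceptions, every point of a low-degree surface where
many lines meet is rich in lines of a small subfamily. -/
theorem exists_rich_lines_of_surface {n : ℕ} {𝓐 : Finset (Set Pt)} (hA : WellSpread n 𝓐)
    {S : Finset Pt} {k D : ℕ} (hk : 3 ≤ k) (hS : ∀ x ∈ S, k ≤ (linesAt 𝓐 x).card) {g : Poly3}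
    (hg : g ≠ 0) (hdeg : g.totalDegree ≤ 12 * D) (hSg : ∀ x ∈ S, x ∈ zeroSet g) :
    ∃ (S' : Finset Pt) (R : Finset (Set Pt)), R ⊆ 𝓐 ∧ R.card ≤ 576 * D ^ 2 ∧
      (∀ x ∈ S', 3 * k ≤ 4 * (linesAt R x).card) ∧
      S.card * k ^ 2 ≤ S'.card * k ^ 2 + 480 * D * 𝓐.card * k + 19 * n * 𝓐.card := by
  obtain ⟨r, F, hF, hFd, hFz⟩ := exists_components hg
  have hFd := hFd.trans hdeg
  have hFj : ∀ j < r, (F j).totalDegree ≤ 12 * D := fun j hj =>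
    (Finset.single_le_sum (f := fun j => (F j).totalDegree) (fun _ _ => Nat.zero_le _)
      (Finset.mem_range.2 hj)).trans hFd
  set bad : Pt → Finset (Set Pt) := fun x => (linesAt 𝓐 x).filter fun l => CrossesComp r F x l
    with hbad
  set good : Pt → Finset (Set Pt) := fun x => (linesAt 𝓐 x).filter fun l => ¬ CrossesComp r F x l
    with hgood
  have hbg : ∀ x, (bad x).card + (good x).card = (linesAt 𝓐 x).card := fun x =>
    Finset.card_filter_add_card_filter_not _
  have hgd : ∀ x ∈ S, ∀ l ∈ good x, l ∈ 𝓐 ∧ x ∈ l ∧ compIdx F {x} < r ∧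
      l ⊆ zeroSet (F (compIdx F {x})) ∧ compIdx F l = compIdx F {x} := by
    intro x hx l hl
    rw [hgood, Finset.mem_filter, mem_linesAt] at hl
    exact ⟨hl.1.1, hl.1.2, compIdx_of_not_crossesComp (hFz x (hSg x hx)) hl.1.2 hl.2⟩
  set Sb := S.filter fun x => k ≤ 8 * (bad x).card with hSb
  set S₁ := S.filter fun x => ¬ k ≤ 8 * (bad x).card with hS₁
  have hcb : Sb.card + S₁.card = S.card := Finset.card_filter_add_card_filter_not _
  have hSb' : Sb.card * k ≤ 8 * (12 * D * 𝓐.card) := by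
    refine card_mul_le_of_incidences (fun x l => CrossesComp r F x l)
      (fun x hx => (Finset.mem_filter.1 hx).2) fun l hl => ?_
    exact (card_crossesComp_le (hA.isLine l hl) _ fun x hx => (Finset.mem_filter.1 hx).2).trans hFd
  set Sp := S₁.filter fun x => (F (compIdx F {x})).totalDegree ≤ 1 with hSp
  set S₂ := S₁.filter fun x => ¬ (F (compIdx F {x})).totalDegree ≤ 1 with hS₂
  have hcp : Sp.card + S₂.card = S₁.card := Finset.card_filter_add_card_filter_not _
  have hg1 : ∀ x ∈ S₁, 7 * k < 8 * (good x).card := by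
    intro x hx
    rw [hS₁, Finset.mem_filter] at hx
    have h1 := hS x hx.1
    have h2 := hbg x
    omega
  have hSp' : Sp.card * k ^ 2 ≤ 19 * n * 𝓐.card := by
    have h1 := card_mul_sq_le_of_pairs hA.isLine Sp good
      (fun x hx l hl => by
        have := hgd x (Finset.mem_filter.1 (Finset.mem_filter.1 hx).1).1 l hl
        exact ⟨this.1, this.2.1⟩) ((𝓐 ×ˢ 𝓐).filter fun y => compIdx F y.1 < r ∧
          (F (compIdx F y.1)).totalDegree ≤ 2 ∧ y.2 ⊆ zeroSet (F (compIdx F y.1))) (fun x hx l hl l'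
            hl' => by
        rw [hSp, Finset.mem_filter] at hx
        have hxS := (Finset.mem_filter.1 hx.1).1
        obtain ⟨a1, a2, a3, a4, a5⟩ := hgd x hxS l hl
        obtain ⟨b1, b2, b3, b4, b5⟩ := hgd x hxS l' hl'
        refine Finset.mem_filter.2 ⟨Finset.mem_product.2 ⟨a1, b1⟩, ?_⟩
        show compIdx F l < r ∧ (F (compIdx F l)).totalDegree ≤ 2 ∧ l' ⊆ zeroSet (F (compIdx F l))
        rw [a5]
        exact ⟨a3, hx.2.trans (by norm_num), b4⟩) (k := (7 * k + 7) / 8) (by omega) (fun x hx => by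
        have := hg1 x (Finset.mem_filter.1 hx).1
        omega)
    have h2 := card_pairs_compIdx_le (𝓐 := 𝓐) hA hF
    have h3 : 49 * k ^ 2 ≤ 64 * ((7 * k + 7) / 8) ^ 2 := by
      have : 7 * k ≤ 8 * ((7 * k + 7) / 8) := by omega
      have := Nat.pow_le_pow_left this 2
      linarith [mul_pow 7 k 2, mul_pow 8 ((7 * k + 7) / 8) 2]
    have h4 : Sp.card * (49 * k ^ 2) ≤ 64 * (2 * (7 * n * 𝓐.card)) :=
      calc _ ≤ Sp.card * (64 * ((7 * k + 7) / 8) ^ 2) := by gcongr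
        _ = 64 * (Sp.card * ((7 * k + 7) / 8) ^ 2) := by ring
        _ ≤ _ := Nat.mul_le_mul_left _ (h1.trans (Nat.mul_le_mul_left _ h2))
    have h5 : Sp.card * (49 * k ^ 2) = 49 * (Sp.card * k ^ 2) := by ring
    have h6 : 19 * n * 𝓐.card = 19 * (n * 𝓐.card) := by ring
    have h7 : 64 * (2 * (7 * n * 𝓐.card)) = 896 * (n * 𝓐.card) := by ring
    omega
  set T : Set Pt → Finset Pt := fun l => S₂.filter fun x => x ∈ l ∧ ¬ CrossesComp r F x l with hT
  set R := 𝓐.filter fun l => 4 * (F (compIdx F l)).totalDegree < (T l).card with hR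
  have hTm : ∀ l ∈ 𝓐, ∀ x ∈ T l, x ∈ l ∧ x ∈ S₁ ∧ l ∈ good x ∧ compIdx F l = compIdx F {x} ∧
      compIdx F l < r ∧ 2 ≤ (F (compIdx F l)).totalDegree ∧ l ⊆ zeroSet (F (compIdx F l)) := by
    intro l hl x hx
    rw [hT, Finset.mem_filter, hS₂, Finset.mem_filter] at hx
    have hlg : l ∈ good x := Finset.mem_filter.2 ⟨mem_linesAt.2 ⟨hl, hx.2.1⟩, hx.2.2⟩
    obtain ⟨a1, a2, a3, a4, a5⟩ := hgd x (Finset.mem_filter.1 hx.1.1).1 l hlg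
    rw [a5]
    exact ⟨a2, hx.1.1, hlg, rfl, a3, by omega, a4⟩
  have hRT : ∀ l ∈ R, l ∈ 𝓐 ∧ 4 * (F (compIdx F l)).totalDegree < (T l).card ∧ (T l).Nonempty := by
    intro l hl
    rw [hR, Finset.mem_filter] at hl
    exact ⟨hl.1, hl.2, Finset.card_pos.1 (by omega)⟩
  obtain ⟨poor, hpoor⟩ : ∃ p : Pt → Set Pt → Prop, ∀ x l, p x l ↔ ¬ CrossesComp r F x l ∧ l ∉ R :=
    ⟨_, fun _ _ => Iff.rfl⟩
  refine ⟨S₂.filter fun x => ¬ k ≤ 8 * ((linesAt 𝓐 x).filter fun l => poor x l).card, R,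
    Finset.filter_subset _ _, ?_, ?_, ?_⟩
  · have h1 : R.card ≤ 4 * (12 * D) ^ 2 := by
      refine card_le_of_components (F := F) R hFd (fun l hl => ?_) fun j hj => ?_
      · obtain ⟨h1, -, x, hx⟩ := hRT l hl
        exact (hTm l h1 x hx).2.2.2.2.1
      · rcases (R.filter fun l => compIdx F l = j).eq_empty_or_nonempty with h | ⟨l₀, hl₀⟩
        · rw [h]
          exact Nat.zero_le _
        · have hmem : ∀ l ∈ R.filter fun l => compIdx F l = j, l ∈ 𝓐 ∧ compIdx F l = j ∧
              4 * (F j).totalDegree < (T l).card ∧ (T l).Nonempty := by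
            intro l hl
            rw [Finset.mem_filter] at hl
            obtain ⟨h1, h2, h3⟩ := hRT l hl.1
            exact ⟨h1, hl.2, hl.2 ▸ h2, h3⟩
          refine card_flat_lines_le (hF j hj) ?_ _ (fun l hl => hA.isLine l (hmem l hl).1) ?_ ?_
          · obtain ⟨h1, h2, h3, x, hx⟩ := hmem l₀ hl₀
            exact h2 ▸ (hTm l₀ h1 x hx).2.2.2.2.2.1
          · intro l hl
            obtain ⟨h1, h2, h3, x, hx⟩ := hmem l hl
            exact h2 ▸ (hTm l h1 x hx).2.2.2.2.2.2
          · intro l hl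
            obtain ⟨h1, h2, h3, -⟩ := hmem l hl
            refine ⟨T l, h3, fun x hx => ?_⟩
            obtain ⟨a1, a2, a3, a4, a5, a6, a7⟩ := hTm l h1 x hx
            have hxS := (Finset.mem_filter.1 a2).1
            refine ⟨a1, ?_⟩
            have hc : 1 < ((good x).erase l).card := by
              rw [Finset.card_erase_of_mem a3]
              have := hg1 x a2
              omega
            obtain ⟨l₁, h₁, l₂, h₂, hne⟩ := Finset.one_lt_card.1 hc
            rw [Finset.mem_erase] at h₁ h₂
            obtain ⟨c1, c2, c3, c4, c5⟩ := hgd x hxS l₁ h₁.2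
            obtain ⟨d1, d2, d3, d4, d5⟩ := hgd x hxS l₂ h₂.2
            rw [← a4, h2] at c4 d4
            exact ⟨l₁, l₂, hA.isLine _ c1, hA.isLine _ d1, c2, d2, c4, d4, h₁.1.symm, h₂.1.symm,
              hne⟩
    linarith [mul_pow 12 D 2]
  · intro x hx
    rw [Finset.mem_filter] at hx
    have hx1 := hg1 x (Finset.mem_filter.1 hx.1).1
    have h1 : (good x).card ≤ ((linesAt 𝓐 x).filter fun l => poor x l).card +
        (linesAt R x).card := by
      refine le_trans (Finset.card_le_card fun l hl => ?_) (Finset.card_union_le _ _)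
      rw [hgood, Finset.mem_filter] at hl
      rw [Finset.mem_union, Finset.mem_filter, hpoor, mem_linesAt (𝓐 := R)]
      by_cases h : l ∈ R
      · exact Or.inr ⟨h, (mem_linesAt.1 hl.1).2⟩
      · exact Or.inl ⟨hl.1, hl.2, h⟩
    omega
  · have hcq := Finset.card_filter_add_card_filter_not (s := S₂) (fun x => k ≤ 8 *
      ((linesAt 𝓐 x).filter fun l => poor x l).card)
    have hSq : (S₂.filter fun x => k ≤ 8 * ((linesAt 𝓐 x).filter fun l => poor x l).card).card * k ≤
      8 * (48 * D * 𝓐.card) := by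
      refine card_mul_le_of_incidences poor
        (fun x hx => (Finset.mem_filter.1 hx).2) fun l hl => ?_
      by_cases h : l ∈ R
      · rw [Finset.card_eq_zero.2]
        · exact Nat.zero_le _
        · rw [Finset.filter_eq_empty_iff]
          exact fun x _ hx => ((hpoor x l).1 hx.2).2 h
      · have hTc : (T l).card ≤ 4 * (F (compIdx F l)).totalDegree := by
          by_contra! hc
          exact h (Finset.mem_filter.2 ⟨hl, hc⟩)
        refine (Finset.card_le_card (t := T l) fun x hx => ?_).trans ?_
        · rw [Finset.mem_filter, Finset.mem_filter] at hx
          exact Finset.mem_filter.2 ⟨hx.1.1, hx.2.1, ((hpoor x l).1 hx.2.2).1⟩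
        · rcases (T l).eq_empty_or_nonempty with h0 | ⟨x, hx⟩
          · rw [h0]
            exact Nat.zero_le _
          · have := hFj _ (hTm l hl x hx).2.2.2.2.1
            omega
    set q := (S₂.filter fun x => k ≤ 8 * ((linesAt 𝓐 x).filter fun l => poor x l).card).card
    set S' := S₂.filter fun x => ¬ k ≤ 8 * ((linesAt 𝓐 x).filter fun l => poor x l).card
    have e1 : S.card = Sb.card + Sp.card + q + S'.card := by omega
    rw [e1]
    calc (Sb.card + Sp.card + q + S'.card) * k ^ 2
        = Sb.card * k * k + Sp.card * k ^ 2 + q * k * k + S'.card * k ^ 2 := by ring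
      _ ≤ 8 * (12 * D * 𝓐.card) * k + 19 * n * 𝓐.card + 8 * (48 * D * 𝓐.card) * k +
          S'.card * k ^ 2 := by gcongr
      _ = _ := by ring

theorem exists_pow_two_maximal {p : ℕ → Prop} (h0 : p 1) {B : ℕ} (hB : ∀ m, p m → m ≤ B) :
    ∃ i, p (2 ^ i) ∧ ¬ p (2 * 2 ^ i) := by
  by_contra! h
  have : ∀ i, p (2 ^ i) := fun i => by
    induction i with
    | zero => simpa using h0
    | succ i ih => rw [pow_succ, mul_comm]; exact h i ih
  exact absurd (hB _ (this B)) (not_le.2 Nat.lt_two_pow_self)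

set_option maxHeartbeats 800000 in
/-- Points of multiplicity at least `k ≥ 3` in a well-spread family of lines. -/
theorem card_rich_points_mul_sq_le {n : ℕ} : ∀ (L : ℕ) {𝓐 : Finset (Set Pt)}, 𝓐.card = L →
    WellSpread n 𝓐 → ∀ {k : ℕ}, 3 ≤ k → ∀ S : Finset Pt, (∀ x ∈ S, k ≤ (linesAt 𝓐 x).card) →
      S.card * k ^ 2 ≤ 2 ^ 21 * L * n := by
  intro L
  induction L using Nat.strong_induction_on with
  | _ L ih =>
  intro 𝓐 hL hA k hk S₀ hS₀
  by_contra! hc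
  have hne : S₀.Nonempty := by
    rw [Finset.nonempty_iff_ne_empty]
    rintro rfl
    simp at hc
  obtain ⟨x₀, hx₀⟩ := hne
  have hkn : k ≤ n := (hS₀ x₀ hx₀).trans (hA.card_linesAt_le x₀)
  have hkL : k ≤ L := hL ▸ (hS₀ x₀ hx₀).trans (Finset.card_le_card (Finset.filter_subset _ _))
  have hLn : L ≤ n ^ 2 := hL ▸ hA.card_le
  have hk2 : k ^ 2 ≤ L * n := by rw [sq]; exact Nat.mul_le_mul hkL hkn
  obtain ⟨S, hSS₀, hN⟩ : ∃ S ⊆ S₀, S.card = 2 ^ 21 * L * n / k ^ 2 + 1 := by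
    refine Finset.exists_subset_card_eq (Nat.succ_le_of_lt ?_)
    exact (Nat.div_lt_iff_lt_mul (by positivity)).2 hc
  have hS : ∀ x ∈ S, k ≤ (linesAt 𝓐 x).card := fun x hx => hS₀ x (hSS₀ hx)
  have hlow : 2 ^ 21 * L * n < S.card * k ^ 2 := by
    rw [hN]
    exact (Nat.div_lt_iff_lt_mul (by positivity)).1 (Nat.lt_succ_self _)
  have hS0 : 0 < S.card := by
    rw [hN]
    exact Nat.succ_pos _
  have hup : S.card * k ^ 2 ≤ 2 * (2 ^ 21 * L * n) := by
    rw [hN, add_mul, one_mul]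
    have := Nat.div_mul_le_self (2 ^ 21 * L * n) (k ^ 2)
    nlinarith
  have hLbig : 8192 ≤ L := by
    by_contra! hlt
    have h1 := card_mul_sq_le_two_mul_sq hA.isLine S (by omega : 2 ≤ k) hS
    rw [hL] at h1
    have : 2 * L ^ 2 ≤ 2 ^ 21 * L * n := by
      rw [sq]
      calc 2 * (L * L) ≤ 2 ^ 21 * L * 1 := by nlinarith
        _ ≤ 2 ^ 21 * L * n := by gcongr; omega
    omega
  obtain ⟨i, ⟨hD1, hD2⟩, hD3⟩ := exists_pow_two_maximal
    (p := fun D => 8192 * D ^ 2 ≤ L ∧ 3840 * D * k ≤ 2 ^ 21 * n) ⟨by omega, by omega⟩ (B := L)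
    (fun m hm => by nlinarith [hm.1])
  obtain ⟨g, c, hg, hgd, hcell, hline⟩ := exists_partition S (fun _ => 1) (fun _ => zero_le_one) i
  set D := 2 ^ i with hD
  have hD0 : 0 < D := by positivity
  set Sc := S.filter fun x => MvPolynomial.eval x g ≠ 0 with hSc
  set Sz := S.filter fun x => ¬ MvPolynomial.eval x g ≠ 0 with hSz
  have hcs : Sc.card + Sz.card = S.card := Finset.card_filter_add_card_filter_not _
  rcases le_total S.card (2 * Sz.card) with hz | hz
  · obtain ⟨S', R, hR, hRc, hS', hcount⟩ := exists_rich_lines_of_surface hA hk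
      (S := Sz) (fun x hx => hS x (Finset.mem_filter.1 hx).1) hg hgd
      (fun x hx => mem_zeroSet.2 (not_not.1 (Finset.mem_filter.1 hx).2))
    have h1 := ih R.card (by omega) rfl (hA.mono hR) (k := (3 * k + 3) / 4) (by omega) S'
      (fun x hx => by have := hS' x hx; omega)
    have h2 : 9 * k ^ 2 ≤ 16 * ((3 * k + 3) / 4) ^ 2 := by
      have : 3 * k ≤ 4 * ((3 * k + 3) / 4) := by omega
      have := Nat.pow_le_pow_left this 2
      linarith [mul_pow 3 k 2, mul_pow 4 ((3 * k + 3) / 4) 2]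
    have h3 : 9 * (S'.card * k ^ 2) ≤ 16 * (2 ^ 21 * (576 * D ^ 2) * n) :=
      calc 9 * (S'.card * k ^ 2) = S'.card * (9 * k ^ 2) := by ring
        _ ≤ S'.card * (16 * ((3 * k + 3) / 4) ^ 2) := by gcongr
        _ = 16 * (S'.card * ((3 * k + 3) / 4) ^ 2) := by ring
        _ ≤ 16 * (2 ^ 21 * R.card * n) := by gcongr
        _ ≤ _ := by gcongr
    have h4 : 8192 * D ^ 2 * n ≤ L * n := Nat.mul_le_mul_right n hD1
    have h5 : 3840 * D * k * L ≤ 2 ^ 21 * n * L := Nat.mul_le_mul_right L hD2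
    have h6 : S.card * k ^ 2 ≤ 2 * (Sz.card * k ^ 2) := by
      rw [← mul_assoc]
      gcongr
    rw [hL] at hcount
    have h7 : 0 < L * n := by nlinarith
    linarith
  · have hSc2 : S.card ≤ 2 * Sc.card := by omega
    have hcl : ∀ l ∈ 𝓐, ((Sc.filter fun x => x ∈ l).image c).card ≤ 13 * D := by
      intro l hl
      have := hline l (hA.isLine l hl) (Sc.filter fun x => x ∈ l) (fun x hx => by
        rw [Finset.mem_filter, hSc, Finset.mem_filter] at hx
        exact ⟨hx.2, hx.1.2⟩)
      exact this
    have hcN : ∀ s, D ^ 3 * (Sc.filter fun x => c x = s).card ≤ S.card := by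
      intro s
      have := hcell s
      simp only [Finset.sum_const, nsmul_eq_mul, mul_one] at this
      rw [hSc, Finset.filter_filter]
      exact_mod_cast this
    have hSck : ∀ x ∈ Sc, k ≤ (linesAt 𝓐 x).card := fun x hx => hS x (Finset.mem_filter.1 hx).1
    rw [not_and_or, not_le, not_le] at hD3
    rcases hD3 with hD3 | hD3
    · have h1 := card_sq_mul_le_of_cells hA.isLine (by omega : 2 ≤ k) hD0 hSck hcl hcN
      rw [hL] at h1
      have h2 : S.card * (S.card * k ^ 2 * D) ≤ S.card * (1352 * L ^ 2) :=
        calc S.card * (S.card * k ^ 2 * D) = S.card ^ 2 * k ^ 2 * D := by ring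
          _ ≤ (2 * Sc.card) ^ 2 * k ^ 2 * D := by gcongr
          _ = 4 * (Sc.card ^ 2 * k ^ 2 * D) := by ring
          _ ≤ 4 * (338 * S.card * L ^ 2) := by gcongr
          _ = _ := by ring
      have h3 := Nat.le_of_mul_le_mul_left h2 hS0
      have h4 : L * (2 ^ 21 * n * D) ≤ L * (1352 * L) := by
        calc L * (2 ^ 21 * n * D) = 2 ^ 21 * L * n * D := by ring
          _ ≤ S.card * k ^ 2 * D := by gcongr
          _ ≤ _ := h3
          _ = _ := by ring
      have h5 := Nat.le_of_mul_le_mul_left h4 (by omega)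
      have h6 := Nat.pow_le_pow_left h5 2
      have h7 : (2 ^ 21 * n * D) ^ 2 * 32768 ≤ 1352 ^ 2 * 32768 * L * n ^ 2 :=
        calc (2 ^ 21 * n * D) ^ 2 * 32768 ≤ (1352 * L) ^ 2 * 32768 := by gcongr
          _ = 1352 ^ 2 * 32768 * L * L := by ring
          _ ≤ _ := by gcongr
      have h8 : L * n ^ 2 ≤ 32768 * D ^ 2 * n ^ 2 := by
        gcongr
        nlinarith
      have h9 : 0 < L * n ^ 2 := by
        have : 0 < n := by omega
        have : 0 < L := by omega
        positivity
      have h10 : 2 ^ 42 * (L * n ^ 2) ≤ 1352 ^ 2 * 32768 * (L * n ^ 2) :=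
        calc 2 ^ 42 * (L * n ^ 2) ≤ 2 ^ 42 * (32768 * D ^ 2 * n ^ 2) := Nat.mul_le_mul_left _ h8
          _ = (2 ^ 21 * n * D) ^ 2 * 32768 := by ring
          _ ≤ _ := h7
          _ = _ := by ring
      omega
    · have h1 := card_mul_le_of_cells hA.isLine hSck hcl (fun s => by
        have h2 := hcN s
        have h3 : 2 * S.card * k ^ 2 ≤ D ^ 3 * k * k ^ 2 := by
          have h4 := Nat.pow_le_pow_left hD3.le 3
          have h5 : L * n ≤ n ^ 3 := (Nat.mul_le_mul_right n hLn).trans_eq (pow_succ n 2).symm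
          have h6 : 2 ^ 63 * n ^ 3 ≤ 7680 ^ 3 * (D ^ 3 * k * k ^ 2) :=
            calc 2 ^ 63 * n ^ 3 = (2 ^ 21 * n) ^ 3 := by ring
              _ ≤ _ := h4
              _ = _ := by ring
          have h7 : S.card * k ^ 2 ≤ 2 ^ 22 * n ^ 3 :=
            calc S.card * k ^ 2 ≤ 2 * (2 ^ 21 * L * n) := hup
              _ = 2 ^ 22 * (L * n) := by ring
              _ ≤ _ := Nat.mul_le_mul_left _ h5
          rw [mul_assoc]
          omega
        have h7 := Nat.le_of_mul_le_mul_right h3 (by positivity)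
        have h8 : D ^ 3 * (2 * (Sc.filter fun x => c x = s).card) ≤ D ^ 3 * k := by linarith
        exact Nat.le_of_mul_le_mul_left h8 (by positivity))
      rw [hL] at h1
      have h2 : S.card * k ^ 2 ≤ 2 * (26 * D * L) * k := by
        calc S.card * k ^ 2 ≤ 2 * Sc.card * k ^ 2 := by gcongr
          _ = 2 * (Sc.card * k) * k := by ring
          _ ≤ _ := by gcongr
      have h3 : 3840 * D * k * L ≤ 2 ^ 21 * n * L := Nat.mul_le_mul_right L hD2
      linarith

/-- Pairs of distinct lines of `𝓐` and `𝓑` crossing at `x`. -/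
def crossPairs (𝓐 𝓑 : Finset (Set Pt)) (x : Pt) : Finset (Set Pt × Set Pt) :=
  (linesAt 𝓐 x ×ˢ linesAt 𝓑 x).filter fun y => y.1 ≠ y.2

theorem mem_crossPairs {𝓐 𝓑 : Finset (Set Pt)} {x : Pt} {y : Set Pt × Set Pt} :
    y ∈ crossPairs 𝓐 𝓑 x ↔ (y.1 ∈ 𝓐 ∧ x ∈ y.1) ∧ (y.2 ∈ 𝓑 ∧ x ∈ y.2) ∧ y.1 ≠ y.2 := by
  rw [crossPairs, Finset.mem_filter, Finset.mem_product, mem_linesAt, mem_linesAt, and_assoc]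

/-- Pairs of distinct lines determine their crossing point. -/
theorem sum_card_subset_crossPairs_le {𝓐 𝓑 : Finset (Set Pt)} (hA : ∀ l ∈ 𝓐, IsLine l)
    (hB : ∀ l ∈ 𝓑, IsLine l) (S : Finset Pt) (G : Pt → Finset (Set Pt × Set Pt))
    (hG : ∀ x ∈ S, G x ⊆ crossPairs 𝓐 𝓑 x) (Q : Finset (Set Pt × Set Pt))
    (hQ : ∀ x ∈ S, G x ⊆ Q) : ∑ x ∈ S, (G x).card ≤ Q.card := by
  rw [← Finset.card_sigma]
  refine Finset.card_le_card_of_injOn (fun y => y.2) ?_ ?_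
  · rintro ⟨x, y⟩ hy
    simp only [Finset.coe_sigma, Set.mem_sigma_iff, Finset.mem_coe] at hy
    exact hQ x hy.1 hy.2
  · rintro ⟨x, y⟩ hy ⟨x', y'⟩ hy' heq
    simp only at heq
    subst heq
    simp only [Finset.coe_sigma, Set.mem_sigma_iff, Finset.mem_coe] at hy hy'
    obtain ⟨h1, h2, h3⟩ := mem_crossPairs.1 (hG x hy.1 hy.2)
    obtain ⟨h1', h2', -⟩ := mem_crossPairs.1 (hG x' hy'.1 hy'.2)
    have : x = x' := (hA _ h1.1).inter_subsingleton (hB _ h2.1) h3 ⟨h1.2, h2.2⟩ ⟨h1'.2, h2'.2⟩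
    rw [this]

theorem sum_card_crossPairs_le {𝓐 𝓑 : Finset (Set Pt)} (hA : ∀ l ∈ 𝓐, IsLine l)
    (hB : ∀ l ∈ 𝓑, IsLine l) (S : Finset Pt) :
    ∑ x ∈ S, (crossPairs 𝓐 𝓑 x).card ≤ 𝓐.card * 𝓑.card := by
  rw [← Finset.card_product]
  refine sum_card_subset_crossPairs_le hA hB S _ (fun _ _ => subset_rfl) _ fun x _ y hy => ?_
  obtain ⟨h1, h2, -⟩ := mem_crossPairs.1 hy
  exact Finset.mem_product.2 ⟨h1.1, h2.1⟩

/-- Summation of cell estimates by the Cauchy–Schwarz inequality. -/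
theorem sum_sq_mul_le_of_cells {I : Finset ℕ} {w a b : ℕ → ℕ} {D N A B : ℕ} (hD : 0 < D)
    (hN : ∀ s, D ^ 3 * w s ≤ N) (hw : ∀ s, w s ≤ a s * b s) (ha : ∑ s ∈ I, a s ≤ 13 * D * A)
    (hb : ∑ s ∈ I, b s ≤ 13 * D * B) : (∑ s ∈ I, w s) ^ 2 * D ≤ 169 * N * (A * B) := by
  have hD' : (0 : ℝ) < D := by exact_mod_cast hD
  have hcell : ∀ s, √((D : ℝ) ^ 3) * w s ≤ √N * (√(a s : ℝ) * √(b s : ℝ)) := by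
    intro s
    have h1 : (w s : ℝ) ≤ a s * b s := by exact_mod_cast hw s
    have h2 : (D : ℝ) ^ 3 * w s ≤ N := by exact_mod_cast hN s
    rw [← Real.sqrt_mul (by positivity), ← Real.sqrt_mul (by positivity)]
    refine Real.le_sqrt_of_sq_le ?_
    rw [mul_pow, Real.sq_sqrt (by positivity)]
    calc (D : ℝ) ^ 3 * (w s : ℝ) ^ 2 = (D ^ 3 * w s) * w s := by ring
      _ ≤ _ := by gcongr
  have hsum : √((D : ℝ) ^ 3) * (∑ s ∈ I, w s : ℕ) ≤ √N * (√(13 * D * A) * √(13 * D * B)) := by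
    have h2 : (∑ s ∈ I, (a s : ℝ)) ≤ 13 * D * A := by exact_mod_cast ha
    have h3 : (∑ s ∈ I, (b s : ℝ)) ≤ 13 * D * B := by exact_mod_cast hb
    push_cast
    rw [Finset.mul_sum]
    refine (Finset.sum_le_sum fun s _ => hcell s).trans ?_
    rw [← Finset.mul_sum]
    refine mul_le_mul_of_nonneg_left ?_ (Real.sqrt_nonneg _)
    refine (Real.sum_sqrt_mul_sqrt_le _ (fun _ => by positivity) fun _ => by positivity).trans ?_
    gcongr
  generalize ∑ s ∈ I, w s = W at hsum ⊢
  have h3 := pow_le_pow_left₀ (by positivity) hsum 2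
  rw [mul_pow, mul_pow, mul_pow, Real.sq_sqrt (by positivity), Real.sq_sqrt (by positivity),
    Real.sq_sqrt (by positivity), Real.sq_sqrt (by positivity)] at h3
  have h4 : (D : ℝ) ^ 2 * (W ^ 2 * D) ≤ D ^ 2 * (169 * N * (A * B)) := by
    calc _ = (D : ℝ) ^ 3 * W ^ 2 := by ring
      _ ≤ _ := h3
      _ = _ := by ring
  exact_mod_cast le_of_mul_le_mul_left h4 (by positivity)

/-- The cell estimate for crossings of two families of lines. -/
theorem sum_crossPairs_sq_mul_le_of_cells {𝓐 𝓑 : Finset (Set Pt)} (hA : ∀ l ∈ 𝓐, IsLine l)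
    (hB : ∀ l ∈ 𝓑, IsLine l) {S : Finset Pt} {c : Pt → ℕ} {D N : ℕ} (hD : 0 < D)
    (hlA : ∀ l ∈ 𝓐, ((S.filter fun x => x ∈ l).image c).card ≤ 13 * D)
    (hlB : ∀ l ∈ 𝓑, ((S.filter fun x => x ∈ l).image c).card ≤ 13 * D)
    (hN : ∀ s, D ^ 3 * ∑ x ∈ S with c x = s, (crossPairs 𝓐 𝓑 x).card ≤ N) :
    (∑ x ∈ S, (crossPairs 𝓐 𝓑 x).card) ^ 2 * D ≤ 169 * N * (𝓐.card * 𝓑.card) := by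
  rw [← Finset.sum_fiberwise_of_maps_to (fun x hx => Finset.mem_image_of_mem c hx)]
  refine sum_sq_mul_le_of_cells hD hN (fun s => ?_) (sum_card_cellLines_le hlA)
    (sum_card_cellLines_le hlB)
  rw [← Finset.card_product]
  refine sum_card_subset_crossPairs_le hA hB _ _ (fun _ _ => subset_rfl) _ fun x hx y hy => ?_
  rw [Finset.mem_filter] at hx
  obtain ⟨h1, h2, -⟩ := mem_crossPairs.1 hy
  exact Finset.mem_product.2 ⟨Finset.mem_filter.2 ⟨h1.1, x, hx.1, hx.2, h1.2⟩,
    Finset.mem_filter.2 ⟨h2.1, x, hx.1, hx.2, h2.2⟩⟩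

theorem sum_card_crossPairs_fst_le {𝓐 𝓑 : Finset (Set Pt)} {S : Finset Pt} {N m : ℕ}
    (hN : ∀ x ∈ S, (linesAt 𝓑 x).card * 𝓐.card ≤ N) (p : Pt → Set Pt → Prop)
    (hm : ∀ l ∈ 𝓐, (S.filter fun x => x ∈ l ∧ p x l).card ≤ m) :
    ∑ x ∈ S, ((crossPairs 𝓐 𝓑 x).filter fun y => p x y.1).card ≤ N * m := by
  rcases Nat.eq_zero_or_pos 𝓐.card with h0 | h0
  · rw [Finset.sum_eq_zero]
    · exact Nat.zero_le _
    · intro x _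
      rw [Finset.card_eq_zero, Finset.filter_eq_empty_iff]
      intro y hy
      rw [Finset.card_eq_zero.1 h0] at hy
      exact absurd (mem_crossPairs.1 hy).1.1 (Finset.notMem_empty _)
  · refine Nat.le_of_mul_le_mul_right ?_ h0
    have h1 := sum_card_filter_linesAt_le p hm
    calc _ ≤ ∑ x ∈ S, N * ((linesAt 𝓐 x).filter fun l => p x l).card := by
          rw [Finset.sum_mul]
          refine Finset.sum_le_sum fun x hx => ?_
          have h2 : ((crossPairs 𝓐 𝓑 x).filter fun y => p x y.1).card ≤
              ((linesAt 𝓐 x).filter fun l => p x l).card * (linesAt 𝓑 x).card := by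
            rw [← Finset.card_product]
            refine Finset.card_le_card fun y hy => ?_
            rw [Finset.mem_filter, mem_crossPairs] at hy
            exact Finset.mem_product.2 ⟨Finset.mem_filter.2 ⟨mem_linesAt.2 hy.1.1, hy.2⟩,
              mem_linesAt.2 hy.1.2.1⟩
          have h3 := hN x hx
          calc _ ≤ ((linesAt 𝓐 x).filter fun l => p x l).card * (linesAt 𝓑 x).card * 𝓐.card :=
                Nat.mul_le_mul_right _ h2
            _ = ((linesAt 𝓐 x).filter fun l => p x l).card * ((linesAt 𝓑 x).card * 𝓐.card) := by
                ring
            _ ≤ ((linesAt 𝓐 x).filter fun l => p x l).card * N := Nat.mul_le_mul_left _ h3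
            _ = _ := mul_comm _ _
      _ ≤ N * (m * 𝓐.card) := by rw [← Finset.mul_sum]; exact Nat.mul_le_mul_left _ h1
      _ = _ := by ring

theorem sum_card_crossPairs_snd_le {𝓐 𝓑 : Finset (Set Pt)} {S : Finset Pt} {m : ℕ}
    (ha : ∀ x ∈ S, (linesAt 𝓐 x).card ≤ 2) (p : Pt → Set Pt → Prop)
    (hm : ∀ l ∈ 𝓑, (S.filter fun x => x ∈ l ∧ p x l).card ≤ m) :
    ∑ x ∈ S, ((crossPairs 𝓐 𝓑 x).filter fun y => p x y.2).card ≤ 2 * (m * 𝓑.card) := by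
  refine le_trans ?_ (Nat.mul_le_mul_left 2 (sum_card_filter_linesAt_le p hm))
  rw [Finset.mul_sum]
  refine Finset.sum_le_sum fun x hx => ?_
  refine le_trans ?_ (Nat.mul_le_mul_right _ (ha x hx))
  rw [← Finset.card_product]
  refine Finset.card_le_card fun y hy => ?_
  rw [Finset.mem_filter, mem_crossPairs] at hy
  exact Finset.mem_product.2 ⟨mem_linesAt.2 hy.1.1,
    Finset.mem_filter.2 ⟨mem_linesAt.2 hy.1.2.1, hy.2⟩⟩

/-- Surface estimate for crossings of two families of lines: up to a controlled error, all
crossings on a low-degree surface involve a small subfamily of `𝓐`. -/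
theorem exists_crossing_lines_of_surface {n : ℕ} {𝓐 𝓑 : Finset (Set Pt)} (hB : WellSpread n 𝓑)
    (hAB : 𝓐 ⊆ 𝓑) {S : Finset Pt} {D : ℕ} (ha : ∀ x ∈ S, (linesAt 𝓐 x).card ≤ 2)
    (hb : ∀ x ∈ S, (linesAt 𝓑 x).card * 𝓐.card ≤ 2 * n ^ 2) {g : Poly3}
    (hg : g ≠ 0) (hdeg : g.totalDegree ≤ 12 * D) (hSg : ∀ x ∈ S, x ∈ zeroSet g) :
    ∃ R ⊆ 𝓐, R.card ≤ 1872 * D ^ 2 ∧ ∑ x ∈ S, (crossPairs 𝓐 𝓑 x).card ≤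
      ∑ x ∈ S, (crossPairs R 𝓑 x).card + 312 * D * n ^ 2 + 7 * n * 𝓐.card := by
  obtain ⟨r, F, hF, hFd, hFz⟩ := exists_components hg
  have hFd := hFd.trans hdeg
  have hFj : ∀ j < r, (F j).totalDegree ≤ 12 * D := fun j hj =>
    (Finset.single_le_sum (f := fun j => (F j).totalDegree) (fun _ _ => Nat.zero_le _)
      (Finset.mem_range.2 hj)).trans hFd
  have hA := hB.mono hAB
  have hcross : ∀ l ∈ 𝓑, (S.filter fun x => x ∈ l ∧ CrossesComp r F x l).card ≤ 12 * D :=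
    fun l hl => (card_crossesComp_le (hB.isLine l hl) _
      fun x hx => (Finset.mem_filter.1 hx).2).trans hFd
  obtain ⟨rich, hrich⟩ : ∃ p : Pt → Set Pt → Prop, ∀ x l, p x l ↔ ¬ CrossesComp r F x l ∧
      3 ≤ (F (compIdx F {x})).totalDegree ∧
      ∃ l' ∈ 𝓑, x ∈ l' ∧ l ≠ l' ∧ ¬ CrossesComp r F x l' := ⟨_, fun _ _ => Iff.rfl⟩
  have hrich' : ∀ x ∈ S, ∀ l, x ∈ l → rich x l → compIdx F l < r ∧
      l ⊆ zeroSet (F (compIdx F l)) ∧ 3 ≤ (F (compIdx F l)).totalDegree ∧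
      ∃ l', IsLine l' ∧ x ∈ l' ∧ l' ⊆ zeroSet (F (compIdx F l)) ∧ l ≠ l' := by
    intro x hx l hxl h
    obtain ⟨h1, h2, l', hl', hxl', hne, h3⟩ := (hrich x l).1 h
    obtain ⟨a1, a2, a3⟩ := compIdx_of_not_crossesComp (hFz x (hSg x hx)) hxl h1
    obtain ⟨-, b2, -⟩ := compIdx_of_not_crossesComp (hFz x (hSg x hx)) hxl' h3
    rw [a3]
    exact ⟨a1, a2, h2, l', hB.isLine l' hl', hxl', b2, hne⟩
  set T : Set Pt → Finset Pt := fun l => S.filter fun x => x ∈ l ∧ rich x l with hT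
  have hTm : ∀ l, ∀ x ∈ T l, x ∈ S ∧ x ∈ l ∧ rich x l := fun l x hx => Finset.mem_filter.1 hx
  set R := 𝓐.filter fun l => 11 * (F (compIdx F l)).totalDegree < (T l).card with hR
  have hRT : ∀ l ∈ R, l ∈ 𝓐 ∧ 11 * (F (compIdx F l)).totalDegree < (T l).card ∧
      (T l).Nonempty := by
    intro l hl
    rw [hR, Finset.mem_filter] at hl
    exact ⟨hl.1, hl.2, Finset.card_pos.1 (by omega)⟩
  refine ⟨R, Finset.filter_subset _ _, ?_, ?_⟩
  · have h1 : R.card ≤ 13 * (12 * D) ^ 2 := by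
      refine card_le_of_components (F := F) R hFd (fun l hl => ?_) fun j hj => ?_
      · obtain ⟨-, -, x, hx⟩ := hRT l hl
        obtain ⟨a1, a2, a3⟩ := hTm l x hx
        exact (hrich' x a1 l a2 a3).1
      · rcases (R.filter fun l => compIdx F l = j).eq_empty_or_nonempty with h | ⟨l₀, hl₀⟩
        · rw [h]
          exact Nat.zero_le _
        · have hmem : ∀ l ∈ R.filter fun l => compIdx F l = j, l ∈ 𝓐 ∧ compIdx F l = j ∧
              11 * (F j).totalDegree < (T l).card ∧ (T l).Nonempty := by
            intro l hl
            rw [Finset.mem_filter] at hl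
            obtain ⟨h1, h2, h3⟩ := hRT l hl.1
            exact ⟨h1, hl.2, hl.2 ▸ h2, h3⟩
          refine card_crossing_lines_le (hF j hj) ?_ _ (fun l hl => hA.isLine l (hmem l hl).1) ?_ ?_
          · obtain ⟨-, h2, -, x, hx⟩ := hmem l₀ hl₀
            obtain ⟨a1, a2, a3⟩ := hTm l₀ x hx
            exact h2 ▸ (hrich' x a1 l₀ a2 a3).2.2.1
          · intro l hl
            obtain ⟨-, h2, -, x, hx⟩ := hmem l hl
            obtain ⟨a1, a2, a3⟩ := hTm l x hx
            exact h2 ▸ (hrich' x a1 l a2 a3).2.1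
          · intro l hl
            obtain ⟨-, h2, h3, -⟩ := hmem l hl
            refine ⟨T l, h3, fun x hx => ?_⟩
            obtain ⟨a1, a2, a3⟩ := hTm l x hx
            exact ⟨a2, h2 ▸ (hrich' x a1 l a2 a3).2.2.2⟩
    linarith [mul_pow 12 D 2]
  · obtain ⟨poor, hpoor⟩ : ∃ p : Pt → Set Pt → Prop, ∀ x l, p x l ↔ rich x l ∧ l ∉ R :=
      ⟨_, fun _ _ => Iff.rfl⟩
    obtain ⟨low, hlow⟩ : ∃ p : Pt → Set Pt × Set Pt → Prop, ∀ x y, p x y ↔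
        (¬ CrossesComp r F x y.1 ∧ ¬ CrossesComp r F x y.2) ∧
          (F (compIdx F {x})).totalDegree ≤ 2 := ⟨_, fun _ _ => Iff.rfl⟩
    have h1 := sum_card_crossPairs_snd_le (𝓑 := 𝓑) ha (CrossesComp r F) hcross
    have h2 := sum_card_crossPairs_fst_le hb (CrossesComp r F) fun l hl => hcross l (hAB hl)
    have h3 : ∑ x ∈ S, ((crossPairs 𝓐 𝓑 x).filter fun y => poor x y.1).card ≤
        2 * n ^ 2 * (132 * D) := by
      refine sum_card_crossPairs_fst_le hb poor fun l hl => ?_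
      by_cases h : l ∈ R
      · rw [Finset.card_eq_zero.2]
        · exact Nat.zero_le _
        · rw [Finset.filter_eq_empty_iff]
          exact fun x _ hx => ((hpoor x l).1 hx.2).2 h
      · have hTc : (T l).card ≤ 11 * (F (compIdx F l)).totalDegree := by
          by_contra! hc
          exact h (Finset.mem_filter.2 ⟨hl, hc⟩)
        refine (Finset.card_le_card (t := T l) fun x hx => ?_).trans ?_
        · rw [Finset.mem_filter] at hx
          exact Finset.mem_filter.2 ⟨hx.1, hx.2.1, ((hpoor x l).1 hx.2.2).1⟩
        · rcases (T l).eq_empty_or_nonempty with h0 | ⟨x, hx⟩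
          · rw [h0]
            exact Nat.zero_le _
          · obtain ⟨a1, a2, a3⟩ := hTm l x hx
            have := hFj _ (hrich' x a1 l a2 a3).1
            omega
    have h4 : ∑ x ∈ S, ((crossPairs 𝓐 𝓑 x).filter fun y => low x y).card ≤ 7 * n * 𝓐.card := by
      refine le_trans (sum_card_subset_crossPairs_le hA.isLine hB.isLine S _
        (fun x _ => Finset.filter_subset _ _) _ fun x hx y hy => ?_)
        (card_pairs_compIdx_le (𝓐 := 𝓐) hB hF)
      rw [Finset.mem_filter, mem_crossPairs, hlow] at hy
      obtain ⟨⟨⟨c1, c2⟩, ⟨c3, c4⟩, -⟩, ⟨c5, c6⟩, c7⟩ := hy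
      obtain ⟨a1, a2, a3⟩ := compIdx_of_not_crossesComp (hFz x (hSg x hx)) c2 c5
      obtain ⟨-, b2, -⟩ := compIdx_of_not_crossesComp (hFz x (hSg x hx)) c4 c6
      refine Finset.mem_filter.2 ⟨Finset.mem_product.2 ⟨c1, c3⟩, ?_⟩
      rw [a3]
      exact ⟨a1, c7, b2⟩
    have h5 : ∑ x ∈ S, (crossPairs 𝓐 𝓑 x).card ≤
        ∑ x ∈ S, (((crossPairs 𝓐 𝓑 x).filter fun y => CrossesComp r F x y.2).card +
          ((crossPairs 𝓐 𝓑 x).filter fun y => CrossesComp r F x y.1).card +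
          ((crossPairs 𝓐 𝓑 x).filter fun y => poor x y.1).card +
          ((crossPairs 𝓐 𝓑 x).filter fun y => low x y).card + (crossPairs R 𝓑 x).card) := by
      refine Finset.sum_le_sum fun x _ => ?_
      refine (Finset.card_le_card (t := (((((crossPairs 𝓐 𝓑 x).filter fun y =>
        CrossesComp r F x y.2) ∪ ((crossPairs 𝓐 𝓑 x).filter fun y => CrossesComp r F x y.1)) ∪
        ((crossPairs 𝓐 𝓑 x).filter fun y => poor x y.1)) ∪
        ((crossPairs 𝓐 𝓑 x).filter fun y => low x y)) ∪ crossPairs R 𝓑 x) fun y hy => ?_).trans ?_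
      · simp only [Finset.mem_union, Finset.mem_filter, hy, true_and]
        obtain ⟨c1, c2, c3⟩ := mem_crossPairs.1 hy
        by_cases g1 : CrossesComp r F x y.2
        · exact Or.inl (Or.inl (Or.inl (Or.inl g1)))
        by_cases g2 : CrossesComp r F x y.1
        · exact Or.inl (Or.inl (Or.inl (Or.inr g2)))
        by_cases g3 : (F (compIdx F {x})).totalDegree ≤ 2
        · exact Or.inl (Or.inr ((hlow x y).2 ⟨⟨g2, g1⟩, g3⟩))
        by_cases g4 : y.1 ∈ R
        · exact Or.inr (mem_crossPairs.2 ⟨⟨g4, c1.2⟩, c2, c3⟩)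
        · exact Or.inl (Or.inl (Or.inr ((hpoor x y.1).2
            ⟨(hrich x y.1).2 ⟨g2, by omega, y.2, c2.1, c2.2, c3, g1⟩, g4⟩)))
      · refine (Finset.card_union_le _ _).trans (Nat.add_le_add_right ?_ _)
        refine (Finset.card_union_le _ _).trans (Nat.add_le_add_right ?_ _)
        refine (Finset.card_union_le _ _).trans (Nat.add_le_add_right ?_ _)
        exact Finset.card_union_le _ _
    simp only [Finset.sum_add_distrib] at h5
    have h6 : 2 * (12 * D * 𝓑.card) ≤ 24 * D * n ^ 2 := by
      calc 2 * (12 * D * 𝓑.card) ≤ 2 * (12 * D * n ^ 2) :=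
            Nat.mul_le_mul_left _ (Nat.mul_le_mul_left _ hB.card_le)
        _ = _ := by ring
    linarith

/-- Crossings of a small subfamily of a well-spread family of lines with the whole family, at
points of low multiplicity. -/
theorem sum_crossPairs_le {n : ℕ} {𝓑 : Finset (Set Pt)} (hB : WellSpread n 𝓑) :
    ∀ (M : ℕ) {𝓐 : Finset (Set Pt)}, 𝓐.card = M → 𝓐 ⊆ 𝓑 → ∀ S : Finset Pt,
      (∀ x ∈ S, (linesAt 𝓐 x).card ≤ 2) → (∀ x ∈ S, (linesAt 𝓑 x).card * M ≤ 2 * n ^ 2) →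
      ((∑ x ∈ S, (crossPairs 𝓐 𝓑 x).card : ℕ) : ℝ) ≤ 300000 * n ^ 2 * √M := by
  intro M
  induction M using Nat.strong_induction_on with
  | _ M ih =>
  intro 𝓐 hM hAB S ha hb
  have hA := hB.mono hAB
  have hMn : M ≤ n ^ 2 := hM ▸ hA.card_le
  set σ : ℝ := √M with hσ
  have hσ0 : 0 ≤ σ := Real.sqrt_nonneg _
  have hσM : σ ^ 2 = M := Real.sq_sqrt (Nat.cast_nonneg _)
  have hσn : σ ≤ n := Real.sqrt_le_iff.2 ⟨Nat.cast_nonneg _, by exact_mod_cast hMn⟩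
  have hn2 : (0 : ℝ) ≤ (n : ℝ) ^ 2 := by positivity
  rcases lt_or_ge M 40000 with hsmall | hbig
  · have h1 : ∑ x ∈ S, (crossPairs 𝓐 𝓑 x).card ≤ M * n ^ 2 :=
      (sum_card_crossPairs_le hA.isLine hB.isLine S).trans
        (hM ▸ Nat.mul_le_mul_left _ hB.card_le)
    have h2 : ((∑ x ∈ S, (crossPairs 𝓐 𝓑 x).card : ℕ) : ℝ) ≤ M * n ^ 2 := by exact_mod_cast h1
    have h3 : σ ≤ 200 := by
      refine Real.sqrt_le_iff.2 ⟨by norm_num, ?_⟩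
      have : (M : ℝ) < 40000 := by exact_mod_cast hsmall
      linarith
    refine h2.trans ?_
    rw [← hσM]
    calc σ ^ 2 * (n : ℝ) ^ 2 = σ * (n ^ 2 * σ) := by ring
      _ ≤ 300000 * (n ^ 2 * σ) := by gcongr; linarith
      _ = _ := by ring
  obtain ⟨i, hD1, hD2⟩ := exists_pow_two_maximal (p := fun D => (200 * D) ^ 2 ≤ M) hbig (B := M)
    (fun m hm => by nlinarith)
  obtain ⟨g, c, hg, hgd, hcell, hline⟩ := exists_partition S (fun x => (crossPairs 𝓐 𝓑 x).card)
    (fun _ => Nat.cast_nonneg _) i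
  set D := 2 ^ i with hD
  have hD0 : 0 < D := by positivity
  have hD0' : (0 : ℝ) < D := by exact_mod_cast hD0
  have hDσ : 200 * (D : ℝ) ≤ σ := by
    refine Real.le_sqrt_of_sq_le ?_
    exact_mod_cast hD1
  have hDσ' : σ ≤ 400 * D := by
    refine Real.sqrt_le_iff.2 ⟨by positivity, ?_⟩
    have : M ≤ (400 * D) ^ 2 := by
      rw [not_le] at hD2
      calc M ≤ (200 * (2 * D)) ^ 2 := hD2.le
        _ = _ := by ring
    exact_mod_cast this
  set Sc := S.filter fun x => MvPolynomial.eval x g ≠ 0 with hSc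
  set Sz := S.filter fun x => ¬ MvPolynomial.eval x g ≠ 0 with hSz
  have hcs : ∑ x ∈ Sc, (crossPairs 𝓐 𝓑 x).card + ∑ x ∈ Sz, (crossPairs 𝓐 𝓑 x).card =
    ∑ x ∈ S, (crossPairs 𝓐 𝓑 x).card := Finset.sum_filter_add_sum_filter_not _ _ _
  obtain ⟨W, hW⟩ : ∃ W, ∑ x ∈ S, (crossPairs 𝓐 𝓑 x).card = W := ⟨_, rfl⟩
  rw [hW] at hcs ⊢
  rcases le_total W (2 * ∑ x ∈ Sz, (crossPairs 𝓐 𝓑 x).card) with hz | hz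
  · obtain ⟨R, hR, hRc, hcount⟩ := exists_crossing_lines_of_surface hB hAB (S := Sz) (D := D)
      (fun x hx => ha x (Finset.mem_filter.1 hx).1)
      (fun x hx => by rw [hM]; exact hb x (Finset.mem_filter.1 hx).1) hg hgd
      (fun x hx => mem_zeroSet.2 (not_not.1 (Finset.mem_filter.1 hx).2))
    have hRM : 16 * R.card ≤ M := by
      have : (200 * D) ^ 2 = 40000 * D ^ 2 := by ring
      omega
    have h1 := ih R.card (by omega) rfl (hR.trans hAB) Sz
      (fun x hx => (Finset.card_le_card (linesAt_mono hR x)).trans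
        (ha x (Finset.mem_filter.1 hx).1))
      (fun x hx => (Nat.mul_le_mul_left _ (by omega)).trans (hb x (Finset.mem_filter.1 hx).1))
    have h2 : √(R.card : ℝ) ≤ σ / 4 := by
      refine Real.sqrt_le_iff.2 ⟨by positivity, ?_⟩
      have : (16 : ℝ) * R.card ≤ M := by exact_mod_cast hRM
      rw [div_pow, hσM]
      linarith
    have h3 : (W : ℝ) ≤ 2 * ((∑ x ∈ Sz, (crossPairs R 𝓑 x).card : ℕ) + 312 * D * n ^ 2 +
        7 * n * M) := by
      rw [hM] at hcount
      exact_mod_cast hz.trans (Nat.mul_le_mul_left 2 hcount)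
    have h4 : (300000 : ℝ) * n ^ 2 * √(R.card : ℝ) ≤ 300000 * n ^ 2 * (σ / 4) := by gcongr
    have h5 : (D : ℝ) * n ^ 2 * 200 ≤ σ * n ^ 2 := by nlinarith
    have h6 : (n : ℝ) * M ≤ σ * n ^ 2 := by
      rw [← hσM]
      nlinarith [mul_nonneg (mul_nonneg hσ0 (Nat.cast_nonneg (α := ℝ) n)) (sub_nonneg.2 hσn)]
    nlinarith
  · have hWc : W ≤ 2 * ∑ x ∈ Sc, (crossPairs 𝓐 𝓑 x).card := by omega
    have hcl : ∀ l ∈ 𝓑, ((Sc.filter fun x => x ∈ l).image c).card ≤ 13 * D := by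
      intro l hl
      have := hline l (hB.isLine l hl) (Sc.filter fun x => x ∈ l) (fun x hx => by
        rw [Finset.mem_filter, hSc, Finset.mem_filter] at hx
        exact ⟨hx.2, hx.1.2⟩)
      exact this
    have hcN : ∀ s, D ^ 3 * ∑ x ∈ Sc with c x = s, (crossPairs 𝓐 𝓑 x).card ≤ W := by
      intro s
      have := hcell s
      rw [hSc, Finset.filter_filter, ← hW]
      exact_mod_cast this
    have h1 := sum_crossPairs_sq_mul_le_of_cells hA.isLine hB.isLine hD0
      (fun l hl => hcl l (hAB hl)) hcl hcN
    rw [hM] at h1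
    obtain ⟨V, hV⟩ : ∃ V, ∑ x ∈ Sc, (crossPairs 𝓐 𝓑 x).card = V := ⟨_, rfl⟩
    rw [hV] at h1 hWc
    rcases Nat.eq_zero_or_pos W with h0 | h0
    · rw [h0, Nat.cast_zero]
      positivity
    have h2 : W * (W * D) ≤ W * (676 * (M * n ^ 2)) :=
      calc W * (W * D) = W ^ 2 * D := by ring
        _ ≤ (2 * V) ^ 2 * D := by gcongr
        _ = 4 * (V ^ 2 * D) := by ring
        _ ≤ 4 * (169 * W * (M * n ^ 2)) := by
          refine Nat.mul_le_mul_left _ (h1.trans ?_)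
          exact Nat.mul_le_mul_left _ (Nat.mul_le_mul_left _ hB.card_le)
        _ = _ := by ring
    have h3 : (W : ℝ) * D ≤ 676 * (M * n ^ 2) := by
      exact_mod_cast Nat.le_of_mul_le_mul_left h2 h0
    refine le_of_mul_le_mul_right (h3.trans ?_) hD0'
    rw [← hσM]
    calc 676 * (σ ^ 2 * (n : ℝ) ^ 2) = 676 * (σ * n ^ 2) * σ := by ring
      _ ≤ 676 * (σ * n ^ 2) * (400 * D) := by gcongr
      _ = 270400 * (n ^ 2 * σ * D) := by ring
      _ ≤ 300000 * (n ^ 2 * σ * D) := by gcongr; norm_num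
      _ = _ := by ring

/-- The Elekes–Sharir line of the rigid motions taking `p` to `q`. -/
def motionLine (p q : EuclideanSpace ℝ (Fin 2)) : Set Pt :=
  lineThrough ![(p 0 + q 0) / 2, (p 1 + q 1) / 2, 0] ![-(q 1 - p 1) / 2, (q 0 - p 0) / 2, 1]

theorem mem_motionLine {p q : EuclideanSpace ℝ (Fin 2)} {z : Pt} : z ∈ motionLine p q ↔
    2 * z 0 = p 0 + q 0 - z 2 * (q 1 - p 1) ∧ 2 * z 1 = p 1 + q 1 + z 2 * (q 0 - p 0) := by
  constructor
  · rintro ⟨t, rfl⟩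
    simp only [Pi.add_apply, Pi.smul_apply, smul_eq_mul, Matrix.cons_val]
    constructor <;> ring
  · rintro ⟨h0, h1⟩
    refine ⟨z 2, ?_⟩
    ext i
    fin_cases i
    · simp only [Fin.zero_eta, Pi.add_apply, Pi.smul_apply, smul_eq_mul, Matrix.cons_val]
      linarith
    · simp only [Fin.mk_one, Pi.add_apply, Pi.smul_apply, smul_eq_mul, Matrix.cons_val]
      linarith
    · simp

theorem isLine_motionLine (p q : EuclideanSpace ℝ (Fin 2)) : IsLine (motionLine p q) := by
  refine ⟨_, _, fun h => ?_, rfl⟩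
  have := congrFun h 2
  simp at this

theorem euclidean_ext_two {p q : EuclideanSpace ℝ (Fin 2)} (h0 : p 0 = q 0) (h1 : p 1 = q 1) :
    p = q := by
  ext i
  fin_cases i
  · exact h0
  · exact h1

/-- A motion line through `z` starting from `p` has a determined endpoint. -/
theorem eq_of_mem_motionLine {p q q' : EuclideanSpace ℝ (Fin 2)} {z : Pt}
    (h : z ∈ motionLine p q) (h' : z ∈ motionLine p q') : q = q' := by
  rw [mem_motionLine] at h h'
  have hz : (1 + z 2 ^ 2) ≠ 0 := by positivity
  refine euclidean_ext_two (mul_left_cancel₀ hz ?_) (mul_left_cancel₀ hz ?_)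
  · linear_combination h'.1 - h.1 + z 2 * (h'.2 - h.2)
  · linear_combination h'.2 - h.2 - z 2 * (h'.1 - h.1)

theorem motionLine_injective {p q p' q' : EuclideanSpace ℝ (Fin 2)}
    (h : motionLine p q = motionLine p' q') : p = p' ∧ q = q' := by
  have h0 : (![(p 0 + q 0) / 2, (p 1 + q 1) / 2, 0] : Pt) ∈ motionLine p q :=
    mem_motionLine.2 (by simp only [Matrix.cons_val]; constructor <;> ring)
  have h1 : (![(p 0 + q 0 - (q 1 - p 1)) / 2, (p 1 + q 1 + (q 0 - p 0)) / 2, 1] : Pt) ∈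
      motionLine p q :=
    mem_motionLine.2 (by simp only [Matrix.cons_val]; constructor <;> ring)
  rw [h, mem_motionLine] at h0 h1
  simp only [Matrix.cons_val] at h0 h1
  obtain ⟨a, b⟩ := h0
  obtain ⟨c, d⟩ := h1
  refine ⟨euclidean_ext_two ?_ ?_, euclidean_ext_two ?_ ?_⟩ <;> linarith

/-- Congruent pairs of points with distinct displacement give crossing motion lines. -/
theorem motionLine_inter_nonempty {p q r s : EuclideanSpace ℝ (Fin 2)}
    (hd : dist p r = dist q s) (hne : p - r ≠ q - s) :
    (motionLine p q ∩ motionLine r s).Nonempty := by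
  rw [EuclideanSpace.dist_eq, EuclideanSpace.dist_eq, Real.sqrt_inj (by positivity) (by positivity)]
    at hd
  simp only [Fin.sum_univ_two, Real.dist_eq, sq_abs] at hd
  have hN : ((q 0 - s 0 - (p 0 - r 0)) ^ 2 + (q 1 - s 1 - (p 1 - r 1)) ^ 2) ≠ 0 := by
    intro h0
    refine hne (euclidean_ext_two ?_ ?_)
    · show p 0 - r 0 = q 0 - s 0
      nlinarith [sq_nonneg (q 0 - s 0 - (p 0 - r 0)), sq_nonneg (q 1 - s 1 - (p 1 - r 1))]
    · show p 1 - r 1 = q 1 - s 1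
      nlinarith [sq_nonneg (q 0 - s 0 - (p 0 - r 0)), sq_nonneg (q 1 - s 1 - (p 1 - r 1))]
  obtain ⟨t, ht⟩ : ∃ t : ℝ, t * ((q 0 - s 0 - (p 0 - r 0)) ^ 2 + (q 1 - s 1 - (p 1 - r 1)) ^ 2) =
      (p 0 - r 0 + (q 0 - s 0)) * (q 1 - s 1 - (p 1 - r 1)) -
        (p 1 - r 1 + (q 1 - s 1)) * (q 0 - s 0 - (p 0 - r 0)) := ⟨_, div_mul_cancel₀ _ hN⟩
  have e0 : (p 0 - r 0 + (q 0 - s 0)) - t * (q 1 - s 1 - (p 1 - r 1)) = 0 := by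
    refine (mul_eq_zero.1 ?_).resolve_right hN
    linear_combination (-(q 1 - s 1 - (p 1 - r 1))) * ht - (q 0 - s 0 - (p 0 - r 0)) * hd
  have e1 : (p 1 - r 1 + (q 1 - s 1)) + t * (q 0 - s 0 - (p 0 - r 0)) = 0 := by
    refine (mul_eq_zero.1 ?_).resolve_right hN
    linear_combination (q 0 - s 0 - (p 0 - r 0)) * ht - (q 1 - s 1 - (p 1 - r 1)) * hd
  refine ⟨![(p 0 + q 0 - t * (q 1 - p 1)) / 2, (p 1 + q 1 + t * (q 0 - p 0)) / 2, t],
    mem_motionLine.2 ?_, mem_motionLine.2 ?_⟩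
  · simp only [Matrix.cons_val]
    constructor <;> ring
  · simp only [Matrix.cons_val]
    constructor <;> linarith

/-- The vector field tangent to all motion lines starting from `p`. -/
def motionField (p : EuclideanSpace ℝ (Fin 2)) : Derivation ℝ Poly3 Poly3 :=
  (-(MvPolynomial.X 1 - MvPolynomial.C (p 1)) +
      MvPolynomial.X 2 * (MvPolynomial.X 0 - MvPolynomial.C (p 0)) : Poly3) •
    (MvPolynomial.pderiv 0 : Derivation ℝ Poly3 Poly3) +
  ((MvPolynomial.X 0 - MvPolynomial.C (p 0)) +
      MvPolynomial.X 2 * (MvPolynomial.X 1 - MvPolynomial.C (p 1)) : Poly3) •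
    (MvPolynomial.pderiv 1 : Derivation ℝ Poly3 Poly3) +
  (1 + MvPolynomial.X 2 ^ 2 : Poly3) • (MvPolynomial.pderiv 2 : Derivation ℝ Poly3 Poly3)

/-- The vector field `t w + J w`, where `J` is the rotation by a right angle. -/
def twistField (a b : ℝ) : Derivation ℝ Poly3 Poly3 :=
  (MvPolynomial.X 2 * MvPolynomial.C a - MvPolynomial.C b : Poly3) •
    (MvPolynomial.pderiv 0 : Derivation ℝ Poly3 Poly3) +
  (MvPolynomial.X 2 * MvPolynomial.C b + MvPolynomial.C a : Poly3) •
    (MvPolynomial.pderiv 1 : Derivation ℝ Poly3 Poly3)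

theorem motionField_sub (p q : EuclideanSpace ℝ (Fin 2)) (f : Poly3) :
    motionField q f - motionField p f = twistField (p 0 - q 0) (p 1 - q 1) f := by
  simp only [motionField, twistField, Derivation.add_apply, Derivation.smul_apply, smul_eq_mul,
    map_sub]
  ring

theorem commutator_motionField_twistField (p : EuclideanSpace ℝ (Fin 2)) (a b : ℝ) :
    ⁅motionField p, twistField a b⁆ = (-2 : ℝ) • twistField (-b) a := by
  have h2 : (MvPolynomial.C (2 : ℝ) : Poly3) = 2 := map_ofNat _ 2
  refine MvPolynomial.derivation_ext fun i => ?_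
  fin_cases i <;>
  · simp [Derivation.commutator_apply, motionField, twistField, MvPolynomial.pderiv_X,
      MvPolynomial.smul_eq_C_mul, h2]
    try ring

theorem dvd_derivation {f g : Poly3} (V : Derivation ℝ Poly3 Poly3) (hf : f ∣ V f) (hg : f ∣ g) :
    f ∣ V g := by
  obtain ⟨h, rfl⟩ := hg
  rw [Derivation.leibniz]
  exact dvd_add (dvd_mul_right _ _) (by rw [smul_eq_mul]; exact hf.mul_left _)

theorem eval_motionField_eq_zero {p q : EuclideanSpace ℝ (Fin 2)} {f : Poly3}
    (h : motionLine p q ⊆ zeroSet f) {z : Pt} (hz : z ∈ motionLine p q) :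
    MvPolynomial.eval z (motionField p f) = 0 := by
  have hl : motionLine p q = lineThrough z ![-(q 1 - p 1) / 2, (q 0 - p 0) / 2, 1] :=
    lineThrough_eq_of_mem hz
  have h1 := sum_mul_pderiv_eq_zero (hl ▸ h)
  obtain ⟨h2, h3⟩ := mem_motionLine.1 hz
  rw [Fin.sum_univ_three] at h1
  simp only [Matrix.cons_val] at h1
  simp only [motionField, Derivation.add_apply, Derivation.smul_apply, smul_eq_mul, map_add,
    map_mul, map_neg, map_sub, map_pow, map_one, MvPolynomial.eval_X, MvPolynomial.eval_C]
  linear_combination (1 + z 2 ^ 2) * h1 +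
    MvPolynomial.eval z (MvPolynomial.pderiv 0 f) * (z 2 * h2 - h3) / 2 +
    MvPolynomial.eval z (MvPolynomial.pderiv 1 f) * (h2 + z 2 * h3) / 2

theorem totalDegree_motionField_le (p : EuclideanSpace ℝ (Fin 2)) {f : Poly3}
    (hf : f.totalDegree ≤ 2) : (motionField p f).totalDegree ≤ 3 := by
  have hd : ∀ i, (MvPolynomial.pderiv i f).totalDegree ≤ 1 := fun i =>
    (totalDegree_pderiv_le_sub_one f i).trans (by omega)
  have hX : ∀ i, (MvPolynomial.X i : Poly3).totalDegree ≤ 1 := fun i =>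
    (MvPolynomial.totalDegree_X i).le
  have hXC : ∀ i (c : ℝ), (MvPolynomial.X i - MvPolynomial.C c : Poly3).totalDegree ≤ 1 :=
    fun i c => (MvPolynomial.totalDegree_sub_C_le _ _).trans (hX i)
  simp only [motionField, Derivation.add_apply, Derivation.smul_apply, smul_eq_mul]
  refine totalDegree_add_le_of (totalDegree_add_le_of ?_ ?_) ?_
  · refine (totalDegree_mul_le_of (m := 2) (totalDegree_add_le_of ?_ ?_) (hd 0))
    · rw [MvPolynomial.totalDegree_neg]
      exact (hXC 1 _).trans one_le_two
    · exact totalDegree_mul_le_of (hX 2) (hXC 0 _)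
  · refine (totalDegree_mul_le_of (m := 2) (totalDegree_add_le_of ?_ ?_) (hd 1))
    · exact (hXC 0 _).trans one_le_two
    · exact totalDegree_mul_le_of (hX 2) (hXC 1 _)
  · refine (totalDegree_mul_le_of (m := 2) (totalDegree_add_le_of ?_ ?_) (hd 2))
    · simp
    · rw [pow_two]
      exact totalDegree_mul_le_of (hX 2) (hX 2)

/-- A quadric containing many motion lines from `p` is invariant under the field of `p`. -/
theorem dvd_motionField {f : Poly3} (hf : Irreducible f) (hd : f.totalDegree ≤ 2)
    (p : EuclideanSpace ℝ (Fin 2)) (Q : Finset (EuclideanSpace ℝ (Fin 2)))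
    (hQ : ∀ q ∈ Q, motionLine p q ⊆ zeroSet f) (hc : 6 < Q.card) : f ∣ motionField p f := by
  by_contra hdvd
  have hcard : (Q.image (motionLine p)).card = Q.card :=
    Finset.card_image_of_injective _ fun q q' h => (motionLine_injective h).2
  obtain ⟨l, hl, x, hx, hx'⟩ := exists_line_not_subset hf hdvd (Q.image (motionLine p))
    (fun l hl => by
      obtain ⟨q, -, rfl⟩ := Finset.mem_image.1 hl
      exact isLine_motionLine p q)
    (fun l hl => by
      obtain ⟨q, hq, rfl⟩ := Finset.mem_image.1 hl
      exact hQ q hq)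
    (by
      rw [hcard]
      exact (Nat.mul_le_mul hd (totalDegree_motionField_le p hd)).trans_lt hc)
  obtain ⟨q, hq, rfl⟩ := Finset.mem_image.1 hl
  exact hx' (eval_motionField_eq_zero (hQ q hq) hx)

theorem dvd_twistField_rotate {f : Poly3} {p : EuclideanSpace ℝ (Fin 2)} {a b : ℝ}
    (h : f ∣ motionField p f) (h' : f ∣ twistField a b f) : f ∣ twistField (-b) a f := by
  have h1 : f ∣ ⁅motionField p, twistField a b⁆ f := by
    rw [Derivation.commutator_apply]
    exact dvd_sub (dvd_derivation _ h h') (dvd_derivation _ h' h)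
  rw [commutator_motionField_twistField, Derivation.smul_apply] at h1
  have h2 : twistField (-b) a f = (-2 : ℝ)⁻¹ • ((-2 : ℝ) • twistField (-b) a f) := by
    rw [smul_smul, inv_mul_cancel₀ (by norm_num), one_smul]
  rw [h2, MvPolynomial.smul_eq_C_mul]
  exact h1.mul_left _

theorem dvd_of_dvd_mul_of_eval_ne_zero {f g h : Poly3} (hf : Irreducible f) (hd : f ∣ g * h)
    {z : Pt} (hz : MvPolynomial.eval z f = 0) (hg : MvPolynomial.eval z g ≠ 0) : f ∣ h := by
  refine (hf.prime.dvd_or_dvd hd).resolve_left ?_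
  rintro ⟨k, rfl⟩
  simp [hz] at hg

/-- An irreducible surface with a real point cannot be invariant under the fields of two distinct
points. -/
theorem eq_of_dvd_motionField {f : Poly3} (hf : Irreducible f) {z : Pt}
    (hz : MvPolynomial.eval z f = 0) {p q : EuclideanSpace ℝ (Fin 2)}
    (hp : f ∣ motionField p f) (hq : f ∣ motionField q f) : p = q := by
  by_contra hpq
  obtain ⟨a, ha⟩ : ∃ a, a = p 0 - q 0 := ⟨_, rfl⟩
  obtain ⟨b, hb⟩ : ∃ b, b = p 1 - q 1 := ⟨_, rfl⟩
  have hab : a ^ 2 + b ^ 2 ≠ 0 := by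
    intro h
    refine hpq (euclidean_ext_two ?_ ?_)
    · nlinarith [sq_nonneg a, sq_nonneg b]
    · nlinarith [sq_nonneg a, sq_nonneg b]
  have hU : f ∣ twistField a b f := by
    rw [ha, hb, ← motionField_sub]
    exact dvd_sub hq hp
  have hU' := dvd_twistField_rotate hp hU
  have hz2 : 1 + z 2 ^ 2 ≠ 0 := by positivity
  have hne : MvPolynomial.eval z (MvPolynomial.C (a ^ 2 + b ^ 2) * (1 + MvPolynomial.X 2 ^ 2) :
      Poly3) ≠ 0 := by
    simpa using ⟨by simpa using hab, hz2⟩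
  have h0 : f ∣ MvPolynomial.pderiv 0 f := by
    refine dvd_of_dvd_mul_of_eval_ne_zero hf ?_ hz hne
    have := dvd_sub (hU.mul_left (MvPolynomial.X 2 * MvPolynomial.C a - MvPolynomial.C b))
      (hU'.mul_left (MvPolynomial.X 2 * MvPolynomial.C b + MvPolynomial.C a))
    convert this using 1
    simp only [twistField, Derivation.add_apply, Derivation.smul_apply, smul_eq_mul, map_add,
      map_neg, map_pow]
    ring
  have h1 : f ∣ MvPolynomial.pderiv 1 f := by
    refine dvd_of_dvd_mul_of_eval_ne_zero hf ?_ hz hne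
    have := dvd_add (hU.mul_left (MvPolynomial.X 2 * MvPolynomial.C b + MvPolynomial.C a))
      (hU'.mul_left (MvPolynomial.X 2 * MvPolynomial.C a - MvPolynomial.C b))
    convert this using 1
    simp only [twistField, Derivation.add_apply, Derivation.smul_apply, smul_eq_mul, map_add,
      map_neg, map_pow]
    ring
  have h2 : f ∣ MvPolynomial.pderiv 2 f := by
    refine dvd_of_dvd_mul_of_eval_ne_zero (g := 1 + MvPolynomial.X 2 ^ 2) hf ?_ hz (by simpa)
    simp only [motionField, Derivation.add_apply, Derivation.smul_apply, smul_eq_mul] at hp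
    exact (dvd_add_right (dvd_add (h0.mul_left _) (h1.mul_left _))).1 hp
  obtain ⟨k, hk⟩ := exists_not_dvd_pderiv hf
  fin_cases k
  · exact hk h0
  · exact hk h1
  · exact hk h2

/-- The motion lines of all pairs of points of `P`. -/
def motionLines (P : Finset (EuclideanSpace ℝ (Fin 2))) : Finset (Set Pt) :=
  (P ×ˢ P).image fun y => motionLine y.1 y.2

theorem mem_motionLines {P : Finset (EuclideanSpace ℝ (Fin 2))} {l : Set Pt} :
    l ∈ motionLines P ↔ ∃ p ∈ P, ∃ q ∈ P, motionLine p q = l := by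
  simp only [motionLines, Finset.mem_image, Finset.mem_product, Prod.exists]
  constructor
  · rintro ⟨p, q, ⟨hp, hq⟩, h⟩
    exact ⟨p, hp, q, hq, h⟩
  · rintro ⟨p, hp, q, hq, h⟩
    exact ⟨p, q, ⟨hp, hq⟩, h⟩

theorem card_filter_motionLine_le {P : Finset (EuclideanSpace ℝ (Fin 2))} {f : Poly3}
    (hf : Irreducible f) (hd : f.totalDegree ≤ 2) :
    ∑ p ∈ P, (P.filter fun q => motionLine p q ⊆ zeroSet f).card ≤ 7 * P.card := by
  by_cases h : ∃ p ∈ P, 6 < (P.filter fun q => motionLine p q ⊆ zeroSet f).card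
  · obtain ⟨p, hp, hc⟩ := h
    have hdvd := dvd_motionField hf hd p _ (fun q hq => (Finset.mem_filter.1 hq).2) hc
    obtain ⟨q, hq⟩ := Finset.card_pos.1 (Nat.zero_lt_of_lt hc)
    obtain ⟨z, hz⟩ := (isLine_motionLine p q).infinite.nonempty
    have hz0 := (Finset.mem_filter.1 hq).2 hz
    have hother : ∀ r ∈ P.erase p, (P.filter fun q => motionLine r q ⊆ zeroSet f).card ≤ 6 := by
      intro r hr
      by_contra hlt
      refine Finset.ne_of_mem_erase hr (eq_of_dvd_motionField hf hz0 ?_ hdvd)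
      exact dvd_motionField hf hd r _ (fun q hq => (Finset.mem_filter.1 hq).2)
        (not_le.1 hlt)
    rw [← Finset.add_sum_erase _ _ hp]
    have h1 := Finset.sum_le_card_nsmul _ _ _ hother
    have h2 := Finset.card_filter_le P fun q => motionLine p q ⊆ zeroSet f
    have h3 := Finset.card_erase_le (s := P) (a := p)
    rw [smul_eq_mul] at h1
    omega
  · push Not at h
    have h1 := Finset.sum_le_card_nsmul _ _ _ h
    rw [smul_eq_mul] at h1
    omega

theorem wellSpread_motionLines (P : Finset (EuclideanSpace ℝ (Fin 2))) :
    WellSpread P.card (motionLines P) where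
  isLine l hl := by
    obtain ⟨p, -, q, -, rfl⟩ := mem_motionLines.1 hl
    exact isLine_motionLine p q
  card_le := Finset.card_image_le.trans (by rw [Finset.card_product, pow_two])
  card_linesAt_le x := by
    have h : ∀ l ∈ linesAt (motionLines P) x, ∃ p ∈ P, ∃ q, x ∈ l ∧ motionLine p q = l := by
      intro l hl
      obtain ⟨hl, hx⟩ := mem_linesAt.1 hl
      obtain ⟨p, hp, q, -, h⟩ := mem_motionLines.1 hl
      exact ⟨p, hp, q, hx, h⟩
    choose! p hp q hx hq using h
    refine Finset.card_le_card_of_injOn p hp fun l hl l' hl' heq => ?_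
    have h1 := hx l hl
    have h2 := hx l' hl'
    rw [← hq l hl] at h1
    rw [← hq l' hl', ← heq] at h2
    rw [← hq l hl, ← hq l' hl', ← heq, eq_of_mem_motionLine h1 h2]
  card_quadric_le f hf hd := by
    refine le_trans ?_ (card_filter_motionLine_le hf hd)
    rw [← Finset.card_sigma]
    refine Finset.card_le_card_of_surjOn (fun y => motionLine y.1 y.2) ?_
    intro l hl
    obtain ⟨hl, hlf⟩ := Finset.mem_filter.1 hl
    obtain ⟨p, hp, q, hq, rfl⟩ := mem_motionLines.1 hl
    exact ⟨⟨p, q⟩, by simp [hp, hq, hlf], rfl⟩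

/-! ### Counting crossings and hinges -/

theorem sq_le_sum_layers {m N : ℕ} (h : m ≤ N) :
    (m : ℝ) ^ 2 ≤ ∑ k ∈ Finset.Icc 1 N, if k ≤ m then 2 * (k : ℝ) else 0 := by
  rw [← Finset.sum_filter]
  have hset : (Finset.Icc 1 N).filter (fun k => k ≤ m) = Finset.Icc 1 m := by
    ext k
    simp only [Finset.mem_filter, Finset.mem_Icc]
    omega
  rw [hset]
  clear hset h
  induction m with
  | zero => simp
  | succ m ih =>
    rw [Finset.sum_Icc_succ_top (by omega)]
    push_cast
    nlinarith

/-- A weight with quadratically decaying level sets has sum of squares bounded up to a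
logarithm. -/
theorem sum_sq_le_of_layers {α : Type*} (S : Finset α) (m : α → ℕ) {N : ℕ} {B : ℝ}
    (hB : 0 ≤ B) (hN : ∀ x ∈ S, m x ≤ N)
    (h : ∀ k : ℕ, 1 ≤ k → ((S.filter fun x => k ≤ m x).card : ℝ) * k ^ 2 ≤ B) :
    ∑ x ∈ S, (m x : ℝ) ^ 2 ≤ 2 * B * (1 + Real.log N) := by
  have h1 : ∑ x ∈ S, (m x : ℝ) ^ 2 ≤
      ∑ k ∈ Finset.Icc 1 N, 2 * B * (k : ℝ)⁻¹ := by
    refine (Finset.sum_le_sum fun x hx => sq_le_sum_layers (hN x hx)).trans ?_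
    rw [Finset.sum_comm]
    refine Finset.sum_le_sum fun k hk => ?_
    have hk1 := (Finset.mem_Icc.1 hk).1
    have hk0 : (0 : ℝ) < k := by exact_mod_cast hk1
    rw [← Finset.sum_filter, Finset.sum_const, nsmul_eq_mul, ← div_eq_mul_inv, le_div_iff₀ hk0]
    have := h k hk1
    nlinarith
  refine h1.trans ?_
  rw [← Finset.mul_sum]
  have h2 := harmonic_le_one_add_log N
  rw [harmonic_eq_sum_Icc] at h2
  push_cast at h2
  exact mul_le_mul_of_nonneg_left h2 (by positivity)

theorem sum_card_linesAt_sq_le {n : ℕ} {𝓐 : Finset (Set Pt)} (hA : WellSpread n 𝓐)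
    (S : Finset Pt) (hS : ∀ x ∈ S, 3 ≤ (linesAt 𝓐 x).card) :
    ∑ x ∈ S, ((linesAt 𝓐 x).card : ℝ) ^ 2 ≤
      2 * (2 ^ 21 * 𝓐.card * n) * (1 + Real.log n) := by
  refine sum_sq_le_of_layers S (fun x => (linesAt 𝓐 x).card) (by positivity)
    (fun x _ => hA.card_linesAt_le x) fun k _ => ?_
  have h := card_rich_points_mul_sq_le 𝓐.card rfl hA (k := max k 3) (le_max_right _ _)
    (S.filter fun x => k ≤ (linesAt 𝓐 x).card) fun x hx =>
      max_le (Finset.mem_filter.1 hx).2 (hS x (Finset.mem_filter.1 hx).1)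
  have h' := (Nat.mul_le_mul_left (S.filter fun x => k ≤ (linesAt 𝓐 x).card).card
    (Nat.pow_le_pow_left (le_max_left k 3) 2)).trans h
  exact_mod_cast h'

theorem card_crossPairs_le (𝓐 𝓑 : Finset (Set Pt)) (x : Pt) :
    (crossPairs 𝓐 𝓑 x).card ≤ (linesAt 𝓐 x).card * (linesAt 𝓑 x).card :=
  (Finset.card_filter_le _ _).trans (Finset.card_product _ _).le

/-- The total number of crossings of the lines of `𝓐` with lines of `𝓑`. -/
theorem sum_card_crossPairs_le_sqrt {n : ℕ} {𝓐 𝓑 : Finset (Set Pt)} (hB : WellSpread n 𝓑)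
    (hAB : 𝓐 ⊆ 𝓑) (hA : 𝓐.Nonempty) (S : Finset Pt) :
    ((∑ x ∈ S, (crossPairs 𝓐 𝓑 x).card : ℕ) : ℝ) ≤
      (300000 + 2 ^ 23) * n ^ 2 * √𝓐.card * (1 + Real.log n) := by
  obtain ⟨M, hM⟩ : ∃ M, M = 𝓐.card := ⟨_, rfl⟩
  have hM0 : 0 < M := hM ▸ hA.card_pos
  have hMn : M ≤ n ^ 2 := hM ▸ (Finset.card_le_card hAB).trans hB.card_le
  have hn0 : 0 < n := by
    rcases Nat.eq_zero_or_pos n with rfl | h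
    · omega
    · exact h
  have hlog : 0 ≤ Real.log n := Real.log_natCast_nonneg n
  have hs0 : 0 < √(M : ℝ) := Real.sqrt_pos.2 (by exact_mod_cast hM0)
  have hss : √(M : ℝ) * √(M : ℝ) = M := Real.mul_self_sqrt (Nat.cast_nonneg M)
  have hsn : √(M : ℝ) ≤ n := Real.sqrt_le_iff.2 ⟨Nat.cast_nonneg n, by exact_mod_cast hMn⟩
  have hn0' : (0 : ℝ) < n := by exact_mod_cast hn0
  rw [← hM]
  obtain ⟨s, hs⟩ : ∃ s, s = √(M : ℝ) := ⟨_, rfl⟩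
  obtain ⟨a, ha⟩ : ∃ a : Pt → ℕ, ∀ x, a x = (linesAt 𝓐 x).card := ⟨_, fun _ => rfl⟩
  obtain ⟨b, hb⟩ : ∃ b : Pt → ℕ, ∀ x, b x = (linesAt 𝓑 x).card := ⟨_, fun _ => rfl⟩
  obtain ⟨w, hw⟩ : ∃ w : Pt → ℕ, ∀ x, w x = (crossPairs 𝓐 𝓑 x).card := ⟨_, fun _ => rfl⟩
  have hab : ∀ x, a x ≤ b x := fun x => by
    rw [ha, hb]
    exact Finset.card_le_card (linesAt_mono hAB x)
  have hwab : ∀ x, (w x : ℝ) ≤ a x * b x := fun x => by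
    rw [hw, ha, hb]
    exact_mod_cast card_crossPairs_le 𝓐 𝓑 x
  rw [← hs] at hs0 hss hsn ⊢
  simp only [← hw]
  obtain ⟨P₁, hP₁⟩ : ∃ p : Pt → Prop, ∀ x, p x ↔ a x ≤ 2 ∧ b x * M ≤ 2 * n ^ 2 :=
    ⟨_, fun _ => Iff.rfl⟩
  obtain ⟨P₂, hP₂⟩ : ∃ p : Pt → Prop, ∀ x, p x ↔ 3 ≤ b x ∧ (a x : ℝ) * n ≤ b x * s :=
    ⟨_, fun _ => Iff.rfl⟩
  obtain ⟨P₃, hP₃⟩ : ∃ p : Pt → Prop, ∀ x, p x ↔ 3 ≤ a x ∧ (b x : ℝ) * s ≤ a x * n :=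
    ⟨_, fun _ => Iff.rfl⟩
  have hcover : ∀ x, P₁ x ∨ P₂ x ∨ P₃ x := by
    intro x
    rw [hP₁, hP₂, hP₃]
    by_cases h1 : a x ≤ 2 ∧ b x * M ≤ 2 * n ^ 2
    · exact Or.inl h1
    right
    have hx := hab x
    rcases le_total ((a x : ℝ) * n) (b x * s) with h | h
    · refine Or.inl ⟨?_, h⟩
      by_contra hb3
      refine h1 ⟨by omega, ?_⟩
      exact Nat.mul_le_mul (by omega) hMn
    · refine Or.inr ⟨?_, h⟩
      by_contra ha3
      refine h1 ⟨by omega, ?_⟩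
      have ha2 : (a x : ℝ) ≤ 2 := by exact_mod_cast (by omega : a x ≤ 2)
      have h2 : (b x : ℝ) * M ≤ 2 * n ^ 2 := by
        calc (b x : ℝ) * M = b x * s * s := by rw [mul_assoc, hss]
          _ ≤ 2 * n * n := by
            refine mul_le_mul (h.trans ?_) hsn hs0.le (by positivity)
            exact mul_le_mul_of_nonneg_right ha2 hn0'.le
          _ = 2 * n ^ 2 := by ring
      exact_mod_cast h2
  have hsub : S ⊆ S.filter P₁ ∪ (S.filter P₂ ∪ S.filter P₃) := by
    intro x hx
    simp only [Finset.mem_union, Finset.mem_filter]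
    exact (hcover x).imp (⟨hx, ·⟩) (Or.imp (⟨hx, ·⟩) (⟨hx, ·⟩))
  have hsum : ((∑ x ∈ S, w x : ℕ) : ℝ) ≤ ((∑ x ∈ S.filter P₁, w x : ℕ) : ℝ) +
      (∑ x ∈ S.filter P₂, (w x : ℝ) + ∑ x ∈ S.filter P₃, (w x : ℝ)) := by
    have h0 : ∑ x ∈ S, w x ≤
        ∑ x ∈ S.filter P₁, w x + (∑ x ∈ S.filter P₂, w x + ∑ x ∈ S.filter P₃, w x) := by
      refine (Finset.sum_le_sum_of_subset hsub).trans ?_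
      refine (le_of_le_of_eq (Nat.le_add_right _ _) Finset.sum_union_inter).trans ?_
      exact Nat.add_le_add_left
        (le_of_le_of_eq (Nat.le_add_right _ _) Finset.sum_union_inter) _
    exact_mod_cast h0
  have h1 : ((∑ x ∈ S.filter P₁, w x : ℕ) : ℝ) ≤ 300000 * n ^ 2 * s := by
    have := sum_crossPairs_le hB M hM.symm hAB (S.filter P₁)
      (fun x hx => by
        rw [← ha]
        exact ((hP₁ x).1 (Finset.mem_filter.1 hx).2).1)
      (fun x hx => by
        rw [← hb]
        exact ((hP₁ x).1 (Finset.mem_filter.1 hx).2).2)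
    simpa only [← hw, ← hs] using this
  have h2 : ∑ x ∈ S.filter P₂, (w x : ℝ) ≤ 2 ^ 22 * n ^ 2 * s * (1 + Real.log n) := by
    have hx : ∀ x ∈ S.filter P₂, (w x : ℝ) ≤ s / n * (b x : ℝ) ^ 2 := by
      intro x hx
      have h := ((hP₂ x).1 (Finset.mem_filter.1 hx).2).2
      refine (hwab x).trans ?_
      have : (a x : ℝ) ≤ b x * s / n := (le_div_iff₀ hn0').2 h
      calc (a x : ℝ) * b x ≤ b x * s / n * b x :=
            mul_le_mul_of_nonneg_right this (Nat.cast_nonneg _)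
        _ = s / n * (b x : ℝ) ^ 2 := by ring
    refine (Finset.sum_le_sum hx).trans ?_
    rw [← Finset.mul_sum]
    have h := sum_card_linesAt_sq_le hB (S.filter P₂) fun x hx => by
      rw [← hb]
      exact ((hP₂ x).1 (Finset.mem_filter.1 hx).2).1
    simp only [← hb] at h
    have hBn : (𝓑.card : ℝ) ≤ n ^ 2 := by exact_mod_cast hB.card_le
    generalize (𝓑.card : ℝ) = β at h hBn
    calc s / n * ∑ x ∈ S.filter P₂, (b x : ℝ) ^ 2
        ≤ s / n * (2 * (2 ^ 21 * (n : ℝ) ^ 2 * n) * (1 + Real.log n)) := by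
          refine mul_le_mul_of_nonneg_left (h.trans ?_) (by positivity)
          gcongr
      _ = 2 ^ 22 * n ^ 2 * s * (1 + Real.log n) := by
          field_simp
  have h3 : ∑ x ∈ S.filter P₃, (w x : ℝ) ≤ 2 ^ 22 * n ^ 2 * s * (1 + Real.log n) := by
    have hx : ∀ x ∈ S.filter P₃, (w x : ℝ) ≤ n / s * (a x : ℝ) ^ 2 := by
      intro x hx
      have h := ((hP₃ x).1 (Finset.mem_filter.1 hx).2).2
      refine (hwab x).trans ?_
      have : (b x : ℝ) ≤ a x * n / s := (le_div_iff₀ hs0).2 h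
      calc (a x : ℝ) * b x ≤ a x * (a x * n / s) :=
            mul_le_mul_of_nonneg_left this (Nat.cast_nonneg _)
        _ = n / s * (a x : ℝ) ^ 2 := by ring
    refine (Finset.sum_le_sum hx).trans ?_
    rw [← Finset.mul_sum]
    have h := sum_card_linesAt_sq_le (hB.mono hAB) (S.filter P₃) fun x hx => by
      rw [← ha]
      exact ((hP₃ x).1 (Finset.mem_filter.1 hx).2).1
    simp only [← ha, ← hM, ← hss] at h
    calc n / s * ∑ x ∈ S.filter P₃, (a x : ℝ) ^ 2
        ≤ n / s * (2 * (2 ^ 21 * (s * s) * n) * (1 + Real.log n)) :=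
          mul_le_mul_of_nonneg_left h (by positivity)
      _ = 2 ^ 22 * n ^ 2 * s * (1 + Real.log n) := by
          field_simp
  have h4 : 300000 * (n : ℝ) ^ 2 * s ≤ 300000 * n ^ 2 * s * (1 + Real.log n) :=
    le_mul_of_one_le_right (by positivity) (by linarith)
  calc ((∑ x ∈ S, w x : ℕ) : ℝ) ≤ 300000 * n ^ 2 * s * (1 + Real.log n) +
        (2 ^ 22 * n ^ 2 * s * (1 + Real.log n) + 2 ^ 22 * n ^ 2 * s * (1 + Real.log n)) := by
        linarith
    _ = _ := by ring

/-- The lines of `𝓑` crossing the line `l`. -/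
def crossing (𝓑 : Finset (Set Pt)) (l : Set Pt) : Finset (Set Pt) :=
  𝓑.filter fun l' => l ≠ l' ∧ (l ∩ l').Nonempty

theorem mem_crossing {𝓑 : Finset (Set Pt)} {l l' : Set Pt} :
    l' ∈ crossing 𝓑 l ↔ l' ∈ 𝓑 ∧ l ≠ l' ∧ (l ∩ l').Nonempty := Finset.mem_filter

theorem exists_sum_card_crossing_le (𝓐 𝓑 : Finset (Set Pt)) :
    ∃ S : Finset Pt, ∑ l ∈ 𝓐, (crossing 𝓑 l).card ≤ ∑ x ∈ S, (crossPairs 𝓐 𝓑 x).card := by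
  have hex : ∀ l l' : Set Pt, ∃ x : Pt, (l ∩ l').Nonempty → x ∈ l ∩ l' := by
    intro l l'
    by_cases h : (l ∩ l').Nonempty
    · exact ⟨h.some, fun _ => h.some_mem⟩
    · exact ⟨0, fun h' => absurd h' h⟩
  choose c hc using hex
  refine ⟨(𝓐 ×ˢ 𝓑).image fun y => c y.1 y.2, ?_⟩
  rw [← Finset.card_sigma, ← Finset.card_sigma]
  refine Finset.card_le_card_of_injOn (fun y => ⟨c y.1 y.2, y.1, y.2⟩) ?_ ?_
  · rintro ⟨l, l'⟩ h
    simp only [Finset.coe_sigma, Set.mem_sigma_iff, Finset.mem_coe, mem_crossing] at h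
    obtain ⟨hl, hl', hne, hx⟩ := h
    have := hc l l' hx
    simp only [Finset.coe_sigma, Set.mem_sigma_iff, Finset.mem_coe, mem_crossPairs]
    exact ⟨Finset.mem_image.2 ⟨(l, l'), Finset.mem_product.2 ⟨hl, hl'⟩, rfl⟩,
      ⟨hl, this.1⟩, ⟨hl', this.2⟩, hne⟩
  · rintro ⟨l, l'⟩ - ⟨m, m'⟩ - h
    simp only [Sigma.mk.injEq, heq_eq_eq, Prod.mk.injEq] at h
    obtain ⟨-, rfl, rfl⟩ := h
    rfl

theorem sum_card_crossing_sq_le {n : ℕ} {𝓑 : Finset (Set Pt)} (hB : WellSpread n 𝓑) :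
    ∑ l ∈ 𝓑, ((crossing 𝓑 l).card : ℝ) ^ 2 ≤
      4 * (300000 + 2 ^ 23) ^ 2 * n ^ 4 * (1 + Real.log n) ^ 3 := by
  have hlog : 0 ≤ Real.log n := Real.log_natCast_nonneg n
  have h := sum_sq_le_of_layers 𝓑 (fun l => (crossing 𝓑 l).card) (N := n ^ 2)
    (B := ((300000 + 2 ^ 23) * n ^ 2 * (1 + Real.log n)) ^ 2) (by positivity)
    (fun l _ => (Finset.card_filter_le _ _).trans hB.card_le) ?_
  · refine h.trans ?_
    push_cast
    rw [Real.log_pow]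
    calc 2 * ((300000 + 2 ^ 23) * (n : ℝ) ^ 2 * (1 + Real.log n)) ^ 2 *
          (1 + ((2 : ℕ) : ℝ) * Real.log n)
        ≤ 2 * ((300000 + 2 ^ 23) * (n : ℝ) ^ 2 * (1 + Real.log n)) ^ 2 *
          (2 * (1 + Real.log n)) := by
          refine mul_le_mul_of_nonneg_left ?_ (by positivity)
          push_cast
          linarith
      _ = _ := by ring
  · intro k _
    obtain ⟨𝓐, hA⟩ : ∃ 𝓐, 𝓐 = 𝓑.filter fun l => k ≤ (crossing 𝓑 l).card := ⟨_, rfl⟩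
    rw [← hA]
    rcases 𝓐.eq_empty_or_nonempty with rfl | hne
    · simp only [Finset.card_empty, Nat.cast_zero, zero_mul]
      positivity
    obtain ⟨S, hS⟩ := exists_sum_card_crossing_le 𝓐 𝓑
    have h1 : 𝓐.card * k ≤ ∑ l ∈ 𝓐, (crossing 𝓑 l).card := by
      rw [← smul_eq_mul]
      refine Finset.card_nsmul_le_sum _ _ _ fun l hl => ?_
      rw [hA] at hl
      exact (Finset.mem_filter.1 hl).2
    have h2 := sum_card_crossPairs_le_sqrt hB (hA ▸ Finset.filter_subset _ _) hne S
    have h3 : ((𝓐.card * k : ℕ) : ℝ) ≤ _ := le_trans (by exact_mod_cast h1.trans hS) h2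
    have hpos : (0 : ℝ) < 𝓐.card := by exact_mod_cast hne.card_pos
    clear h1 h2 hS hA
    push_cast at h3
    generalize (𝓐.card : ℝ) = M at h3 hpos
    have hs := Real.sqrt_pos.2 hpos
    have hss := Real.mul_self_sqrt hpos.le
    generalize √M = s at h3 hs hss
    subst hss
    have h4 : s * k ≤ (300000 + 2 ^ 23) * n ^ 2 * (1 + Real.log n) := by
      refine le_of_mul_le_mul_left ?_ hs
      linarith
    calc s * s * (k : ℝ) ^ 2 = (s * k) ^ 2 := by ring
      _ ≤ _ := pow_le_pow_left₀ (by positivity) h4 2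

/-- Pairs of points of `P` at equal distance from `q` and `q'` respectively. -/
def equidistant (P : Finset (EuclideanSpace ℝ (Fin 2))) (q q' : EuclideanSpace ℝ (Fin 2)) :
    Finset (EuclideanSpace ℝ (Fin 2) × EuclideanSpace ℝ (Fin 2)) :=
  (P ×ˢ P).filter fun y => dist y.1 q = dist y.2 q'

theorem mem_equidistant {P : Finset (EuclideanSpace ℝ (Fin 2))} {q q' : EuclideanSpace ℝ (Fin 2)}
    {y : EuclideanSpace ℝ (Fin 2) × EuclideanSpace ℝ (Fin 2)} :
    y ∈ equidistant P q q' ↔ (y.1 ∈ P ∧ y.2 ∈ P) ∧ dist y.1 q = dist y.2 q' := by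
  rw [equidistant, Finset.mem_filter, Finset.mem_product]

theorem card_equidistant_le (P : Finset (EuclideanSpace ℝ (Fin 2)))
    (q q' : EuclideanSpace ℝ (Fin 2)) :
    (equidistant P q q').card ≤ P.card + (crossing (motionLines P) (motionLine q q')).card := by
  rw [← Finset.card_filter_add_card_filter_not (s := equidistant P q q')
    (fun y => y.1 - q = y.2 - q')]
  refine Nat.add_le_add ?_ ?_
  · refine Finset.card_le_card_of_injOn (fun y => y.1) ?_ ?_
    · intro y hy
      exact (mem_equidistant.1 (Finset.mem_filter.1 hy).1).1.1
    · intro y hy z hz h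
      have h1 := (Finset.mem_filter.1 hy).2
      have h2 := (Finset.mem_filter.1 hz).2
      dsimp only at h
      rw [h, h2] at h1
      exact Prod.ext h (sub_left_injective h1.symm)
  · refine Finset.card_le_card_of_injOn (fun y => motionLine y.1 y.2) ?_ ?_
    · intro y hy
      obtain ⟨hy, hne⟩ := Finset.mem_filter.1 hy
      obtain ⟨⟨h1, h2⟩, hd⟩ := mem_equidistant.1 hy
      refine mem_crossing.2 ⟨mem_motionLines.2 ⟨_, h1, _, h2, rfl⟩, ?_, ?_⟩
      · intro h
        obtain ⟨rfl, rfl⟩ := motionLine_injective h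
        simp at hne
      · rw [Set.inter_comm]
        exact motionLine_inter_nonempty hd hne
    · intro y _ z _ h
      obtain ⟨h1, h2⟩ := motionLine_injective h
      exact Prod.ext h1 h2

theorem sum_card_equidistant_sq_le (P : Finset (EuclideanSpace ℝ (Fin 2))) :
    ∑ y ∈ P ×ˢ P, ((equidistant P y.1 y.2).card : ℝ) ^ 2 ≤
      10 * (300000 + 2 ^ 23) ^ 2 * P.card ^ 4 * (1 + Real.log P.card) ^ 3 := by
  have hlog : 0 ≤ Real.log P.card := Real.log_natCast_nonneg _
  have h1 : ∀ y ∈ P ×ˢ P, ((equidistant P y.1 y.2).card : ℝ) ^ 2 ≤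
      2 * (P.card : ℝ) ^ 2 +
        2 * ((crossing (motionLines P) (motionLine y.1 y.2)).card : ℝ) ^ 2 := by
    intro y _
    have h : ((equidistant P y.1 y.2).card : ℝ) ≤
        P.card + (crossing (motionLines P) (motionLine y.1 y.2)).card := by
      exact_mod_cast card_equidistant_le P y.1 y.2
    have h0 : (0 : ℝ) ≤ (equidistant P y.1 y.2).card := Nat.cast_nonneg _
    generalize ((equidistant P y.1 y.2).card : ℝ) = e at h h0
    generalize ((crossing (motionLines P) (motionLine y.1 y.2)).card : ℝ) = i at h
    nlinarith [pow_le_pow_left₀ h0 h 2, sq_nonneg ((P.card : ℝ) - i)]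
  refine (Finset.sum_le_sum h1).trans ?_
  rw [Finset.sum_add_distrib, Finset.sum_const, ← Finset.mul_sum, Finset.card_product,
    nsmul_eq_mul]
  have h2 := sum_card_crossing_sq_le (wellSpread_motionLines P)
  rw [motionLines, Finset.sum_image (fun y _ z _ h =>
    Prod.ext (motionLine_injective h).1 (motionLine_injective h).2), ← motionLines] at h2
  generalize ∑ y ∈ P ×ˢ P, ((crossing (motionLines P) (motionLine y.1 y.2)).card : ℝ) ^ 2 = T
    at h2 ⊢
  push_cast
  generalize hL : Real.log (P.card : ℝ) = L at h2 hlog ⊢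
  generalize (P.card : ℝ) = n at h2 ⊢
  have h3 : 1 ≤ (1 + L) ^ 3 := one_le_pow₀ (by linarith)
  have h4 : 0 ≤ n ^ 4 := by positivity
  have h5 : n ^ 4 ≤ n ^ 4 * (1 + L) ^ 3 := le_mul_of_one_le_right h4 h3
  nlinarith

/-- The Cauchy–Schwarz inequality relating hinges to pairs of congruent hinges. -/
theorem card_pow_six_le (P : Finset (EuclideanSpace ℝ (Fin 2))) :
    (P.card : ℝ) ^ 6 ≤ ((P ×ˢ P ×ˢ P).image
        (fun x : EuclideanSpace ℝ (Fin 2) × EuclideanSpace ℝ (Fin 2) ×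
            EuclideanSpace ℝ (Fin 2) => (dist x.1 x.2.1, dist x.2.1 x.2.2))).card *
      ∑ y ∈ P ×ˢ P, ((equidistant P y.1 y.2).card : ℝ) ^ 2 := by
  obtain ⟨h, hh⟩ : ∃ h : EuclideanSpace ℝ (Fin 2) × EuclideanSpace ℝ (Fin 2) ×
      EuclideanSpace ℝ (Fin 2) → ℝ × ℝ, h = fun x => (dist x.1 x.2.1, dist x.2.1 x.2.2) :=
    ⟨_, rfl⟩
  rw [← hh]
  have hcard : (P ×ˢ P ×ˢ P).card = P.card ^ 3 := by
    rw [Finset.card_product, Finset.card_product]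
    ring
  have h1 := Finset.card_eq_sum_card_image h (P ×ˢ P ×ˢ P)
  have h2 := sq_sum_le_card_mul_sum_sq (s := (P ×ˢ P ×ˢ P).image h)
    (f := fun z => ((P ×ˢ P ×ˢ P).filter fun x => h x = z).card)
  rw [← h1, hcard] at h2
  have h3 : ∑ z ∈ (P ×ˢ P ×ˢ P).image h, ((P ×ˢ P ×ˢ P).filter fun x => h x = z).card ^ 2 ≤
      ∑ y ∈ P ×ˢ P, (equidistant P y.1 y.2).card ^ 2 := by
    simp only [pow_two, ← Finset.card_product]
    rw [← Finset.card_sigma, ← Finset.card_sigma]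
    refine Finset.card_le_card_of_injOn (fun w => ⟨(w.2.1.2.1, w.2.2.2.1),
      (w.2.1.1, w.2.2.1), (w.2.1.2.2, w.2.2.2.2)⟩) ?_ ?_
    · rintro ⟨z, ⟨p, q, r⟩, p', q', r'⟩ hw
      simp only [Finset.coe_sigma, Set.mem_sigma_iff, Finset.mem_coe, Finset.mem_product,
        Finset.mem_filter, hh] at hw
      obtain ⟨-, ⟨⟨hp, hq, hr⟩, hz⟩, ⟨hp', hq', hr'⟩, hz'⟩ := hw
      have hzz := hz.trans hz'.symm
      simp only [Prod.mk.injEq] at hzz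
      simp only [Finset.coe_sigma, Set.mem_sigma_iff, Finset.mem_coe, Finset.mem_product,
        mem_equidistant]
      exact ⟨⟨hq, hq'⟩, ⟨⟨hp, hp'⟩, hzz.1⟩, ⟨hr, hr'⟩, by
        rw [dist_comm r, dist_comm r', hzz.2]⟩
    · rintro ⟨z, ⟨p, q, r⟩, p', q', r'⟩ hw ⟨z₁, ⟨p₁, q₁, r₁⟩, p₁', q₁', r₁'⟩ hw₁ heq
      simp only [Sigma.mk.injEq, heq_eq_eq, Prod.mk.injEq] at heq
      obtain ⟨⟨rfl, rfl⟩, ⟨rfl, rfl⟩, rfl, rfl⟩ := heq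
      simp only [Finset.coe_sigma, Set.mem_sigma_iff, Finset.mem_coe, Finset.mem_product,
        Finset.mem_filter] at hw hw₁
      obtain rfl := hw.2.1.2.symm.trans hw₁.2.1.2
      rfl
  have h4 : (P.card ^ 3) ^ 2 ≤ ((P ×ˢ P ×ˢ P).image h).card *
      ∑ y ∈ P ×ˢ P, (equidistant P y.1 y.2).card ^ 2 :=
    le_trans (by exact_mod_cast h2) (Nat.mul_le_mul_left _ h3)
  rw [← pow_mul] at h4
  exact_mod_cast h4

/-- **Hinge count lower bound.** There is an absolute constant `c > 0` such that for every
finite set `P` of `n` points in the plane, with `n` sufficiently large, the number of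
distinct hinges, i.e. the cardinality of the image of `P³` under
`(p,q,r) ↦ (‖p−q‖, ‖q−r‖)`, is at least `c · n² / (log n)³`. -/
theorem hinge_count_lower_bound :
    ∃ c : ℝ, 0 < c ∧ ∃ N₀ : ℕ, ∀ n : ℕ, N₀ ≤ n →
      ∀ P : Finset (EuclideanSpace ℝ (Fin 2)), P.card = n →
        c * (n : ℝ) ^ 2 / (Real.log n) ^ 3 ≤
          (((P ×ˢ P ×ˢ P).image
              (fun x : EuclideanSpace ℝ (Fin 2) × EuclideanSpace ℝ (Fin 2) ×
                  EuclideanSpace ℝ (Fin 2) =>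
                (dist x.1 x.2.1, dist x.2.1 x.2.2))).card : ℝ) := by
  refine ⟨(80 * (300000 + 2 ^ 23) ^ 2)⁻¹, by positivity, 3, fun n hn P hP => ?_⟩
  have h1 := card_pow_six_le P
  have h2 := sum_card_equidistant_sq_le P
  rw [hP] at h1 h2
  generalize (((P ×ˢ P ×ˢ P).image
    (fun x : EuclideanSpace ℝ (Fin 2) × EuclideanSpace ℝ (Fin 2) × EuclideanSpace ℝ (Fin 2) =>
      (dist x.1 x.2.1, dist x.2.1 x.2.2))).card) = H at h1 ⊢
  have hn3 : (3 : ℝ) ≤ n := by exact_mod_cast hn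
  have hlog : 1 ≤ Real.log n := by
    rw [Real.le_log_iff_exp_le (by linarith)]
    linarith [Real.exp_one_lt_d9]
  have h3 : (1 + Real.log n) ^ 3 ≤ (2 * Real.log n) ^ 3 :=
    pow_le_pow_left₀ (by linarith) (by linarith) 3
  generalize Real.log n = L at h2 h3 hlog ⊢
  have hL : 0 < L ^ 3 := by positivity
  have h4 : (n : ℝ) ^ 6 ≤ H * (10 * (300000 + 2 ^ 23) ^ 2 * n ^ 4 * (2 * L) ^ 3) := by
    refine h1.trans (mul_le_mul_of_nonneg_left (h2.trans ?_) (Nat.cast_nonneg H))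
    exact mul_le_mul_of_nonneg_left h3 (by positivity)
  rw [div_le_iff₀ hL, inv_mul_le_iff₀ (by positivity)]
  refine le_of_mul_le_mul_left ?_ (by positivity : (0 : ℝ) < n ^ 4)
  linarith

end
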